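/- arXiv:2010.12410 — 6 statements merged into one kernel-verified Lean document; each statement's English description precedes it below -/
import Mathlib

section
/- There exist an absolute constant C > 0 and an absolute constant N₀ such that the following holds for all N ≥ N₀. Let A be a real number with 1 ≤ A ≤ (log N)/(log log N), and let g be a permutation in S_N whose cycle type has largest part at least (√6/(2π))·√N·(log N)·(1 + 1/A). Then the number of irreducible complex characters χ of S_N with χ(g) ≠ 0 is at most C · p(N) · (log N)/N^(1/(2A)). -/
open CategoryTheory

/-- Bessel's inequality for a family of orthogonal functions of the same norm on a finite type,
applied to the indicator function of a set on which each of them is constant. -/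
theorem sum_sq_mul_card_le_of_orthogonal {ι G : Type*} [DecidableEq ι] [Fintype G]
    (F : Finset ι) (f : ι → G → ℝ) (M : ℝ) (hM : 0 < M)
    (horth : ∀ i ∈ F, ∀ j ∈ F, ∑ x, f i x * f j x = if i = j then M else 0)
    (S : Finset G) (w : G) (hS : ∀ i ∈ F, ∀ x ∈ S, f i x = f i w) (hne : S.Nonempty) :
    (∑ i ∈ F, f i w ^ 2) * S.card ≤ M := by
  classical
  set n : ℝ := (S.card : ℝ) with hn
  have hnpos : 0 < n := by rw [hn]; exact_mod_cast hne.card_pos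
  set e : G → ℝ := fun x => if x ∈ S then 1 else 0 with he
  have h1 : ∑ x, e x * e x = n := by simp [he, hn]
  have h2 : ∀ i ∈ F, ∑ x, e x * f i x = n * f i w := by
    intro i hi
    simp only [he, ite_mul, one_mul, zero_mul, Finset.sum_ite_mem, Finset.univ_inter]
    rw [Finset.sum_congr rfl (hS i hi)]
    simp [hn]
  have h3 : ∑ x, (∑ i ∈ F, n * f i w * f i x) * (∑ i ∈ F, n * f i w * f i x)
      = M * n ^ 2 * ∑ i ∈ F, f i w ^ 2 := by
    simp only [Finset.sum_mul_sum]
    rw [Finset.sum_comm, Finset.mul_sum]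
    refine Finset.sum_congr rfl fun i hi => ?_
    rw [Finset.sum_comm]
    have : ∀ j ∈ F, ∑ x, n * f i w * f i x * (n * f j w * f j x)
        = if i = j then M * n ^ 2 * f i w ^ 2 else 0 := by
      intro j hj
      have : ∀ x, n * f i w * f i x * (n * f j w * f j x)
        = n ^ 2 * f i w * f j w * (f i x * f j x) := fun x => by ring
      simp only [this]
      rw [← Finset.mul_sum, horth i hi j hj]
      split_ifs with h
      · subst h; ring
      · simp
    rw [Finset.sum_congr rfl this]
    simp [hi]
  have h4 : ∑ x, e x * (∑ i ∈ F, n * f i w * f i x) = n ^ 2 * ∑ i ∈ F, f i w ^ 2 := by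
    simp only [Finset.mul_sum]
    rw [Finset.sum_comm]
    refine Finset.sum_congr rfl fun i hi => ?_
    have : ∀ x, e x * (n * f i w * f i x) = n * f i w * (e x * f i x) := fun x => by ring
    simp only [this]
    rw [← Finset.mul_sum, h2 i hi]
    ring
  have h5 : 0 ≤ ∑ x, (M * e x - ∑ i ∈ F, n * f i w * f i x) ^ 2 :=
    Finset.sum_nonneg fun x _ => sq_nonneg _
  have h6 : ∑ x, (M * e x - ∑ i ∈ F, n * f i w * f i x) ^ 2
      = M ^ 2 * ∑ x, e x * e x - 2 * M * ∑ x, e x * (∑ i ∈ F, n * f i w * f i x)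
        + ∑ x, (∑ i ∈ F, n * f i w * f i x) * (∑ i ∈ F, n * f i w * f i x) := by
    rw [Finset.mul_sum, Finset.mul_sum, ← Finset.sum_sub_distrib, ← Finset.sum_add_distrib]
    exact Finset.sum_congr rfl fun x _ => by ring
  rw [h6, h1, h3, h4] at h5
  have h7 : 0 ≤ (M * n) * (M - (∑ i ∈ F, f i w ^ 2) * n) := by nlinarith
  have := nonneg_of_mul_nonneg_right h7 (by positivity)
  linarith

/-- In a finite group in which every generator of `⟨g⟩` is conjugate to `g`,
complex characters are rational valued. -/
theorem Representation.exists_rat_character_eq {G V : Type*} [Group G] [Finite G] [AddCommGroup V]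
    [Module ℂ V] [FiniteDimensional ℂ V] (ρ : Representation ℂ G V)
    (hG : ∀ g x : G, Subgroup.zpowers x = Subgroup.zpowers g → IsConj g x) (g : G) :
    ∃ q : ℚ, ρ.character g = q := by
  classical
  induction hn : orderOf g using Nat.strong_induction_on generalizing g with
  | _ n ih =>
    subst hn
    have := Fintype.ofFinite G
    set H := Subgroup.zpowers g with hH
    have hcard : (Nat.card H : ℂ) ≠ 0 := by exact_mod_cast Nat.card_pos.ne'
    let : Invertible (Nat.card H : ℂ) := invertibleOfNonzero hcard
    have key := Representation.card_inv_mul_sum_char_eq_finrank (k := ℂ) (ρ.comp H.subtype)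
    have hsum : ∑ x : H, Representation.character (k := ℂ) (ρ.comp H.subtype) x =
        ∑ x : H, ρ.character (x : G) := rfl
    rw [hsum, inv_mul_eq_iff_eq_mul₀ hcard] at key
    set T : Finset H := Finset.univ.filter fun x => Subgroup.zpowers (x : G) = H with hT
    rw [← Finset.sum_filter_add_sum_filter_not Finset.univ
      (fun x : H => Subgroup.zpowers (x : G) = H)] at key
    have h1 : ∑ x ∈ T, ρ.character (x : G) = T.card * ρ.character g := by
      rw [Finset.sum_congr rfl (g := fun _ => ρ.character g), Finset.sum_const, nsmul_eq_mul]
      intro x hx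
      obtain ⟨c, hc⟩ := isConj_iff.1 (hG g x (by simpa [hT] using hx))
      rw [← hc, Representation.char_conj]
    have h2 : ∀ x : H, ∃ q : ℚ, ¬ Subgroup.zpowers (x : G) = H → ρ.character (x : G) = q := by
      intro x
      by_cases hx : Subgroup.zpowers (x : G) = H
      · exact ⟨0, fun h => absurd hx h⟩
      · have hle : Subgroup.zpowers (x : G) ≤ H := (Subgroup.zpowers_le).2 x.2
        obtain ⟨q, hq⟩ := ih (orderOf (x : G)) (by
          rw [← Nat.card_zpowers, ← Nat.card_zpowers]
          exact Set.ncard_lt_ncard (SetLike.coe_ssubset_coe.2 (lt_of_le_of_ne hle hx))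
            (Set.toFinite _)) x rfl
        exact ⟨q, fun _ => hq⟩
    choose q hq using h2
    rw [h1, Finset.sum_congr rfl (fun x hx => hq x (by simpa using hx))] at key
    have hTpos : (T.card : ℂ) ≠ 0 := by
      have : (⟨g, Subgroup.mem_zpowers g⟩ : H) ∈ T := by simp [hT, hH]
      exact_mod_cast (Finset.card_pos.2 ⟨_, this⟩).ne'
    refine ⟨((Nat.card H : ℚ) *
        (Module.finrank ℂ (Representation.invariants (k := ℂ) (ρ.comp H.subtype)) : ℚ) -
      ∑ x ∈ Finset.univ.filter (fun x : H => ¬ Subgroup.zpowers (x : G) = H), q x) / T.card, ?_⟩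
    push_cast
    rw [eq_div_iff hTpos, ← key]
    ring

theorem isIntegral_trace_of_pow_succ_eq {V : Type*} [AddCommGroup V]
    [Module ℂ V] [FiniteDimensional ℂ V] (f : Module.End ℂ V) (n : ℕ) (hn : 0 < n)
    (hf : f ^ (n + 1) = f) : IsIntegral ℤ (LinearMap.trace ℂ V f) := by
  rw [Module.End.trace_eq_sum_roots_charpoly_of_splits (IsAlgClosed.splits _)]
  refine IsIntegral.multiset_sum fun μ hμ => ?_
  have hev : f.HasEigenvalue μ :=
    (Module.End.hasEigenvalue_iff_isRoot_charpoly f μ).2 (Polynomial.isRoot_of_mem_roots hμ)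
  obtain ⟨v, hv⟩ := hev.exists_hasEigenvector
  have h1 := hv.pow_apply (n + 1)
  rw [hf, hv.apply_eq_smul] at h1
  have h2 : μ = μ ^ (n + 1) := smul_left_injective ℂ hv.2 h1
  refine ⟨Polynomial.X ^ (n + 1) - Polynomial.X, ?_, ?_⟩
  · refine Polynomial.monic_X_pow_sub ?_
    rw [Polynomial.degree_X]
    exact_mod_cast Nat.lt_add_of_pos_left hn
  · simp [← h2]

theorem Equiv.Perm.cycleType_pow_of_coprime {α : Type*} [Fintype α] [DecidableEq α]
    (σ : Equiv.Perm α) {n : ℕ} (h : n.Coprime (orderOf σ)) : (σ ^ n).cycleType = σ.cycleType := by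
  induction σ using Equiv.Perm.cycle_induction_on with
  | base_one => simp
  | base_cycles σ hσ =>
    obtain ⟨m, hm⟩ := exists_pow_eq_self_of_coprime h
    have hs := Equiv.Perm.support_pow_coprime h
    have h1 : (σ ^ n).IsCycle := by
      refine Equiv.Perm.IsCycle.of_pow (n := m) (by rwa [hm]) (by rw [hm, hs])
    rw [h1.cycleType, hσ.cycleType, hs]
  | induction_disjoint σ τ hd hc h1 h2 =>
    rw [hd.orderOf] at h
    rw [hd.commute.mul_pow, (hd.pow_disjoint_pow n n).cycleType_mul, hd.cycleType_mul,
      h1 (h.coprime_dvd_right (Nat.dvd_lcm_left _ _)),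
      h2 (h.coprime_dvd_right (Nat.dvd_lcm_right _ _))]

theorem Equiv.Perm.isConj_of_zpowers_eq {α : Type*} [Fintype α] [DecidableEq α]
    {σ τ : Equiv.Perm α} (h : Subgroup.zpowers τ = Subgroup.zpowers σ) : IsConj σ τ := by
  have hτ : τ ∈ Subgroup.zpowers σ := h ▸ Subgroup.mem_zpowers τ
  obtain ⟨n, rfl⟩ := (mem_powers_iff_mem_zpowers (x := σ)).2 hτ
  have ho : orderOf (σ ^ n) = orderOf σ := by
    rw [← Nat.card_zpowers, ← Nat.card_zpowers, h]
  have hco : n.Coprime (orderOf σ) := by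
    rw [orderOf_pow] at ho
    have hpos := orderOf_pos σ
    have := (Nat.div_eq_self.1 ho).resolve_left hpos.ne'
    rwa [Nat.gcd_comm] at this
  exact (Equiv.Perm.isConj_iff_cycleType_eq).2 (σ.cycleType_pow_of_coprime hco).symm

theorem Representation.isIntegral_average_character {G K V : Type*} [Group G] [Finite G] [Group K]
    [Fintype K] [AddCommGroup V] [Module ℂ V] [FiniteDimensional ℂ V] (ρ : Representation ℂ G V)
    (φ : K →* G) (z : G) (hz : ∀ k, Commute z (φ k)) :
    IsIntegral ℤ ((Fintype.card K : ℂ)⁻¹ * ∑ k, ρ.character (z * φ k)) := by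
  have hK : (Fintype.card K : ℂ) ≠ 0 := by exact_mod_cast Fintype.card_ne_zero
  set P : Module.End ℂ V := (Fintype.card K : ℂ)⁻¹ • ∑ k, ρ (φ k) with hP
  have hmul : ∀ j, ρ (φ j) * P = P := by
    intro j
    rw [hP, mul_smul_comm, Finset.mul_sum]
    congr 1
    simp only [← map_mul]
    exact Fintype.sum_equiv (Equiv.mulLeft j) _ _ fun k => rfl
  have hPP : P * P = P := by
    conv_lhs => enter [1]; rw [hP]
    rw [smul_mul_assoc, Finset.sum_mul, Finset.sum_congr rfl fun j _ => hmul j, Finset.sum_const,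
      Finset.card_univ, ← Nat.cast_smul_eq_nsmul ℂ, smul_smul, inv_mul_cancel₀ hK, one_smul]
  have hcomm : Commute (ρ z) P := by
    rw [hP]
    exact Commute.smul_right (Commute.sum_right _ _ _ fun k _ => (hz k).map ρ) _
  have hf : (ρ z * P) ^ (orderOf z + 1) = ρ z * P := by
    rw [hcomm.mul_pow, ← map_pow, pow_succ, pow_orderOf_eq_one, one_mul,
      (show IsIdempotentElem P from hPP).pow_succ_eq]
  have := isIntegral_trace_of_pow_succ_eq _ _ (orderOf_pos z) hf
  convert this using 1
  have hsum : ρ z * ∑ k, ρ (φ k) = ∑ k, ρ z * ρ (φ k) := Finset.mul_sum _ _ _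
  rw [hP, mul_smul_comm, map_smul, smul_eq_mul, hsum, map_sum]
  simp [Representation.character]

/-- If complex characters of `G` are rational and `χ` does not vanish on the coset `z * φ(K)`,
where `z` centralizes `φ(K)`, then the mean of `χ ^ 2` over this coset is at least one. -/
theorem Representation.card_le_sum_sq_character {G K V : Type*} [Group G] [Finite G] [Group K]
    [Fintype K] [AddCommGroup V] [Module ℂ V] [FiniteDimensional ℂ V] (ρ : Representation ℂ G V)
    (hG : ∀ g x : G, Subgroup.zpowers x = Subgroup.zpowers g → IsConj g x)
    (φ : K →* G) (z : G) (hz : ∀ k, Commute z (φ k)) (h₀ : K) (hne : ρ.character (z * φ h₀) ≠ 0) :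
    (Fintype.card K : ℝ) ≤ ∑ k, (ρ.character (z * φ k)).re ^ 2 := by
  choose q hq using ρ.exists_rat_character_eq hG
  have hinv : ∀ x, ρ.character x⁻¹ = ρ.character x := by
    intro x
    obtain ⟨c, hc⟩ := isConj_iff.1 (hG x x⁻¹ Subgroup.zpowers_inv)
    rw [← hc, Representation.char_conj]
  have hint := (Representation.linHom ρ ρ).isIntegral_average_character φ z hz
  simp only [Representation.char_linHom, hinv, hq] at hint
  set r : ℚ := (Fintype.card K : ℚ)⁻¹ * ∑ k, q (z * φ k) * q (z * φ k) with hr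
  have hint' : IsIntegral ℤ (algebraMap ℚ ℂ r) := by
    convert hint using 1
    simp [hr]
  have hint2 : IsIntegral ℤ r := (isIntegral_algebraMap_iff (algebraMap ℚ ℂ).injective).1 hint'
  obtain ⟨m, hm⟩ := IsIntegrallyClosed.isIntegral_iff.1 hint2
  have hm' : (m : ℚ) = r := by simpa using hm
  have hKpos : (0 : ℚ) < Fintype.card K := by exact_mod_cast Fintype.card_pos
  have hrpos : 0 < r := by
    refine mul_pos (inv_pos.2 hKpos) ?_
    refine Finset.sum_pos' (fun k _ => mul_self_nonneg _) ⟨h₀, Finset.mem_univ _, ?_⟩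
    refine mul_self_pos.2 fun h => hne ?_
    rw [hq, h, Rat.cast_zero]
  have hr1 : 1 ≤ r := by
    rw [← hm'] at hrpos ⊢
    have : 0 < m := by exact_mod_cast hrpos
    exact_mod_cast this
  have hle : (Fintype.card K : ℚ) ≤ ∑ k, q (z * φ k) * q (z * φ k) := by
    rwa [hr, le_inv_mul_iff₀ hKpos, mul_one] at hr1
  have hle' : (Fintype.card K : ℝ) ≤ ∑ k, (q (z * φ k) : ℝ) * (q (z * φ k) : ℝ) := by
    exact_mod_cast hle
  refine hle'.trans (le_of_eq (Finset.sum_congr rfl fun k _ => ?_))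
  rw [hq, Complex.ratCast_re, sq]

open Nat in
/-- The order of the centralizer of a permutation of `n` letters of cycle type `m`. -/
def Multiset.centralizerCard (n : ℕ) (m : Multiset ℕ) : ℕ :=
  (n - m.sum)! * m.prod * ∏ k ∈ m.toFinset, (m.count k)!

open Nat in
theorem Multiset.centralizerCard_cons {n t : ℕ} {m : Multiset ℕ} :
    (t ::ₘ m).centralizerCard n = t * (m.count t + 1) * m.centralizerCard (n - t) := by
  have h : ∏ k ∈ (t ::ₘ m).toFinset, ((t ::ₘ m).count k)!
      = (m.count t + 1) * ∏ k ∈ m.toFinset, (m.count k)! := by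
    have h2 : ∏ k ∈ (t ::ₘ m).toFinset, (m.count k)! = ∏ k ∈ m.toFinset, (m.count k)! := by
      symm
      refine Finset.prod_subset ?_ ?_
      · simp
      · intro x _ hx
        simp [Multiset.count_eq_zero.2 (fun h => hx (Multiset.mem_toFinset.2 h))]
    rw [← h2]
    have ht : t ∈ (t ::ₘ m).toFinset := by simp
    rw [← Finset.mul_prod_erase _ _ ht, ← Finset.mul_prod_erase _ (fun k => (m.count k)!) ht,
      Multiset.count_cons_self, Nat.factorial_succ, mul_assoc]
    congr 2
    refine Finset.prod_congr rfl fun k hk => ?_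
    rw [Multiset.count_cons_of_ne (Finset.ne_of_mem_erase hk)]
  unfold Multiset.centralizerCard
  rw [h, Multiset.sum_cons, Multiset.prod_cons, Nat.sub_sub]
  ring

/-- A weak form of the second orthogonality relation for characters of symmetric groups. -/
theorem sum_sq_character_le_centralizerCard {α : Type} [Fintype α] [DecidableEq α]
    (F : Finset (Equiv.Perm α → ℂ))
    (hF : ∀ χ ∈ F, ∃ V : FDRep ℂ (Equiv.Perm α), Simple V ∧ χ = V.character) (w : Equiv.Perm α) :
    ∑ χ ∈ F, (χ w).re ^ 2 ≤ (w.cycleType.centralizerCard (Fintype.card α) : ℝ) := by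
  classical
  set S : Finset (Equiv.Perm α) := Finset.univ.filter fun x => IsConj w x with hS
  have hSpos : S.Nonempty :=
    ⟨w, by rw [hS, Finset.mem_filter]; exact ⟨Finset.mem_univ _, IsConj.refl w⟩⟩
  have hcl : (S.card : ℝ) * (w.cycleType.centralizerCard (Fintype.card α) : ℝ)
      = Fintype.card (Equiv.Perm α) := by
    have := Equiv.Perm.card_isConj_mul_eq w
    rw [Fintype.card_perm, ← this, ← Nat.cast_mul, Multiset.centralizerCard]
    congr 2
    rw [hS, ← Fintype.card_subtype, ← Nat.card_eq_fintype_card]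
    rfl
  have hMpos : (0 : ℝ) < Fintype.card (Equiv.Perm α) := by exact_mod_cast Fintype.card_pos
  have hbessel := sum_sq_mul_card_le_of_orthogonal F (fun χ x => (χ x).re)
    (Fintype.card (Equiv.Perm α)) hMpos ?_ S w ?_ hSpos
  · rw [← hcl, mul_comm (S.card : ℝ)] at hbessel
    exact le_of_mul_le_mul_right hbessel (by exact_mod_cast hSpos.card_pos)
  · intro χ hχ ψ hψ
    obtain ⟨V, hV, rfl⟩ := hF χ hχ
    obtain ⟨W, hW, rfl⟩ := hF ψ hψ
    have hG : ∀ g x : Equiv.Perm α, Subgroup.zpowers x = Subgroup.zpowers g → IsConj g x :=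
      fun g x => Equiv.Perm.isConj_of_zpowers_eq
    have hrat : ∀ (U : FDRep ℂ (Equiv.Perm α)) x, ((U.character x).re : ℂ) = U.character x := by
      intro U x
      obtain ⟨q, hq⟩ := Representation.exists_rat_character_eq U.ρ hG x
      have hq' : U.character x = q := hq
      rw [hq', Complex.ratCast_re, Complex.ofReal_ratCast]
    have hinv : ∀ x, W.character x⁻¹ = W.character x := by
      intro x
      obtain ⟨c, hc⟩ := isConj_iff.1 (hG x x⁻¹ Subgroup.zpowers_inv)
      rw [← hc, FDRep.char_conj]
    have hne : (Nat.card (Equiv.Perm α) : ℂ) ≠ 0 := by exact_mod_cast Nat.card_pos.ne'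
    let : Invertible (Nat.card (Equiv.Perm α) : ℂ) := invertibleOfNonzero hne
    have horth := FDRep.char_orthonormal V W
    rw [inv_mul_eq_iff_eq_mul₀ hne] at horth
    have hz : ((∑ x, (V.character x).re * (W.character x).re : ℝ) : ℂ)
        = ∑ x, V.character x * W.character x⁻¹ := by
      push_cast
      exact Finset.sum_congr rfl fun x _ => by rw [hrat, hrat, hinv]
    rw [horth] at hz
    apply Complex.ofReal_injective
    rw [hz]
    by_cases hiso : Nonempty (V ≅ W)
    · rw [if_pos hiso, if_pos (FDRep.char_iso hiso.some)]
      simp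
    · have hdiff : V.character ≠ W.character := by
        intro h
        rw [if_neg hiso, mul_zero] at hz
        have h0 : ∑ x, (V.character x).re * (W.character x).re = 0 := by exact_mod_cast hz
        rw [h] at h0
        have hself := FDRep.char_orthonormal W W
        rw [inv_mul_eq_iff_eq_mul₀ hne, if_pos ⟨Iso.refl W⟩, mul_one] at hself
        refine hne ?_
        rw [← hself, ← Complex.ofReal_zero, ← h0]
        push_cast
        exact Finset.sum_congr rfl fun x _ => by rw [hrat, hinv]
      rw [if_neg hiso, if_neg hdiff]
      simp
  · intro χ hχ x hx
    obtain ⟨V, hV, rfl⟩ := hF χ hχ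
    obtain ⟨c, hc⟩ := isConj_iff.1 (Finset.mem_filter.1 hx).2
    rw [← hc, FDRep.char_conj]

theorem sum_mul_centralizerCard_le {α : Type*} [Fintype α] [DecidableEq α]
    (f : (Fintype.card α).Partition → ℕ) :
    ∑ k : Equiv.Perm α, f k.partition * k.cycleType.centralizerCard (Fintype.card α)
      ≤ Fintype.card (Equiv.Perm α) * ∑ μ, f μ := by
  classical
  rw [← Finset.sum_fiberwise Finset.univ Equiv.Perm.partition, Finset.mul_sum]
  refine Finset.sum_le_sum fun μ _ => ?_
  rcases (Finset.univ.filter fun k : Equiv.Perm α => k.partition = μ).eq_empty_or_nonempty with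
    he | ⟨k₀, hk₀⟩
  · rw [he]; simp
  · have hk₀' : k₀.partition = μ := (Finset.mem_filter.1 hk₀).2
    have hcard := Equiv.Perm.card_isConj_mul_eq k₀
    rw [Finset.sum_congr rfl
      (g := fun _ => f μ * k₀.cycleType.centralizerCard (Fintype.card α)), Finset.sum_const,
      smul_eq_mul, Fintype.card_perm, ← hcard]
    · refine le_of_eq ?_
      have : (Finset.univ.filter fun k : Equiv.Perm α => k.partition = μ).card
          = Nat.card {h : Equiv.Perm α | IsConj k₀ h} := by
        rw [← Fintype.card_subtype, ← Nat.card_eq_fintype_card]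
        refine Nat.card_congr (Equiv.subtypeEquivRight fun k => ?_)
        rw [← hk₀', eq_comm, ← Equiv.Perm.partition_eq_of_isConj]
        rfl
      rw [this, Multiset.centralizerCard]
      ring
    · intro k hk
      have hkμ : k.partition = μ := (Finset.mem_filter.1 hk).2
      have : k.cycleType = k₀.cycleType := by
        rw [← Equiv.Perm.isConj_iff_cycleType_eq, Equiv.Perm.partition_eq_of_isConj, hkμ, hk₀']
      rw [hkμ, this]

/-- If `g` has a cycle of length `t`, the number of irreducible characters not vanishing at `g` is
at most `t * ∑ μ, (mₜ(μ) + 1)`, where `μ` runs through the partitions of `card α - t` and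
`mₜ(μ)` is the multiplicity of `t` in `μ`. -/
theorem card_nonvanishing_characters_le {α : Type} [Fintype α] [DecidableEq α]
    (g : Equiv.Perm α) {t : ℕ} (ht : t ∈ g.cycleType) (F : Finset (Equiv.Perm α → ℂ))
    (hF : ∀ χ ∈ F, ∃ V : FDRep ℂ (Equiv.Perm α), Simple V ∧ χ = V.character)
    (hne : ∀ χ ∈ F, χ g ≠ 0) :
    F.card ≤ t * ∑ μ : (Fintype.card α - t).Partition, (μ.parts.count t + 1) := by
  classical
  obtain ⟨z, τ, rfl, hd, hzc, hzt⟩ := Equiv.Perm.mem_cycleType_iff.1 ht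
  let K := Equiv.Perm {x // x ∉ z.support}
  let φ : K →* Equiv.Perm α := Equiv.Perm.ofSubtype
  have hdis : ∀ k, z.Disjoint (φ k) := by
    intro k x
    by_cases hx : x ∈ z.support
    · exact Or.inr (Equiv.Perm.ofSubtype_apply_of_not_mem k (by simpa using hx))
    · exact Or.inl (Equiv.Perm.notMem_support.1 hx)
  obtain ⟨h₀, rfl⟩ : ∃ h₀, φ h₀ = τ := by
    have hp : ∀ x, τ x ∉ z.support ↔ x ∉ z.support := by
      intro x
      rcases hd x with h | h
      · have h2 : z (τ x) = τ x := by
          have := congrArg (fun σ : Equiv.Perm α => σ x) hd.commute.eq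
          simpa [h] using this
        simp [h, h2]
      · rw [h]
    refine ⟨τ.subtypePerm hp, Equiv.Perm.ofSubtype_subtypePerm _ fun x hx => ?_⟩
    exact Equiv.Perm.notMem_support.2 ((hd x).resolve_right hx)
  have hcardK : Fintype.card {x // x ∉ z.support} = Fintype.card α - t := by
    rw [Fintype.card_subtype_compl, Fintype.card_coe, hzt]
  have hle : ∀ k, ∑ χ ∈ F, (χ (z * φ k)).re ^ 2
      ≤ ((t * ((k.partition.parts.count t + 1) *
        k.cycleType.centralizerCard (Fintype.card {x // x ∉ z.support})) : ℕ) : ℝ) := by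
    intro k
    refine (sum_sq_character_le_centralizerCard F hF _).trans ?_
    have hct : (z * φ k).cycleType = t ::ₘ k.cycleType := by
      rw [(hdis k).cycleType_mul, hzc.cycleType, hzt, Equiv.Perm.cycleType_ofSubtype]
      rfl
    rw [hct, Multiset.centralizerCard_cons, ← hcardK, mul_assoc]
    have : k.cycleType.count t ≤ k.partition.parts.count t := by
      rw [Equiv.Perm.parts_partition, Multiset.count_add]
      exact Nat.le_add_right _ _
    gcongr
  have hge : ∀ χ ∈ F, (Fintype.card K : ℝ) ≤ ∑ k, (χ (z * φ k)).re ^ 2 := by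
    intro χ hχ
    obtain ⟨V, hV, rfl⟩ := hF χ hχ
    exact Representation.card_le_sum_sq_character V.ρ
      (fun _ _ => Equiv.Perm.isConj_of_zpowers_eq) φ z (fun k => (hdis k).commute) h₀ (hne _ hχ)
  have hmain : (F.card * Fintype.card K : ℝ)
      ≤ ((t * (Fintype.card K * ∑ μ : (Fintype.card {x // x ∉ z.support}).Partition,
        (μ.parts.count t + 1)) : ℕ) : ℝ) := by
    calc (F.card * Fintype.card K : ℝ) = ∑ χ ∈ F, (Fintype.card K : ℝ) := by simp
      _ ≤ ∑ χ ∈ F, ∑ k, (χ (z * φ k)).re ^ 2 := Finset.sum_le_sum hge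
      _ = ∑ k, ∑ χ ∈ F, (χ (z * φ k)).re ^ 2 := Finset.sum_comm
      _ ≤ _ := Finset.sum_le_sum fun k _ => hle k
      _ ≤ _ := by
        rw [← Nat.cast_sum, ← Finset.mul_sum]
        exact_mod_cast Nat.mul_le_mul_left t
          (sum_mul_centralizerCard_le fun μ => μ.parts.count t + 1)
  rw [hcardK] at hmain
  have hmain' : F.card * Fintype.card K ≤
      (t * ∑ μ : (Fintype.card α - t).Partition, (μ.parts.count t + 1)) * Fintype.card K := by
    have : F.card * Fintype.card K ≤ t * (Fintype.card K *
        ∑ μ : (Fintype.card α - t).Partition, (μ.parts.count t + 1)) := by exact_mod_cast hmain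
    exact this.trans (le_of_eq (by ring))
  exact Nat.le_of_mul_le_mul_right hmain' Fintype.card_pos

theorem Nat.Partition.card_filter_mem_parts {n a : ℕ} (ha : 1 ≤ a) (han : a ≤ n) :
    (Finset.univ.filter fun μ : n.Partition => a ∈ μ.parts).card
      = Fintype.card (n - a).Partition := by
  rw [← Fintype.card_subtype]
  exact Fintype.card_congr (Nat.Partition.partitionWithPartEquiv ha han)

theorem Nat.Partition.count_mul_le {n : ℕ} (μ : n.Partition) (a : ℕ) :
    μ.parts.count a * a ≤ n := by
  have h : Multiset.replicate (μ.parts.count a) a ≤ μ.parts :=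
    Multiset.le_count_iff_replicate_le.1 le_rfl
  obtain ⟨u, hu⟩ := Multiset.le_iff_exists_add.1 h
  have := μ.parts_sum
  rw [hu, Multiset.sum_add, Multiset.sum_replicate, smul_eq_mul] at this
  omega

/-- Bound for the sum of multiplicities of the part `t`. -/
theorem Nat.Partition.sum_count_mul_le {n t : ℕ} (ht : 1 ≤ t) (htn : t ≤ n) :
    t * ∑ μ : n.Partition, μ.parts.count t ≤ n * Fintype.card (n - t).Partition := by
  rw [← card_filter_mem_parts ht htn, Finset.card_filter, Finset.mul_sum, Finset.mul_sum]
  refine Finset.sum_le_sum fun μ _ => ?_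
  split_ifs with h
  · rw [mul_one, mul_comm]; exact μ.count_mul_le t
  · rw [Multiset.count_eq_zero.2 h]; simp

theorem Nat.Partition.card_mono : Monotone fun n : ℕ => Fintype.card n.Partition := by
  refine monotone_nat_of_le_succ fun n => ?_
  have := card_filter_mem_parts (n := n + 1) (a := 1) le_rfl (by omega)
  rw [Nat.add_sub_cancel] at this
  rw [← this]
  exact Finset.card_le_univ _

theorem Nat.Partition.card_le_card_filter_le_count {n v j : ℕ} (hv : 1 ≤ v) (h : v * j ≤ n) :
    Fintype.card (n - v * j).Partition
      ≤ (Finset.univ.filter fun μ : n.Partition => j ≤ μ.parts.count v).card := by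
  rw [← Fintype.card_subtype]
  refine Fintype.card_le_of_injective
    (fun μ => ⟨⟨Multiset.replicate j v + μ.parts, ?_, ?_⟩, ?_⟩) ?_
  · intro i hi
    rcases Multiset.mem_add.1 hi with hi | hi
    · rw [Multiset.eq_of_mem_replicate hi]; omega
    · exact μ.parts_pos hi
  · rw [Multiset.sum_add, Multiset.sum_replicate, μ.parts_sum, smul_eq_mul, mul_comm]
    omega
  · rw [Multiset.count_add, Multiset.count_replicate_self]
    exact Nat.le_add_right _ _
  · intro μ ν hμν
    simp only [Subtype.mk.injEq, Nat.Partition.mk.injEq, add_right_inj] at hμν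
    exact Nat.Partition.ext hμν

/-- One direction of the identity `n * p(n) = ∑_{v, j ≥ 1} v * p(n - v * j)`. -/
theorem Nat.Partition.sum_mul_card_le {n : ℕ} (S : Finset (ℕ × ℕ))
    (hS : ∀ q ∈ S, 1 ≤ q.1 ∧ 1 ≤ q.2 ∧ q.1 * q.2 ≤ n) :
    ∑ q ∈ S, q.1 * Fintype.card (n - q.1 * q.2).Partition ≤ n * Fintype.card n.Partition := by
  classical
  calc ∑ q ∈ S, q.1 * Fintype.card (n - q.1 * q.2).Partition
      ≤ ∑ q ∈ S, q.1 * (Finset.univ.filter fun μ : n.Partition => q.2 ≤ μ.parts.count q.1).card :=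
        Finset.sum_le_sum fun q hq =>
          Nat.mul_le_mul_left _ (card_le_card_filter_le_count (hS q hq).1 (hS q hq).2.2)
    _ = ∑ μ : n.Partition, ∑ q ∈ S with q.2 ≤ μ.parts.count q.1, q.1 := by
        simp only [Finset.card_filter, Finset.mul_sum, Finset.sum_filter, mul_ite, mul_one,
          mul_zero]
        exact Finset.sum_comm
    _ ≤ ∑ μ : n.Partition, n := Finset.sum_le_sum fun μ _ => ?_
    _ = n * Fintype.card n.Partition := by simp [mul_comm]
  calc ∑ q ∈ S with q.2 ≤ μ.parts.count q.1, q.1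
      ≤ ∑ q ∈ (μ.parts.toFinset ×ˢ Finset.Icc 1 n) with q.2 ≤ μ.parts.count q.1, q.1 := by
        refine Finset.sum_le_sum_of_subset fun q hq => ?_
        obtain ⟨hq, hc⟩ := Finset.mem_filter.1 hq
        obtain ⟨h1, h2, h3⟩ := hS q hq
        simp only [Finset.mem_filter, Finset.mem_product, Multiset.mem_toFinset, Finset.mem_Icc]
        exact ⟨⟨Multiset.count_pos.1 (by omega), h2, (Nat.le_mul_of_pos_left _ h1).trans h3⟩, hc⟩
    _ ≤ ∑ v ∈ μ.parts.toFinset, μ.parts.count v * v := by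
        rw [Finset.sum_filter, Finset.sum_product]
        refine Finset.sum_le_sum fun v _ => ?_
        simp only
        rw [← Finset.sum_filter, Finset.sum_const, smul_eq_mul]
        refine Nat.mul_le_mul_right _ ?_
        calc _ ≤ (Finset.Icc 1 (μ.parts.count v)).card := Finset.card_le_card fun j hj => by
              simp only [Finset.mem_filter, Finset.mem_Icc] at hj ⊢
              exact ⟨hj.1.1, hj.2⟩
          _ = _ := by simp
    _ = n := by
        conv_rhs => rw [← μ.parts_sum, Finset.sum_multiset_count]
        simp

/-- The value of the series `∑ v * exp (-y * v)`. -/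
noncomputable def expSeriesSum (y : ℝ) : ℝ := Real.exp (-y) / (1 - Real.exp (-y)) ^ 2

theorem hasSum_expSeriesSum {y : ℝ} (hy : 0 < y) :
    HasSum (fun v : ℕ => (v : ℝ) * Real.exp (-(y * v))) (expSeriesSum y) := by
  have h : ‖Real.exp (-y)‖ < 1 := by
    rw [Real.norm_of_nonneg (Real.exp_pos _).le, Real.exp_lt_one_iff]
    linarith
  have e : (fun v : ℕ => (v : ℝ) * Real.exp (-(y * v))) =
      fun v : ℕ => (v : ℝ) * Real.exp (-y) ^ v := by
    ext v
    rw [← Real.exp_nat_mul]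
    congr 2
    ring
  rw [e]
  exact hasSum_coe_mul_geometric_of_norm_lt_one h

theorem expSeriesSum_nonneg (y : ℝ) : 0 ≤ expSeriesSum y := by
  unfold expSeriesSum; positivity

theorem four_mul_expSeriesSum_le {y : ℝ} (hy : 0 < y) :
    4 * expSeriesSum y ≤ expSeriesSum (y / 2) := by
  unfold expSeriesSum
  set q := Real.exp (-(y / 2)) with hq
  have hq2 : Real.exp (-y) = q ^ 2 := by
    rw [hq, ← Real.exp_nat_mul]; congr 1; push_cast; ring
  have hq0 : 0 < q := Real.exp_pos _
  have hq1 : q < 1 := by rw [hq, Real.exp_lt_one_iff]; linarith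
  have h1 : (1 - q ^ 2) ^ 2 = (1 - q) ^ 2 * (1 + q) ^ 2 := by ring
  have h2 : 0 < (1 - q) ^ 2 := by
    have : 0 < 1 - q := by linarith
    positivity
  rw [hq2, h1, ← mul_div_assoc, div_le_div_iff₀ (by positivity) h2]
  have : 0 ≤ q * (1 - q) ^ 2 * (1 - q) ^ 2 := by positivity
  nlinarith

theorem expSeriesSum_le {y : ℝ} (hy : 0 < y) : expSeriesSum y ≤ 1 / y ^ 2 := by
  unfold expSeriesSum
  set q := Real.exp (-(y / 2)) with hq
  have hq2 : Real.exp (-y) = q ^ 2 := by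
    rw [hq, ← Real.exp_nat_mul]; congr 1; push_cast; ring
  have hq0 : 0 < q := Real.exp_pos _
  have hq1 : q < 1 := by rw [hq, Real.exp_lt_one_iff]; linarith
  have hpos : 0 < 1 - q ^ 2 := by nlinarith
  have hs : y / 2 ≤ Real.sinh (y / 2) := Real.self_le_sinh_iff.2 (by linarith)
  have hy1 : q * y ≤ 1 - q ^ 2 := by
    rw [Real.sinh_eq, ← hq] at hs
    have hinv : Real.exp (y / 2) * q = 1 := by rw [hq, ← Real.exp_add]; simp
    nlinarith
  rw [hq2, div_le_div_iff₀ (by positivity) (by positivity), one_mul, ← mul_pow]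
  exact pow_le_pow_left₀ (by positivity) hy1 2

theorem le_expSeriesSum {y : ℝ} (hy : 0 < y) : 1 / y ^ 2 - 1 / y ≤ expSeriesSum y := by
  unfold expSeriesSum
  have h1 : 1 - y ≤ Real.exp (-y) := by linarith [Real.add_one_le_exp (-y)]
  have h2 : Real.exp (-y) < 1 := by rw [Real.exp_lt_one_iff]; linarith
  have h3 : 0 < (1 - Real.exp (-y)) ^ 2 := by
    have : 0 < 1 - Real.exp (-y) := by linarith
    positivity
  have h4 : 1 / y ^ 2 - 1 / y = (1 - y) / y ^ 2 := by field_simp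
  rw [h4]
  calc (1 - y) / y ^ 2 ≤ Real.exp (-y) / y ^ 2 := by gcongr
    _ ≤ _ := by
      gcongr
      linarith

theorem le_sum_filter_mul_exp {u w : ℝ} (hw : 0 < w) (hwu : w ≤ u) {j x M : ℕ} (hj : 1 ≤ j)
    (hxM : x ≤ M) :
    expSeriesSum (u * j) - Real.exp (-((u - w) * x)) * expSeriesSum (w * j) ≤
      ∑ v ∈ Finset.Icc 1 M with v * j ≤ x, (v : ℝ) * Real.exp (-(u * (v * j))) := by
  have hj' : (0 : ℝ) < j := by exact_mod_cast hj
  have h1 := hasSum_expSeriesSum (mul_pos (hw.trans_le hwu) hj')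
  have h2 := (hasSum_expSeriesSum (mul_pos hw hj')).mul_left (Real.exp (-((u - w) * x)))
  set S := (Finset.Icc 1 M).filter fun v => v * j ≤ x with hS
  have h3 : HasSum (fun v => if v ∈ S then (v : ℝ) * Real.exp (-(u * (v * j))) else 0)
      (∑ v ∈ S, (v : ℝ) * Real.exp (-(u * (v * j)))) := by
    convert hasSum_sum_of_ne_finset_zero (s := S) (L := SummationFilter.unconditional ℕ)
      (f := fun v : ℕ => if v ∈ S then (v : ℝ) * Real.exp (-(u * (v * j))) else 0) ?_ using 1
    · exact Finset.sum_congr rfl fun v hv => by rw [if_pos hv]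
    · intro v hv; rw [if_neg hv]
  refine hasSum_le (fun v => ?_) (h1.sub h2) h3
  have e1 : u * j * v = u * (v * j) := by ring
  split_ifs with hv
  · rw [e1]
    have : 0 ≤ Real.exp (-((u - w) * x)) * (v * Real.exp (-(w * j * v))) := by positivity
    linarith
  · rcases Nat.eq_zero_or_pos v with rfl | hvpos
    · simp
    · have hvx : x < v * j := by
        by_contra hcon
        push Not at hcon
        refine hv (Finset.mem_filter.2 ⟨Finset.mem_Icc.2 ⟨hvpos, ?_⟩, hcon⟩)
        exact (Nat.le_mul_of_pos_right _ hj).trans (hcon.trans hxM)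
      have hvx' : (x : ℝ) ≤ v * j := by exact_mod_cast hvx.le
      have : Real.exp (-(u * j * v)) ≤ Real.exp (-((u - w) * x)) * Real.exp (-(w * j * v)) := by
        rw [← Real.exp_add, Real.exp_le_exp]
        nlinarith [mul_le_mul_of_nonneg_left hvx' (sub_nonneg.2 hwu)]
      have hv0 : (0 : ℝ) ≤ v := Nat.cast_nonneg v
      nlinarith [mul_le_mul_of_nonneg_left this hv0]

theorem le_sum_product_mul_exp {u w : ℝ} (hw : 0 < w) (hwu : w ≤ u) {x M : ℕ} (hxM : x ≤ M) :
    Real.exp (u * x) * ∑ j ∈ Finset.Icc 1 M, expSeriesSum (u * j)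
      - Real.exp (w * x) * ∑ j ∈ Finset.Icc 1 M, expSeriesSum (w * j) ≤
      ∑ q ∈ (Finset.Icc 1 M ×ˢ Finset.Icc 1 M) with q.1 * q.2 ≤ x,
        (q.1 : ℝ) * Real.exp (u * ((x - q.1 * q.2 : ℕ) : ℝ)) := by
  rw [Finset.sum_filter, Finset.sum_product_right, Finset.mul_sum, Finset.mul_sum,
    ← Finset.sum_sub_distrib]
  refine Finset.sum_le_sum fun j hj => ?_
  have h := mul_le_mul_of_nonneg_left
    (le_sum_filter_mul_exp hw hwu (Finset.mem_Icc.1 hj).1 hxM) (Real.exp_pos (u * x)).le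
  have e : Real.exp (u * x) * Real.exp (-((u - w) * x)) = Real.exp (w * x) := by
    rw [← Real.exp_add]; congr 1; ring
  rw [mul_sub, ← mul_assoc, e] at h
  refine h.trans (le_of_eq ?_)
  rw [Finset.mul_sum, Finset.sum_filter]
  refine Finset.sum_congr rfl fun v _ => ?_
  simp only
  split_ifs with hv
  · rw [Nat.cast_sub hv, mul_left_comm, ← Real.exp_add]
    push_cast
    congr 2
    ring
  · rfl

/-- Growth of the partition function: if the series `∑ σ(k) exp (-s k)`, truncated suitably, is at
least `N`, then `p(a + x)` is at least a constant times `exp (s x) p(a)` for `a + x ≤ N`. -/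
theorem Nat.Partition.card_mul_exp_le {N : ℕ} {s : ℝ} (hs : 0 < s)
    (hlow : (N : ℝ) ≤ ∑ j ∈ Finset.Icc 1 N, expSeriesSum (s * j))
    (hup : ∑ j ∈ Finset.Icc 1 N, expSeriesSum (s / 4 * j) ≤ 128 * N) {a : ℕ} (x : ℕ)
    (hx : a + x ≤ N) :
    (Fintype.card a.Partition : ℝ) * (Real.exp (s * x) + Real.exp (s / 2 * x))
      ≤ 2 * Real.exp 20 * Fintype.card (a + x).Partition := by
  induction x using Nat.strong_induction_on with
  | _ x ih =>
    rcases le_or_gt (s * x) 20 with hsx | hsx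
    · have hmono : (Fintype.card a.Partition : ℝ) ≤ Fintype.card (a + x).Partition := by
        exact_mod_cast card_mono (Nat.le_add_right a x)
      have h1 : Real.exp (s * x) ≤ Real.exp 20 := Real.exp_le_exp.2 hsx
      have h2 : Real.exp (s / 2 * x) ≤ Real.exp 20 := Real.exp_le_exp.2 (by
        have : 0 ≤ s * x := by positivity
        linarith)
      rw [mul_comm]
      exact mul_le_mul (by linarith) hmono (by positivity) (by positivity)
    · have hxpos : 0 < x := by
        rcases Nat.eq_zero_or_pos x with rfl | h
        · norm_num at hsx
        · exact h
      have hxN : x ≤ N := by omega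
      set S := (Finset.Icc 1 N ×ˢ Finset.Icc 1 N).filter fun q => q.1 * q.2 ≤ x with hS
      have hrec := sum_mul_card_le (n := a + x) S (by
        intro q hq
        simp only [hS, Finset.mem_filter, Finset.mem_product, Finset.mem_Icc] at hq
        exact ⟨hq.1.1.1, hq.1.2.1, by omega⟩)
      have hrec' : ∑ q ∈ S, (q.1 : ℝ) * Fintype.card (a + x - q.1 * q.2).Partition
          ≤ (N : ℝ) * Fintype.card (a + x).Partition := by
        have h1 : ∑ q ∈ S, (q.1 : ℝ) * Fintype.card (a + x - q.1 * q.2).Partition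
          ≤ ((a + x : ℕ) : ℝ) * Fintype.card (a + x).Partition := by exact_mod_cast hrec
        have h2 : ((a + x : ℕ) : ℝ) ≤ N := by exact_mod_cast hx
        exact h1.trans (by gcongr)
      have hstep : (Fintype.card a.Partition : ℝ) *
          (∑ q ∈ S, (q.1 : ℝ) * Real.exp (s * ((x - q.1 * q.2 : ℕ) : ℝ)) +
            ∑ q ∈ S, (q.1 : ℝ) * Real.exp (s / 2 * ((x - q.1 * q.2 : ℕ) : ℝ)))
          ≤ 2 * Real.exp 20 *
            ∑ q ∈ S, (q.1 : ℝ) * Fintype.card (a + x - q.1 * q.2).Partition := by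
        rw [← Finset.sum_add_distrib, Finset.mul_sum, Finset.mul_sum]
        refine Finset.sum_le_sum fun q hq => ?_
        simp only [hS, Finset.mem_filter, Finset.mem_product, Finset.mem_Icc] at hq
        have hpos : 0 < q.1 * q.2 := Nat.mul_pos hq.1.1.1 hq.1.2.1
        have := ih (x - q.1 * q.2) (by omega) (by omega)
        rw [Nat.add_sub_assoc hq.2]
        have := mul_le_mul_of_nonneg_left this (Nat.cast_nonneg (α := ℝ) q.1)
        linarith
      have k1 := le_sum_product_mul_exp (u := s) (w := s / 4) (by positivity) (by linarith) hxN
      have k2 := le_sum_product_mul_exp (u := s / 2) (w := s / 4) (by positivity) (by linarith) hxN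
      rw [← hS] at k1 k2
      have hmid : (4 * N : ℝ) ≤ ∑ j ∈ Finset.Icc 1 N, expSeriesSum (s / 2 * j) := by
        refine (mul_le_mul_of_nonneg_left hlow (by norm_num)).trans ?_
        rw [Finset.mul_sum]
        refine Finset.sum_le_sum fun j hj => ?_
        have hj' : (0 : ℝ) < j := by exact_mod_cast (Finset.mem_Icc.1 hj).1
        have := four_mul_expSeriesSum_le (mul_pos hs hj')
        rwa [show s / 2 * (j : ℝ) = s * j / 2 by ring]
      set E := Real.exp (s / 4 * x) with hE
      have hE86 : 86 ≤ E := by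
        have h5 : Real.exp 5 ≤ E := Real.exp_le_exp.2 (by linarith)
        have h6 : Real.exp 5 = Real.exp 1 ^ 5 := by rw [← Real.exp_nat_mul]; norm_num
        have h7 : (2.7 : ℝ) ^ 5 ≤ Real.exp 1 ^ 5 :=
          pow_le_pow_left₀ (by norm_num) (by linarith [Real.exp_one_gt_d9]) 5
        rw [← h6] at h7
        norm_num at h7
        linarith
      have hE2 : Real.exp (s / 2 * x) = E ^ 2 := by
        rw [hE, ← Real.exp_nat_mul]; congr 1; push_cast; ring
      have hE4 : Real.exp (s * x) = E ^ 4 := by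
        rw [hE, ← Real.exp_nat_mul]; congr 1; push_cast; ring
      rw [hE2, hE4]
      rw [hE4] at k1
      rw [hE2] at k2
      have hNpos : (0 : ℝ) < N := by exact_mod_cast (by omega : 0 < N)
      have hEpos : 0 < E := by linarith
      have l1 : E ^ 4 * N ≤ E ^ 4 * ∑ j ∈ Finset.Icc 1 N, expSeriesSum (s * j) := by gcongr
      have l2 : E ^ 2 * (4 * N) ≤ E ^ 2 * ∑ j ∈ Finset.Icc 1 N, expSeriesSum (s / 2 * j) := by
        gcongr
      have l3 : E * ∑ j ∈ Finset.Icc 1 N, expSeriesSum (s / 4 * j) ≤ E * (128 * N) := by gcongr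
      have l4 : 256 * E * N ≤ 3 * E ^ 2 * N := by
        have : 256 * E ≤ 3 * E ^ 2 := by nlinarith
        gcongr
      have htot : N * (E ^ 4 + E ^ 2) ≤
          ∑ q ∈ S, (q.1 : ℝ) * Real.exp (s * ((x - q.1 * q.2 : ℕ) : ℝ)) +
            ∑ q ∈ S, (q.1 : ℝ) * Real.exp (s / 2 * ((x - q.1 * q.2 : ℕ) : ℝ)) := by
        linarith
      have hA : (0 : ℝ) ≤ Fintype.card a.Partition := Nat.cast_nonneg _
      have hfin := (mul_le_mul_of_nonneg_left htot hA).trans (hstep.trans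
        (mul_le_mul_of_nonneg_left hrec' (by positivity)))
      refine le_of_mul_le_mul_left ?_ hNpos
      linarith

theorem sum_expSeriesSum_mul_le {y : ℝ} (hy : 0 < y) (N : ℕ) :
    ∑ j ∈ Finset.Icc 1 N, expSeriesSum (y * j) ≤ 2 / y ^ 2 := by
  have h1 : ∑ j ∈ Finset.Icc 1 N, 1 / (j : ℝ) ^ 2 ≤ Real.pi ^ 2 / 6 :=
    sum_le_hasSum _ (fun _ _ => by positivity) hasSum_zeta_two
  have h2 : Real.pi ^ 2 / 6 ≤ 2 := by nlinarith [Real.pi_lt_d2, Real.pi_pos]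
  calc ∑ j ∈ Finset.Icc 1 N, expSeriesSum (y * j)
      ≤ ∑ j ∈ Finset.Icc 1 N, 1 / y ^ 2 * (1 / (j : ℝ) ^ 2) := by
        refine Finset.sum_le_sum fun j hj => ?_
        have hj' : (0 : ℝ) < j := by exact_mod_cast (Finset.mem_Icc.1 hj).1
        refine (expSeriesSum_le (mul_pos hy hj')).trans (le_of_eq ?_)
        rw [mul_pow, one_div_mul_one_div]
    _ = 1 / y ^ 2 * ∑ j ∈ Finset.Icc 1 N, 1 / (j : ℝ) ^ 2 := by rw [Finset.mul_sum]
    _ ≤ 1 / y ^ 2 * 2 := by gcongr; exact h1.trans h2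
    _ = 2 / y ^ 2 := by ring

theorem pi_sq_div_six_sub_le_sum {J : ℕ} (hJ : 1 ≤ J) :
    Real.pi ^ 2 / 6 - 1 / J ≤ ∑ j ∈ Finset.Icc 1 J, 1 / (j : ℝ) ^ 2 := by
  rw [sub_le_iff_le_add]
  refine le_of_tendsto hasSum_zeta_two.tendsto_sum_nat ?_
  filter_upwards [Filter.eventually_ge_atTop (J + 1)] with M hM
  obtain ⟨K, rfl⟩ : ∃ K, M = K + 1 := ⟨M - 1, by omega⟩
  have hK : J ≤ K := by omega
  have h := sum_Ioc_inv_sq_le_sub (α := ℝ) (show J ≠ 0 by omega) hK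
  have e : ∑ i ∈ Finset.range (K + 1), 1 / (i : ℝ) ^ 2 =
      ∑ j ∈ Finset.Icc 1 J, 1 / (j : ℝ) ^ 2 + ∑ i ∈ Finset.Ioc J K, ((i : ℝ) ^ 2)⁻¹ := by
    rw [Finset.range_eq_Ico, Finset.sum_eq_sum_Ico_succ_bot (by omega)]
    simp only [one_div]
    have hd : Finset.Ico (0 + 1) (K + 1) = Finset.Icc 1 J ∪ Finset.Ioc J K := by
      ext i; simp only [Finset.mem_Ico, Finset.mem_union, Finset.mem_Icc, Finset.mem_Ioc]; omega
    rw [hd, Finset.sum_union]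
    · simp
    · rw [Finset.disjoint_left]
      intro i
      simp only [Finset.mem_Icc, Finset.mem_Ioc]
      omega
  rw [e, one_div (J : ℝ)]
  have : (0 : ℝ) ≤ (K : ℝ)⁻¹ := by positivity
  linarith

theorem le_sum_expSeriesSum_mul {y : ℝ} (hy : 0 < y) {J N : ℕ} (hJ : 1 ≤ J) (hJN : J ≤ N) :
    1 / y ^ 2 * (Real.pi ^ 2 / 6 - 1 / J - y * (1 + Real.log J)) ≤
      ∑ j ∈ Finset.Icc 1 N, expSeriesSum (y * j) := by
  have h1 := pi_sq_div_six_sub_le_sum hJ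
  have h2 : ∑ j ∈ Finset.Icc 1 J, 1 / (j : ℝ) ≤ 1 + Real.log J := by
    have := harmonic_le_one_add_log J
    rw [harmonic_eq_sum_Icc] at this
    push_cast at this
    simpa only [one_div] using this
  calc 1 / y ^ 2 * (Real.pi ^ 2 / 6 - 1 / J - y * (1 + Real.log J))
      ≤ 1 / y ^ 2 * (∑ j ∈ Finset.Icc 1 J, 1 / (j : ℝ) ^ 2 -
          y * ∑ j ∈ Finset.Icc 1 J, 1 / (j : ℝ)) := by gcongr
    _ = ∑ j ∈ Finset.Icc 1 J, (1 / (y * j) ^ 2 - 1 / (y * j)) := by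
        rw [Finset.mul_sum, ← Finset.sum_sub_distrib, Finset.mul_sum]
        refine Finset.sum_congr rfl fun j hj => ?_
        have hj' : (0 : ℝ) < j := by exact_mod_cast (Finset.mem_Icc.1 hj).1
        field_simp
    _ ≤ ∑ j ∈ Finset.Icc 1 J, expSeriesSum (y * j) := Finset.sum_le_sum fun j hj =>
        le_expSeriesSum (mul_pos hy (by exact_mod_cast (Finset.mem_Icc.1 hj).1))
    _ ≤ _ := Finset.sum_le_sum_of_subset_of_nonneg (Finset.Icc_subset_Icc_right hJN)
        fun _ _ _ => expSeriesSum_nonneg _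

/-- The decay rate `π / √(6 N)` of `p(N - t) / p(N)`, up to a factor `1 - 1 / log N`. -/
noncomputable def partitionRate (N : ℕ) : ℝ :=
  Real.pi / (Real.sqrt 6 * Real.sqrt N) * (1 - 1 / Real.log N)

theorem four_mul_log_sq_le_sqrt {N : ℕ} (hN : 200 ≤ Real.log N) :
    4 * Real.log N ^ 2 ≤ Real.sqrt N := by
  have hN0 : (0 : ℝ) < N := by
    rcases Nat.eq_zero_or_pos N with rfl | h
    · norm_num at hN
    · exact_mod_cast h
  have h1 : Real.sqrt N = Real.exp (Real.log N / 2) := by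
    rw [Real.exp_half, Real.exp_log hN0]
  have h2 := Real.pow_div_factorial_le_exp (Real.log N / 2) (by linarith) 3
  rw [h1]
  refine le_trans ?_ h2
  norm_num [Nat.factorial]
  nlinarith [sq_nonneg (Real.log N)]

theorem partitionRate_pos {N : ℕ} (hN : 200 ≤ Real.log N) : 0 < partitionRate N := by
  have h0 : 0 < Real.sqrt N := by nlinarith [four_mul_log_sq_le_sqrt hN]
  have h1 : 1 / Real.log N ≤ 1 / 200 := by gcongr
  have := Real.pi_pos
  have : 0 < 1 - 1 / Real.log N := by linarith
  unfold partitionRate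
  positivity

theorem natCast_mul_partitionRate_sq {N : ℕ} (hN : 200 ≤ Real.log N) :
    N * partitionRate N ^ 2 = Real.pi ^ 2 / 6 * (1 - 1 / Real.log N) ^ 2 := by
  have h0 : 0 < Real.sqrt N := by nlinarith [four_mul_log_sq_le_sqrt hN]
  have h1 : Real.sqrt N ^ 2 = N := Real.sq_sqrt (Nat.cast_nonneg N)
  have hN0 : (0 : ℝ) < N := by rw [← h1]; positivity
  unfold partitionRate
  rw [mul_pow, div_pow, mul_pow, h1, Real.sq_sqrt (by norm_num)]
  field_simp

theorem natCast_le_sum_expSeriesSum {N : ℕ} (hN : 200 ≤ Real.log N) :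
    (N : ℝ) ≤ ∑ j ∈ Finset.Icc 1 N, expSeriesSum (partitionRate N * j) := by
  have hs := partitionRate_pos hN
  have hr := four_mul_log_sq_le_sqrt hN
  have hNs := natCast_mul_partitionRate_sq hN
  have h1 : Real.sqrt N ^ 2 = N := Real.sq_sqrt (Nat.cast_nonneg N)
  set ℓ := Real.log N with hℓ
  set r := Real.sqrt N with hrdef
  have hr1 : 1 ≤ r := by nlinarith
  have hd0 : 0 < 1 / ℓ := by positivity
  have hd1 : 1 / ℓ ≤ 1 / 200 := by gcongr
  have hJ1 : 1 ≤ ⌈r⌉₊ := Nat.one_le_iff_ne_zero.2 (by positivity)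
  have hJN : ⌈r⌉₊ ≤ N := Nat.ceil_le.2 (by nlinarith)
  refine le_trans ?_ (le_sum_expSeriesSum_mul hs hJ1 hJN)
  have hJ : 1 / (⌈r⌉₊ : ℝ) ≤ 1 / r := by gcongr; exact Nat.le_ceil r
  have hlog : Real.log ⌈r⌉₊ ≤ ℓ :=
    Real.log_le_log (by exact_mod_cast hJ1) (by exact_mod_cast hJN)
  have hs2 : partitionRate N ≤ 2 / r := by
    have h6 : (2 : ℝ) ≤ Real.sqrt 6 := Real.le_sqrt_of_sq_le (by norm_num)
    have hpi := Real.pi_lt_four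
    unfold partitionRate
    calc Real.pi / (Real.sqrt 6 * Real.sqrt N) * (1 - 1 / Real.log N)
        ≤ 4 / (2 * r) * 1 := by
          gcongr
          · linarith
          · rw [← hℓ]; linarith
      _ = 2 / r := by field_simp; norm_num
  have hpi6 : 1 ≤ Real.pi ^ 2 / 6 := by nlinarith [Real.pi_gt_three]
  have hsum : 1 / r + 2 / r * (1 + ℓ) ≤ 1 / ℓ := by
    have : 1 / r + 2 / r * (1 + ℓ) = (3 + 2 * ℓ) / r := by ring
    rw [this, div_le_div_iff₀ (by linarith) (by linarith)]
    nlinarith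
  have hprod : partitionRate N * (1 + Real.log ⌈r⌉₊) ≤ 2 / r * (1 + ℓ) := by
    have : 0 ≤ Real.log ⌈r⌉₊ := Real.log_natCast_nonneg _
    gcongr
  rw [one_div_mul_eq_div, le_div_iff₀ (by positivity), hNs]
  have : Real.pi ^ 2 / 6 * (1 - 1 / ℓ) ^ 2 ≤ Real.pi ^ 2 / 6 * (1 - 1 / ℓ) := by
    gcongr
    nlinarith
  nlinarith

theorem sum_expSeriesSum_le_mul_natCast {N : ℕ} (hN : 200 ≤ Real.log N) :
    ∑ j ∈ Finset.Icc 1 N, expSeriesSum (partitionRate N / 4 * j) ≤ 128 * N := by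
  have hs := partitionRate_pos hN
  refine (sum_expSeriesSum_mul_le (by positivity) N).trans ?_
  have hd1 : 1 / Real.log N ≤ 1 / 200 := by gcongr
  have hpi6 : 1 ≤ Real.pi ^ 2 / 6 := by nlinarith [Real.pi_gt_three]
  have h : 1 / 4 ≤ N * partitionRate N ^ 2 := by
    rw [natCast_mul_partitionRate_sq hN]
    have : 1 / 4 ≤ (1 - 1 / Real.log N) ^ 2 := by nlinarith
    nlinarith
  rw [div_le_iff₀ (by positivity)]
  nlinarith

theorem Nat.Partition.card_sub_le {N t : ℕ} (hN : 200 ≤ Real.log N) (ht : t ≤ N) :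
    (Fintype.card (N - t).Partition : ℝ) ≤
      2 * Real.exp 20 * Real.exp (-(partitionRate N * t)) * Fintype.card N.Partition := by
  have h := card_mul_exp_le (partitionRate_pos hN) (natCast_le_sum_expSeriesSum hN)
    (sum_expSeriesSum_le_mul_natCast hN) (a := N - t) t (by omega)
  rw [Nat.sub_add_cancel ht] at h
  have h2 : (Fintype.card (N - t).Partition : ℝ) * Real.exp (partitionRate N * t) ≤
      2 * Real.exp 20 * Fintype.card N.Partition :=
    le_trans (by gcongr; exact le_add_of_nonneg_right (Real.exp_pos _).le) h
  rw [← le_div_iff₀ (Real.exp_pos _)] at h2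
  refine h2.trans (le_of_eq ?_)
  rw [Real.exp_neg]
  field_simp

/-- If `t ≥ L` with `s L ≥ 1` then `t exp (-s t) ≤ L exp (-s L)`. -/
theorem mul_exp_neg_le_of_le {s L t : ℝ} (hL : 0 < L) (hsL : 1 ≤ s * L) (ht : L ≤ t) :
    t * Real.exp (-(s * t)) ≤ L * Real.exp (-(s * L)) := by
  have h1 : t / L ≤ Real.exp (t / L - 1) := by linarith [Real.add_one_le_exp (t / L - 1)]
  have h2 : t / L - 1 ≤ s * (t - L) := by
    rw [div_sub_one hL.ne', div_le_iff₀ hL]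
    nlinarith [mul_le_mul_of_nonneg_right hsL (sub_nonneg.2 ht)]
  have h3 : t ≤ L * Real.exp (s * (t - L)) := by
    rw [div_le_iff₀' hL] at h1
    exact h1.trans (by gcongr)
  calc t * Real.exp (-(s * t)) ≤ L * Real.exp (s * (t - L)) * Real.exp (-(s * t)) := by gcongr
    _ = L * Real.exp (-(s * L)) := by rw [mul_assoc, ← Real.exp_add]; congr 2; ring

theorem mul_sum_count_add_one_le {N t : ℕ} {A : ℝ} (hN : 200 ≤ Real.log N) (hA : 1 ≤ A)
    (htN : t ≤ N)
    (ht : Real.sqrt 6 / (2 * Real.pi) * Real.sqrt N * Real.log N * (1 + 1 / A) ≤ (t : ℝ)) :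
    2 ≤ t ∧ ((t * ∑ μ : (N - t).Partition, (μ.parts.count t + 1) : ℕ) : ℝ) ≤
      2 * Real.exp 22 * 2 * Fintype.card N.Partition * Real.log N /
        (N : ℝ) ^ ((1 : ℝ) / (2 * A)) := by
  have hr := four_mul_log_sq_le_sqrt hN
  have h1 : Real.sqrt N ^ 2 = N := Real.sq_sqrt (Nat.cast_nonneg N)
  have hp := Real.pi_pos
  have hp3 := Real.pi_gt_three
  have hs := partitionRate_pos hN
  have hcard := fun {t : ℕ} => Nat.Partition.card_sub_le (t := t) hN
  set s := partitionRate N with hsdef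
  set L := Real.sqrt 6 / (2 * Real.pi) * Real.sqrt N * Real.log N * (1 + 1 / A) with hLdef
  set ℓ := Real.log N with hℓ
  set r := Real.sqrt N with hrdef
  set P := ((Fintype.card N.Partition : ℕ) : ℝ) with hP
  have hP0 : 0 ≤ P := Nat.cast_nonneg _
  have hr1 : 1 ≤ r := by nlinarith
  have hN0 : (0 : ℝ) < N := by nlinarith
  have hA0 : 0 < A := by linarith
  have hA1 : 1 / A ≤ 1 := by rw [div_le_one hA0]; exact hA
  have hA2 : 0 < 1 / A := by positivity
  have h6 : Real.sqrt 6 ≤ 3 := Real.sqrt_le_iff.2 ⟨by norm_num, by norm_num⟩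
  have h62 : (2 : ℝ) ≤ Real.sqrt 6 := Real.le_sqrt_of_sq_le (by norm_num)
  have hL0 : 0 < L := by positivity
  have hLr : L ≤ r * ℓ := by
    have : Real.sqrt 6 / (2 * Real.pi) ≤ 1 / 2 := by
      rw [div_le_div_iff₀ (by positivity) (by norm_num)]; linarith
    calc L ≤ 1 / 2 * r * ℓ * (1 + 1) := by rw [hLdef]; gcongr
      _ = r * ℓ := by ring
  have hL2 : 2 ≤ L := by
    have : (1 : ℝ) / 4 ≤ Real.sqrt 6 / (2 * Real.pi) := by
      rw [div_le_div_iff₀ (by norm_num) (by positivity)]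
      linarith [Real.pi_lt_four]
    calc (2 : ℝ) ≤ 1 / 4 * 1 * 200 * (1 + 0) := by norm_num
      _ ≤ L := by rw [hLdef]; gcongr
  have ht2 : 2 ≤ t := by exact_mod_cast hL2.trans ht
  have hsL : s * L = 1 / 2 * (ℓ - 1) * (1 + 1 / A) := by
    rw [hsdef, hLdef, partitionRate, ← hℓ, ← hrdef]
    have : Real.sqrt 6 ≠ 0 := by positivity
    field_simp
  have hsL1 : 1 / 2 * ℓ * (1 + 1 / A) - 1 ≤ s * L := by rw [hsL]; nlinarith
  have hsL2 : 1 ≤ s * L := by nlinarith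
  set B := (N : ℝ) ^ ((1 : ℝ) / (2 * A)) with hB
  have hBexp : B = Real.exp (ℓ * (1 / (2 * A))) := by rw [hB, Real.rpow_def_of_pos hN0]
  have hB1 : 1 ≤ B := by
    rw [hBexp]; exact Real.one_le_exp (by positivity)
  have hrexp : r = Real.exp (ℓ / 2) := by rw [Real.exp_half, Real.exp_log hN0]
  have hexp : Real.exp (-(s * L)) ≤ Real.exp 1 / (r * B) := by
    rw [hrexp, hBexp, ← Real.exp_add, ← Real.exp_sub, Real.exp_le_exp]
    have : ℓ / 2 + ℓ * (1 / (2 * A)) = 1 / 2 * ℓ * (1 + 1 / A) := by field_simp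
    linarith
  have hfirst : (t : ℝ) * Fintype.card (N - t).Partition ≤
      2 * Real.exp 20 * Real.exp 1 * (P * ℓ / B) := by
    calc (t : ℝ) * Fintype.card (N - t).Partition
        ≤ t * (2 * Real.exp 20 * Real.exp (-(s * t)) * P) := by gcongr; exact hcard htN
      _ = 2 * Real.exp 20 * (t * Real.exp (-(s * t))) * P := by ring
      _ ≤ 2 * Real.exp 20 * (L * Real.exp (-(s * L))) * P := by
          have := mul_exp_neg_le_of_le hL0 hsL2 ht
          exact mul_le_mul_of_nonneg_right (mul_le_mul_of_nonneg_left this (by positivity)) hP0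
      _ ≤ 2 * Real.exp 20 * (r * ℓ * (Real.exp 1 / (r * B))) * P := by gcongr
      _ = 2 * Real.exp 20 * Real.exp 1 * (P * ℓ / B) := by field_simp
  have hsecond : ((t * ∑ μ : (N - t).Partition, μ.parts.count t : ℕ) : ℝ) ≤
      2 * Real.exp 20 * Real.exp 2 * (P * ℓ / B) := by
    rcases le_or_gt t (N - t) with h | h
    · have hle := Nat.Partition.sum_count_mul_le (by omega : 1 ≤ t) h
      have h2t : N - t - t = N - 2 * t := by omega
      rw [h2t] at hle
      have hexp2 : Real.exp (-(s * (2 * t : ℕ))) ≤ (Real.exp 1 / (r * B)) ^ 2 := by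
        calc Real.exp (-(s * (2 * t : ℕ))) = Real.exp (-(s * t)) ^ 2 := by
              rw [← Real.exp_nat_mul]; congr 1; push_cast; ring
          _ ≤ Real.exp (-(s * L)) ^ 2 := by gcongr
          _ ≤ _ := by gcongr
      calc ((t * ∑ μ : (N - t).Partition, μ.parts.count t : ℕ) : ℝ)
          ≤ ((N - t : ℕ) : ℝ) * Fintype.card (N - 2 * t).Partition := by exact_mod_cast hle
        _ ≤ N * (2 * Real.exp 20 * Real.exp (-(s * (2 * t : ℕ))) * P) := by
            gcongr
            · omega
            · exact hcard (by omega)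
        _ ≤ r ^ 2 * (2 * Real.exp 20 * (Real.exp 1 / (r * B)) ^ 2 * P) := by
            rw [h1]; gcongr
        _ = 2 * Real.exp 20 * Real.exp 2 * (P * 1 / (B * B)) := by
            have : Real.exp 2 = Real.exp 1 ^ 2 := by rw [← Real.exp_nat_mul]; norm_num
            rw [this]; field_simp
        _ ≤ 2 * Real.exp 20 * Real.exp 2 * (P * ℓ / B) := by
            gcongr
            · linarith
            · exact le_mul_of_one_le_left (by linarith) hB1
    · have h0 : ∑ μ : (N - t).Partition, μ.parts.count t = 0 := by
        refine Finset.sum_eq_zero fun μ _ => ?_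
        have := μ.count_mul_le t
        by_contra hne
        have := Nat.le_mul_of_pos_left t (Nat.pos_of_ne_zero hne)
        omega
      rw [h0]
      simp only [mul_zero, Nat.cast_zero]
      positivity
  refine ⟨ht2, ?_⟩
  have hQ : 0 ≤ P * ℓ / B := by positivity
  have e22 : Real.exp 22 = Real.exp 20 * Real.exp 2 := by rw [← Real.exp_add]; norm_num
  have e12 : Real.exp 1 ≤ Real.exp 2 := Real.exp_le_exp.2 (by norm_num)
  have hmul : Real.exp 20 * Real.exp 1 * (P * ℓ / B) ≤ Real.exp 20 * Real.exp 2 * (P * ℓ / B) := by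
    gcongr
  have hfinal : 2 * Real.exp 22 * 2 * P * ℓ / B = 4 * (Real.exp 20 * Real.exp 2 * (P * ℓ / B)) := by
    rw [e22]; ring
  rw [hfinal, Finset.sum_add_distrib, mul_add, Nat.cast_add]
  have hcardsum : ((t * ∑ _μ : (N - t).Partition, 1 : ℕ) : ℝ) =
      t * Fintype.card (N - t).Partition := by simp
  rw [hcardsum]
  linarith

/-- **Proposition 1.** There exist absolute constants `C > 0` and `N₀` such
that for all `N ≥ N₀`, any real `1 ≤ A ≤ (log N)/(log log N)`, and any permutation
`g ∈ S_N` whose cycle type (fixed points counted as cycles of length 1) has largest part at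
least `(√6/(2π))·√N·(log N)·(1 + 1/A)`, the number of irreducible complex characters `χ` of
`S_N` with `χ(g) ≠ 0` is at most `C · p(N) · (log N)/N^(1/(2A))`. -/
theorem vanishing_characters_of_large_cycle :
    ∃ C : ℝ, 0 < C ∧ ∃ N₀ : ℕ, ∀ N : ℕ, N₀ ≤ N → ∀ A : ℝ, 1 ≤ A →
      A ≤ Real.log N / Real.log (Real.log N) →
      ∀ g : Equiv.Perm (Fin N),
        (∃ t ∈ (Equiv.Perm.partition g).parts,
          Real.sqrt 6 / (2 * Real.pi) * Real.sqrt N * Real.log N * (1 + 1 / A) ≤ (t : ℝ)) →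
        (Set.ncard {χ : Equiv.Perm (Fin N) → ℂ |
            (∃ V : FDRep ℂ (Equiv.Perm (Fin N)), Simple V ∧ χ = V.character) ∧
            χ g ≠ 0} : ℝ) ≤
          C * (Fintype.card (Nat.Partition N) : ℝ) * Real.log N /
            (N : ℝ) ^ ((1 : ℝ) / (2 * A)) := by
  refine ⟨2 * Real.exp 22 * 2, by positivity, ⌈Real.exp 200⌉₊, ?_⟩
  rintro N hN A hA - g ⟨t, htg, ht⟩
  have hlog : 200 ≤ Real.log N := by
    rw [← Real.log_exp 200]
    exact Real.log_le_log (Real.exp_pos _) (Nat.ceil_le.1 hN)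
  have htN : t ≤ N := by
    have h := Multiset.le_sum_of_mem htg
    rwa [Nat.Partition.parts_sum, Fintype.card_fin] at h
  obtain ⟨ht2, hbound⟩ := mul_sum_count_add_one_le hlog hA htN ht
  have htc : t ∈ g.cycleType := by
    rw [Equiv.Perm.parts_partition, Multiset.mem_add] at htg
    refine htg.resolve_right fun h => ?_
    have := Multiset.eq_of_mem_replicate h
    omega
  set X := {χ : Equiv.Perm (Fin N) → ℂ |
    (∃ V : FDRep ℂ (Equiv.Perm (Fin N)), Simple V ∧ χ = V.character) ∧ χ g ≠ 0} with hX
  refine le_trans ?_ hbound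
  by_cases hfin : X.Finite
  · have h := card_nonvanishing_characters_le g htc hfin.toFinset
      (fun χ hχ => ((hfin.mem_toFinset).1 hχ).1) (fun χ hχ => ((hfin.mem_toFinset).1 hχ).2)
    rw [Fintype.card_fin] at h
    rw [Set.ncard_eq_toFinset_card X hfin]
    exact_mod_cast h
  · rw [Set.Infinite.ncard hfin]
    simp only [Nat.cast_zero]
    positivity
end

section
/- Let p be a prime and let N be a positive integer. Let g and h be permutations in S_N such that the cycle type of h is obtained from the cycle type of g by replacing p parts of the same size m by a single part of size p·m (i.e., the multiset of cycle lengths of h is that of g with p copies of m removed and one copy of p·m added). Then for every irreducible complex character χ of S_N, there exists an integer n with χ(g) − χ(h) = p·n. -/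
open CategoryTheory

open Polynomial Equiv.Perm

/-- Multisets of positive integers are determined by the sums of their elements dividing `d`. -/
theorem Multiset.eq_of_sum_map_dvd_eq {s t : Multiset ℕ} (hs : ∀ l ∈ s, 0 < l)
    (ht : ∀ l ∈ t, 0 < l)
    (h : ∀ d, 0 < d → (s.map fun l ↦ if l ∣ d then l else 0).sum =
      (t.map fun l ↦ if l ∣ d then l else 0).sum) : s = t := by
  have key : ∀ (u : Multiset ℕ) (d : ℕ), 0 < d →
      (u.map fun l ↦ if l ∣ d then l else 0).sum =
        u.count d * d + ∑ l ∈ d.properDivisors, u.count l * l := by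
    intro u d hd
    rw [← Finset.sum_cons (f := fun l ↦ u.count l * l) Nat.self_notMem_properDivisors,
      Nat.cons_self_properDivisors hd.ne', Finset.sum_multiset_map_count]
    simp only [smul_eq_mul, mul_ite, mul_zero]
    rw [← Finset.sum_filter]
    apply Finset.sum_subset_zero_on_sdiff
    · intro l
      simp +contextual [hd.ne']
    · intro l hl
      simp only [Nat.mem_divisors, Finset.mem_filter, Multiset.mem_toFinset, Finset.mem_sdiff] at hl
      rw [Multiset.count_eq_zero_of_notMem (by tauto), zero_mul]
    · simp
  ext d
  induction d using Nat.strong_induction_on with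
  | _ d ih =>
    rcases d.eq_zero_or_pos with rfl | hd
    · rw [Multiset.count_eq_zero_of_notMem fun h0 ↦ (hs 0 h0).false,
        Multiset.count_eq_zero_of_notMem fun h0 ↦ (ht 0 h0).false]
    · have h1 := h d hd
      rw [key s d hd, key t d hd, Finset.sum_congr rfl fun l hl ↦ by
        rw [ih l (Nat.mem_properDivisors.mp hl).2]] at h1
      exact Nat.eq_of_mul_eq_mul_right hd (Nat.add_right_cancel h1)

/-- The number of fixed points of `σ ^ j` is the sum of the cycle lengths of `σ` dividing `j`. -/
theorem Equiv.Perm.card_fixed_pow_eq_sum_parts {α : Type*} [Fintype α] [DecidableEq α]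
    (σ : Equiv.Perm α) (j : ℕ) :
    Finset.card {x | (σ ^ j) x = x} =
      (σ.partition.parts.map fun l ↦ if l ∣ j then l else 0).sum := by
  rw [parts_partition, Multiset.map_add, Multiset.sum_add, cycleType_def, Multiset.map_map,
    Multiset.map_replicate, Multiset.sum_replicate, ← Finset.sum_eq_multiset_sum]
  have hsplit := Finset.card_filter_add_card_filter_not
    (s := ({x | (σ ^ j) x = x} : Finset α)) (fun x ↦ x ∈ σ.support)
  rw [← hsplit]
  congr 1
  · rw [Finset.card_eq_sum_card_fiberwise (f := σ.cycleOf) (t := σ.cycleFactorsFinset)]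
    · refine Finset.sum_congr rfl fun c hc ↦ ?_
      have hcyc := (mem_cycleFactorsFinset_iff.mp hc).1
      have hfix : ∀ x ∈ c.support, (σ ^ j) x = x ↔ c.support.card ∣ j := by
        intro x hx
        have hcx : c = σ.cycleOf x := (cycle_is_cycleOf hx hc)
        rw [← cycleOf_pow_apply_self, ← hcx, ← hcyc.orderOf, orderOf_dvd_iff_pow_eq_one]
        exact (hcyc.pow_eq_one_iff' (mem_support.mp hx)).symm
      have hmem : ∀ x, x ∈ σ.support ∧ σ.cycleOf x = c ↔ x ∈ c.support := by
        intro x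
        constructor
        · rintro ⟨hx, rfl⟩
          exact (mem_support_cycleOf_iff).mpr ⟨SameCycle.refl _ _, hx⟩
        · intro hx
          exact ⟨mem_cycleFactorsFinset_support_le hc hx, (cycle_is_cycleOf hx hc).symm⟩
      rw [Finset.filter_filter, Finset.filter_filter]
      simp only [Function.comp_apply]
      split_ifs with hd
      · congr 1
        ext x
        have := hmem x
        have := hfix x
        simp only [Finset.mem_filter, Finset.mem_univ, true_and]
        tauto
      · rw [Finset.card_eq_zero, Finset.filter_eq_empty_iff]
        intro x _
        have := hmem x
        have := hfix x
        tauto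
    · intro x hx
      simp only [Finset.coe_filter, Set.mem_ofPred_eq] at hx
      exact cycleOf_mem_cycleFactorsFinset_iff.mpr hx.2
  · rw [if_pos (one_dvd j), smul_eq_mul, mul_one, ← Finset.card_compl, Finset.filter_filter]
    congr 1
    ext x
    simp only [Finset.mem_filter, Finset.mem_univ, true_and, Finset.mem_compl, notMem_support]
    exact ⟨fun hx ↦ hx.2, fun hx ↦ ⟨pow_apply_eq_self_of_apply_eq_self hx j, hx⟩⟩

theorem Equiv.Perm.isConj_pow_pow_of_sum_parts {α : Type*} [Fintype α] [DecidableEq α]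
    {σ τ : Equiv.Perm α} {i j : ℕ}
    (h : ∀ d, 0 < d → (σ.partition.parts.map fun l ↦ if l ∣ i * d then l else 0).sum =
      (τ.partition.parts.map fun l ↦ if l ∣ j * d then l else 0).sum) :
    IsConj (σ ^ i) (τ ^ j) := by
  rw [partition_eq_of_isConj, Nat.Partition.ext_iff]
  refine Multiset.eq_of_sum_map_dvd_eq (fun _ ↦ Nat.Partition.parts_pos _)
    (fun _ ↦ Nat.Partition.parts_pos _) fun d hd ↦ ?_
  have := h d hd
  simpa only [← card_fixed_pow_eq_sum_parts, pow_mul] using this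

theorem Equiv.Perm.isConj_pow_of_coprime {α : Type*} [Fintype α] [DecidableEq α]
    (σ : Equiv.Perm α) {j : ℕ} (hj : j.Coprime (orderOf σ)) : IsConj (σ ^ j) σ := by
  have : IsConj (σ ^ j) (σ ^ 1) := by
    refine isConj_pow_pow_of_sum_parts fun d _ ↦ congrArg _ (Multiset.map_congr rfl fun l hl ↦ ?_)
    have hl' : l ∣ orderOf σ := by
      rw [parts_partition, Multiset.mem_add] at hl
      rcases hl with hl | hl
      · exact dvd_of_mem_cycleType hl
      · simp [Multiset.eq_of_mem_replicate hl]
    simp only [(hj.symm.coprime_dvd_left hl').dvd_mul_left, one_mul]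
  simpa using this

theorem Equiv.Perm.exists_isConj_pow_of_merge_cycles {α : Type*} [Fintype α] [DecidableEq α]
    {p m : ℕ} (hp : p.Prime) (hm : 0 < m) {g h : Equiv.Perm α}
    (hcycle : h.partition.parts + Multiset.replicate p m = g.partition.parts + {p * m}) :
    ∃ k, IsConj (g ^ p ^ k) (h ^ p ^ k) := by
  obtain ⟨a, r, hr, rfl⟩ := Nat.exists_eq_pow_mul_and_not_dvd hm.ne' p hp.ne_one
  refine ⟨a + 1, isConj_pow_pow_of_sum_parts fun d _ ↦ ?_⟩
  have hsum := congrArg (fun s ↦ (s.map fun l ↦ if l ∣ p ^ (a + 1) * d then l else 0).sum) hcycle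
  simp only [Multiset.map_add, Multiset.sum_add, Multiset.map_replicate, Multiset.sum_replicate,
    Multiset.map_singleton, Multiset.sum_singleton] at hsum
  have hcop : r.Coprime p := ((Nat.Prime.coprime_iff_not_dvd hp).mpr hr).symm
  have hiff : p ^ a * r ∣ p ^ (a + 1) * d ↔ p * (p ^ a * r) ∣ p ^ (a + 1) * d := by
    rw [← mul_assoc, ← pow_succ', Nat.mul_dvd_mul_iff_left (pow_pos hp.pos _)]
    refine ⟨fun hd ↦ ?_, fun hd ↦ mul_dvd_mul (pow_dvd_pow p a.le_succ) hd⟩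
    exact (hcop.pow_right (a + 1)).dvd_of_dvd_mul_left (dvd_of_mul_left_dvd hd)
  simp only [← hiff] at hsum
  split_ifs at hsum <;> simp at hsum <;> omega

theorem Module.End.exists_trace_pow_eq_aeval {K M : Type*} [Field K] [IsAlgClosed K] [CharZero K]
    [AddCommGroup M] [Module K M] [FiniteDimensional K M] {f : Module.End K M} {n : ℕ}
    (hn : n ≠ 0) (hf : f ^ n = 1) {ζ : K} (hζ : IsPrimitiveRoot ζ n) :
    ∃ P : ℤ[X], ∀ j : ℕ, LinearMap.trace K M (f ^ j) = aeval (ζ ^ j) P := by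
  have hss : f.IsSemisimple := by
    refine isSemisimple_of_squarefree_aeval_eq_zero (p := X ^ n - C 1)
      (separable_X_pow_sub_C 1 (Nat.cast_ne_zero.mpr hn) one_ne_zero).squarefree ?_
    simp [hf]
  have hpow : ∀ (μ : K) (x : M), f x = μ • x → ∀ j : ℕ, (f ^ j) x = μ ^ j • x := by
    intro μ x hx j
    induction j with
    | zero => simp
    | succ j ih => rw [pow_succ, Module.End.mul_apply, hx, map_smul, ih, smul_smul, pow_succ']
  let E : Fin n → Submodule K M := fun i ↦ f.eigenspace (ζ ^ (i : ℕ))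
  have hinj : Function.Injective fun i : Fin n ↦ ζ ^ (i : ℕ) := fun a b hab ↦
    Fin.ext (hζ.pow_inj a.2 b.2 hab)
  have htop : iSup E = ⊤ := by
    rw [eq_top_iff, ← hss.iSup_eigenspace_eq_top]
    refine iSup_le fun μ x hx ↦ ?_
    by_cases hx0 : x = 0
    · simp [hx0]
    have hμ : μ ^ n = 1 := by
      have h1 := hpow μ x (Module.End.mem_eigenspace_iff.mp hx) n
      rw [hf, Module.End.one_apply] at h1
      by_contra hne
      apply hx0
      have : (μ ^ n - 1) • x = 0 := by rw [sub_smul, ← h1, one_smul, sub_self]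
      exact (smul_eq_zero.mp this).resolve_left (sub_ne_zero.mpr hne)
    have : NeZero n := ⟨hn⟩
    obtain ⟨i, hi, rfl⟩ := hζ.eq_pow_of_pow_eq_one hμ
    exact Submodule.mem_iSup_of_mem (⟨i, hi⟩ : Fin n) hx
  have hint : DirectSum.IsInternal E :=
    DirectSum.isInternal_submodule_of_iSupIndep_of_iSup_eq_top
      (f.eigenspaces_iSupIndep.comp hinj) htop
  refine ⟨∑ i : Fin n, (Module.finrank K (E i) : ℤ[X]) * X ^ (i : ℕ), fun j ↦ ?_⟩
  have hE : ∀ i, ∀ x ∈ E i, (f ^ j) x = (ζ ^ (i : ℕ)) ^ j • x := fun i x hx ↦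
    hpow _ x (Module.End.mem_eigenspace_iff.mp hx) j
  have hmaps : ∀ i, Set.MapsTo (f ^ j) (E i) (E i) := fun i x hx ↦ by
    rw [SetLike.mem_coe, hE i x hx]
    exact (E i).smul_mem _ hx
  rw [LinearMap.trace_eq_sum_trace_restrict hint hmaps, map_sum]
  refine Finset.sum_congr rfl fun i _ ↦ ?_
  have : (f ^ j).restrict (hmaps i) = (ζ ^ (i : ℕ)) ^ j • LinearMap.id := by
    exact LinearMap.ext fun x ↦ Subtype.ext (hE i x x.2)
  rw [this, map_smul, LinearMap.trace_id]
  simp [mul_comm, pow_right_comm ζ]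

theorem IsPrimitiveRoot.isIntegral_aeval {K : Type*} [CommRing K] {n : ℕ} {ζ : K}
    (hζ : IsPrimitiveRoot ζ n) (hn : 0 < n) (P : ℤ[X]) : IsIntegral ℤ (aeval ζ P) := by
  rw [aeval_eq_sum_range]
  exact IsIntegral.sum _ fun i _ ↦ ((hζ.isIntegral hn).pow i).smul _

theorem IsPrimitiveRoot.exists_int_eq_aeval {K : Type*} [Field K] [CharZero K] {n : ℕ} [NeZero n]
    [IsCyclotomicExtension {n} ℚ K] {ζ : K} (hζ : IsPrimitiveRoot ζ n) (P : ℤ[X])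
    (hP : ∀ j : ℕ, j.Coprime n → aeval (ζ ^ j) P = aeval ζ P) :
    ∃ z : ℤ, aeval ζ P = (z : K) := by
  have := IsCyclotomicExtension.isGalois {n} ℚ K
  have := IsCyclotomicExtension.finiteDimensional {n} ℚ K
  have hbot : aeval ζ P ∈ (⊥ : IntermediateField ℚ K) := by
    rw [IsGalois.mem_bot_iff_fixed]
    intro σ
    have hσ : σ (aeval ζ P) = aeval (σ ζ) P :=
      (aeval_algHom_apply (σ.toAlgHom.restrictScalars ℤ) ζ P).symm
    rw [hσ, ← hζ.autToPow_spec ℚ σ]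
    exact hP _ (ZMod.val_coe_unit_coprime _)
  obtain ⟨q, hq⟩ := IntermediateField.mem_bot.mp hbot
  have hint : IsIntegral ℤ (aeval ζ P) := hζ.isIntegral_aeval (NeZero.pos n) P
  rw [← hq, isIntegral_algebraMap_iff (algebraMap ℚ K).injective] at hint
  obtain ⟨z, rfl⟩ := IsIntegrallyClosed.isIntegral_iff.mp hint
  exact ⟨z, by simp [← hq]⟩

theorem Polynomial.exists_expand_eq_pow_add {p : ℕ} (hp : p.Prime) (P : ℤ[X]) :
    ∃ Q : ℤ[X], expand ℤ p P = P ^ p + C (p : ℤ) * Q := by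
  have := Fact.mk hp
  have : C (p : ℤ) ∣ expand ℤ p P - P ^ p := by
    rw [C_dvd_iff_dvd_coeff]
    intro i
    rw [← ZMod.intCast_zmod_eq_zero_iff_dvd, ← eq_intCast (Int.castRingHom (ZMod p)), ← coeff_map,
      Polynomial.map_sub, map_expand, ZMod.expand_card, Polynomial.map_pow, sub_self, coeff_zero]
  obtain ⟨Q, hQ⟩ := this
  exact ⟨Q, by rw [← hQ]; ring⟩

theorem FDRep.character_eq_of_isConj {k G : Type*} [Field k] [Group G] (V : FDRep k G) {g h : G}
    (hgh : IsConj g h) : V.character g = V.character h := by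
  obtain ⟨c, rfl⟩ := isConj_iff.mp hgh
  exact (V.char_conj g c).symm

theorem FDRep.exists_character_pow_eq_aeval {k G : Type*} [Field k] [IsAlgClosed k] [CharZero k]
    [Group G] (V : FDRep k G) {g : G} {n : ℕ} (hn : n ≠ 0) (hg : g ^ n = 1) {ζ : k}
    (hζ : IsPrimitiveRoot ζ n) :
    ∃ P : ℤ[X], ∀ j : ℕ, V.character (g ^ j) = aeval (ζ ^ j) P := by
  obtain ⟨P, hP⟩ := Module.End.exists_trace_pow_eq_aeval (f := V.ρ g) hn
    (by rw [← map_pow, hg, map_one]) hζ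
  exact ⟨P, fun j ↦ by rw [← hP j, ← map_pow]; rfl⟩

theorem FDRep.exists_character_eq_int {k α : Type*} [Field k] [IsAlgClosed k] [CharZero k]
    [Finite α] (V : FDRep k (Equiv.Perm α)) (g : Equiv.Perm α) :
    ∃ z : ℤ, V.character g = z := by
  classical
  have := Fintype.ofFinite α
  have : NeZero (orderOf g) := ⟨(orderOf_pos g).ne'⟩
  let K := CyclotomicField (orderOf g) ℚ
  have : IsCyclotomicExtension {orderOf g} ℚ K :=
    CyclotomicField.isCyclotomicExtension (orderOf g) ℚ
  have := IsCyclotomicExtension.finiteDimensional {orderOf g} ℚ K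
  have hζ := IsCyclotomicExtension.zeta_spec (orderOf g) ℚ K
  let φ : K →ₐ[ℤ] k := (IsAlgClosed.lift : K →ₐ[ℚ] k).restrictScalars ℤ
  obtain ⟨P, hP⟩ := V.exists_character_pow_eq_aeval (NeZero.ne _) (pow_orderOf_eq_one g)
    (hζ.map_of_injective φ.toRingHom.injective)
  replace hP : ∀ j : ℕ, V.character (g ^ j) =
      φ (aeval (IsCyclotomicExtension.zeta (orderOf g) ℚ K ^ j) P) := fun j ↦ by
    rw [hP, ← aeval_algHom_apply, map_pow]
    rfl
  obtain ⟨z, hz⟩ := hζ.exists_int_eq_aeval P fun j hj ↦ φ.toRingHom.injective <| by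
    have h1 := hP 1
    rw [pow_one, pow_one] at h1
    exact (hP j).symm.trans ((V.character_eq_of_isConj (g.isConj_pow_of_coprime hj)).trans h1)
  refine ⟨z, ?_⟩
  have h1 := hP 1
  rw [pow_one, pow_one] at h1
  exact h1.trans ((congrArg φ hz).trans (map_intCast φ z))

theorem Int.dvd_of_cast_eq_mul_isIntegral {K : Type*} [Field K] [CharZero K] {a b : ℤ}
    (ha : a ≠ 0) {w : K} (hw : IsIntegral ℤ w) (h : (b : K) = a * w) : a ∣ b := by
  have haK : (a : K) ≠ 0 := Int.cast_ne_zero.mpr ha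
  have hq : w = algebraMap ℚ K (b / a) := by
    rw [map_div₀, map_intCast, map_intCast, h, mul_div_cancel_left₀ _ haK]
  rw [hq, isIntegral_algebraMap_iff (algebraMap ℚ K).injective] at hw
  obtain ⟨z, hz⟩ := IsIntegrallyClosed.isIntegral_iff.mp hw
  refine ⟨z, ?_⟩
  have haQ : (a : ℚ) ≠ 0 := Int.cast_ne_zero.mpr ha
  rw [eq_div_iff haQ, eq_intCast] at hz
  exact_mod_cast (hz.symm.trans (mul_comm _ _))

theorem FDRep.int_modEq_of_character_pow_prime {k G : Type*} [Field k] [IsAlgClosed k] [CharZero k]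
    [Group G] [Finite G] {p : ℕ} (hp : p.Prime) (V : FDRep k G) {g : G} {a b : ℤ}
    (ha : V.character g = a) (hb : V.character (g ^ p) = b) : a ≡ b [ZMOD p] := by
  have : NeZero (orderOf g) := ⟨(orderOf_pos g).ne'⟩
  obtain ⟨ζ, hζ⟩ := HasEnoughRootsOfUnity.exists_primitiveRoot k (orderOf g)
  obtain ⟨P, hP⟩ := V.exists_character_pow_eq_aeval (NeZero.ne _) (pow_orderOf_eq_one g) hζ
  obtain ⟨Q, hQ⟩ := P.exists_expand_eq_pow_add hp
  have h1 := hP 1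
  rw [pow_one, pow_one, ha] at h1
  have hexp := hP p
  rw [hb, ← expand_aeval, hQ, map_add, map_mul, map_pow, ← h1, aeval_C] at hexp
  have hdvd : (p : ℤ) ∣ b - a ^ p := by
    refine Int.dvd_of_cast_eq_mul_isIntegral (Int.natCast_ne_zero.mpr hp.ne_zero)
      (hζ.isIntegral_aeval (NeZero.pos _) Q) ?_
    simp [hexp]
  have := Fact.mk hp
  have hfermat : a ^ p ≡ a [ZMOD p] := by
    rw [← ZMod.intCast_eq_intCast_iff, Int.cast_pow, ZMod.pow_card]
  exact hfermat.symm.trans (Int.modEq_iff_dvd.mpr hdvd)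

theorem FDRep.int_modEq_of_character_pow_prime_pow {k α : Type*} [Field k] [IsAlgClosed k]
    [CharZero k] [Finite α] {p : ℕ} (hp : p.Prime) (V : FDRep k (Equiv.Perm α))
    {g : Equiv.Perm α} (e : ℕ) {a b : ℤ}
    (ha : V.character g = a) (hb : V.character (g ^ p ^ e) = b) : a ≡ b [ZMOD p] := by
  induction e generalizing b with
  | zero =>
    rw [pow_zero, pow_one, ha] at hb
    rw [Int.cast_injective hb]
  | succ e ih =>
    obtain ⟨c, hc⟩ := V.exists_character_eq_int (g ^ p ^ e)
    rw [pow_succ, pow_mul] at hb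
    exact (ih hc).trans (V.int_modEq_of_character_pow_prime hp hc hb)

/-- **Lemma 1.** Let `p` be a prime and `N` a positive integer. If the cycle
type of `h ∈ S_N` (fixed points counted as cycles of length 1) is obtained from the cycle
type of `g ∈ S_N` by removing `p` parts equal to `m` and adding one part equal to `p·m`,
then for every irreducible complex character `χ` of `S_N` one has
`χ(g) ≡ χ(h) (mod p)`, i.e. `χ(g) − χ(h) = p·n` for some integer `n`. -/
theorem character_congruence_merge_cycles (p : ℕ) (hp : p.Prime) (N : ℕ) (hN : 0 < N)
    (m : ℕ) (hm : 0 < m) (g h : Equiv.Perm (Fin N))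
    (hcycle : (Equiv.Perm.partition h).parts + Multiset.replicate p m =
      (Equiv.Perm.partition g).parts + {p * m}) :
    ∀ V : FDRep ℂ (Equiv.Perm (Fin N)), Simple V →
      ∃ n : ℤ, V.character g - V.character h = (p : ℂ) * (n : ℂ) := by
  intro V _
  obtain ⟨e, he⟩ := exists_isConj_pow_of_merge_cycles hp hm hcycle
  obtain ⟨a, ha⟩ := V.exists_character_eq_int g
  obtain ⟨b, hb⟩ := V.exists_character_eq_int h
  obtain ⟨c, hc⟩ := V.exists_character_eq_int (g ^ p ^ e)
  have hab : b ≡ a [ZMOD p] :=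
    (V.int_modEq_of_character_pow_prime_pow hp e hb
      ((V.character_eq_of_isConj he).symm.trans hc)).trans
      (V.int_modEq_of_character_pow_prime_pow hp e ha hc).symm
  obtain ⟨n, hn⟩ := hab.dvd
  exact ⟨n, by rw [ha, hb]; exact_mod_cast hn⟩
end

section
/- There exist an absolute constant C > 0 and an absolute constant N₀ such that the following holds for all N ≥ N₀ and every prime p with p ≤ (log N)/(log log N)². For a partition μ of N, let μ̃ denote the unique partition of N in which every part has multiplicity at most p−1 and such that for every positive integer k coprime to p, the sum of the parts of μ̃ of the form k·p^j (over j ≥ 0, counted with multiplicity) equals the sum of the parts of μ of the form k·p^j (counted with multiplicity). Then the number of partitions μ of N for which the largest part of μ̃ does NOT exceed (√6/(2π))·√N·(log N)·(1 + 1/(5p)) is at most C · p(N) · exp(−N^(1/(15p))). -/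
/-- `IsPReduction p μ ν` says that `ν` is the partition obtained from `μ` by repeatedly
replacing `p` equal parts `m` by a single part `p·m`: every part of `ν` has multiplicity at
most `p − 1`, and for every positive `k` coprime to `p` the total sum of parts of the form
`k·p^j` in `ν` agrees with that in `μ`.  (Since all parts are at most `N`, the sum over
`j ∈ {0, …, N}` captures all the nonzero terms of the sum over all `j ≥ 0`.) -/
def IsPReduction (p : ℕ) {N : ℕ} (μ ν : Nat.Partition N) : Prop :=
  (∀ m : ℕ, ν.parts.count m ≤ p - 1) ∧
  ∀ k : ℕ, 0 < k → Nat.Coprime k p →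
    ∑ j ∈ Finset.range (N + 1), k * p ^ j * ν.parts.count (k * p ^ j) =
      ∑ j ∈ Finset.range (N + 1), k * p ^ j * μ.parts.count (k * p ^ j)

open MeasureTheory ProbabilityTheory

/-- `1 - e^{-s i}` as a point of the unit interval. -/
noncomputable def successProb (s : ℝ) (hs : 0 < s) (i : ℕ) : unitInterval :=
  ⟨1 - Real.exp (-(s * i)), by
    have : Real.exp (-(s * i)) ≤ 1 := Real.exp_le_one_iff.2 (by have := hs.le; simp; positivity)
    constructor
    · linarith
    · linarith [Real.exp_pos (-(s * i))]⟩

lemma successProb_ne_zero {s : ℝ} (hs : 0 < s) {i : ℕ} (hi : i ≠ 0) :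
    successProb s hs i ≠ 0 := by
  intro h
  have h1 : (1 - Real.exp (-(s * i)) : ℝ) = 0 := congrArg Subtype.val h
  have h2 : Real.exp (-(s * i)) < 1 := by
    have : (0:ℝ) < i := by exact_mod_cast Nat.pos_of_ne_zero hi
    rw [Real.exp_lt_one_iff]
    simp only [Left.neg_neg_iff]
    positivity
  linarith

lemma geometric_singleton {s : ℝ} (hs : 0 < s) {i : ℕ} (hi : i ≠ 0) (n : ℕ) :
    (geometricMeasure (successProb s hs i)).real {n} =
      Real.exp (-(s * i)) ^ n * (1 - Real.exp (-(s * i))) := by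
  rw [geometricMeasure_real_singleton (successProb_ne_zero hs hi)]
  simp [successProb]

lemma geometric_Ici {s : ℝ} (hs : 0 < s) {i : ℕ} (hi : i ≠ 0) (c : ℕ) :
    (geometricMeasure (successProb s hs i)).real (Set.Ici c) = Real.exp (-(s * i)) ^ c := by
  have h : Set.Ici c = ((Finset.range c : Finset ℕ) : Set ℕ)ᶜ := by
    ext; simp
  rw [h, probReal_compl_eq_one_sub (Finset.measurableSet _),
    ← sum_measureReal_singleton]
  simp_rw [geometric_singleton hs hi]
  rw [← Finset.sum_mul]
  have := geom_sum_mul (Real.exp (-(s * i))) c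
  linarith

/-- The law of a sequence of independent geometric multiplicities. -/
noncomputable def multLaw (s : ℝ) (hs : 0 < s) : Measure (ℕ → ℕ) :=
  Measure.infinitePi fun i => geometricMeasure (successProb s hs i)

instance (s : ℝ) (hs : 0 < s) : IsProbabilityMeasure (multLaw s hs) := by
  unfold multLaw; infer_instance

lemma Nat.Partition.sum_mul_count {N : ℕ} (μ : Nat.Partition N) :
    ∑ i ∈ Finset.Icc 1 N, i * μ.parts.count i = N := by
  have h := Finset.sum_multiset_count_of_subset μ.parts (Finset.Icc 1 N) (by
    intro i hi
    rw [Multiset.mem_toFinset] at hi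
    exact Finset.mem_Icc.2 ⟨μ.parts_pos hi, μ.le_of_mem_parts hi⟩)
  rw [μ.parts_sum] at h
  exact (Finset.sum_congr rfl fun i _ => by simp [mul_comm]).trans h.symm

lemma Nat.Partition.eq_of_count {N : ℕ} {μ ν : Nat.Partition N}
    (h : ∀ i ∈ Finset.Icc 1 N, μ.parts.count i = ν.parts.count i) : μ = ν := by
  apply Nat.Partition.ext
  ext i
  by_cases hi : i ∈ Finset.Icc 1 N
  · exact h i hi
  · have key : ∀ ρ : Nat.Partition N, ρ.parts.count i = 0 := fun ρ =>
      Multiset.count_eq_zero.2 fun hm =>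
        hi (Finset.mem_Icc.2 ⟨ρ.parts_pos hm, ρ.le_of_mem_parts hm⟩)
    rw [key, key]

/-- The cylinder of multiplicity sequences that agree with `μ`. -/
def multCylinder {N : ℕ} (μ : Nat.Partition N) : Set (ℕ → ℕ) :=
  Set.pi (Finset.Icc 1 N) fun i => {μ.parts.count i}

lemma multLaw_multCylinder {s : ℝ} (hs : 0 < s) {N : ℕ} (μ : Nat.Partition N) :
    (multLaw s hs).real (multCylinder μ) =
      Real.exp (-(s * N)) * ∏ i ∈ Finset.Icc 1 N, (1 - Real.exp (-(s * i))) := by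
  rw [multLaw, multCylinder, measureReal_def,
    Measure.infinitePi_pi _ (fun i _ => measurableSet_singleton _), ENNReal.toReal_prod]
  have : ∀ i ∈ Finset.Icc 1 N,
      ((geometricMeasure (successProb s hs i)) {μ.parts.count i}).toReal =
        Real.exp (-(s * (i * μ.parts.count i : ℕ))) * (1 - Real.exp (-(s * i))) := by
    intro i hi
    rw [← measureReal_def, geometric_singleton hs (by have := Finset.mem_Icc.1 hi; omega),
      ← Real.exp_nat_mul]
    congr 2
    push_cast
    ring
  rw [Finset.prod_congr rfl this, Finset.prod_mul_distrib, ← Real.exp_sum]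
  congr 2
  rw [Finset.sum_neg_distrib, ← Finset.mul_sum, ← Nat.cast_sum, μ.sum_mul_count]

lemma ncard_mul_le_multLaw {s : ℝ} (hs : 0 < s) {N : ℕ} (S : Set (Nat.Partition N))
    (E : Set (ℕ → ℕ)) (hE : ∀ μ ∈ S, multCylinder μ ⊆ E) :
    (S.ncard : ℝ) * (Real.exp (-(s * N)) * ∏ i ∈ Finset.Icc 1 N, (1 - Real.exp (-(s * i)))) ≤
      (multLaw s hs).real E := by
  classical
  have hfin : S.Finite := S.toFinite
  have hmeas : ∀ μ : Nat.Partition N, MeasurableSet (multCylinder μ) := fun μ =>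
    MeasurableSet.pi (Finset.countable_toSet _) fun i _ => measurableSet_singleton _
  calc (S.ncard : ℝ) * _ = ∑ μ ∈ hfin.toFinset, (multLaw s hs).real (multCylinder μ) := by
        rw [Finset.sum_congr rfl fun μ _ => multLaw_multCylinder hs μ, Finset.sum_const,
          nsmul_eq_mul, Set.ncard_eq_toFinset_card S hfin]
    _ = (multLaw s hs).real (⋃ μ ∈ hfin.toFinset, multCylinder μ) := by
        rw [measureReal_biUnion_finset _ fun μ _ => hmeas μ]
        intro μ _ ν _ hne
        refine Set.disjoint_left.2 fun ω h1 h2 => hne (Nat.Partition.eq_of_count fun i hi => ?_)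
        have a1 := h1 i (by exact_mod_cast hi)
        have a2 := h2 i (by exact_mod_cast hi)
        simp only [Set.mem_singleton_iff] at a1 a2
        rw [← a1, ← a2]
    _ ≤ _ := measureReal_mono (Set.iUnion₂_subset fun μ hμ => hE μ (by simpa using hμ))

lemma multLaw_forall {s : ℝ} (hs : 0 < s) {m a : ℕ} (idx : Fin m × Fin a → ℕ)
    (hidx : Function.Injective idx) (D : Fin m → Set (Fin a → ℕ)) :
    (multLaw s hs).real {ω | ∀ i, (fun j => ω (idx (i, j))) ∈ D i} =
      ∏ i, (Measure.infinitePi fun j =>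
        geometricMeasure (successProb s hs (idx (i, j)))).real (D i) := by
  have h1 := Measure.map_infinitePi_infinitePi_of_inj
    (P := fun i => geometricMeasure (successProb s hs i)) hidx
  have h2 := Measure.infinitePi_map_curry
    (fun i j => geometricMeasure (successProb s hs (idx (i, j))))
  have hD : ∀ i, MeasurableSet (D i) := fun i => (D i).to_countable.measurableSet
  have h3 := Measure.infinitePi_pi_univ
    (μ := fun i => Measure.infinitePi fun j => geometricMeasure (successProb s hs (idx (i, j))))
    (t := D) hD
  rw [tprod_fintype] at h3
  rw [← h2, ← h1, Measure.map_map (MeasurableEquiv.measurable _) (by fun_prop),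
    Measure.map_apply (by fun_prop) (MeasurableSet.univ_pi hD)] at h3
  have h4 := congrArg ENNReal.toReal h3
  rw [ENNReal.toReal_prod] at h4
  refine Eq.trans ?_ h4
  rw [measureReal_def, multLaw]
  congr 2
  ext ω
  simp only [Set.mem_ofPred_eq, Set.mem_preimage, Set.mem_pi, Set.mem_univ, true_imp_iff]
  rfl

lemma chain_box_sum_le {p a B : ℕ} (hB : a + 1 ≤ B) (g : Fin a → ℕ)
    (hg : ∀ j : Fin a, g j ≤ p ^ (B - 1 - j) / a) :
    ∑ j : Fin a, p ^ (j + 1 : ℕ) * g j ≤ p ^ B := by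
  rcases Nat.eq_zero_or_pos a with rfl | ha
  · simp
  refine Nat.le_of_mul_le_mul_left ?_ ha
  rw [Finset.mul_sum]
  calc ∑ j : Fin a, a * (p ^ (j + 1 : ℕ) * g j) ≤ ∑ _j : Fin a, p ^ B := by
        refine Finset.sum_le_sum fun j _ => ?_
        have h1 : a * g j ≤ p ^ (B - 1 - j) :=
          (Nat.mul_le_mul_left a (hg j)).trans (Nat.mul_div_le _ _)
        calc a * (p ^ (j + 1 : ℕ) * g j) = p ^ (j + 1 : ℕ) * (a * g j) := by ring
          _ ≤ p ^ (j + 1 : ℕ) * p ^ (B - 1 - j) := Nat.mul_le_mul_left _ h1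
          _ = p ^ B := by
            rw [← pow_add]
            congr 1
            have := j.2
            omega
    _ = a * p ^ B := by simp

/-- A lower bound for the probability that the parts `k, kp, …, kp^a` have total size at least
`k p ^ B`. -/
noncomputable def chainTail (s : ℝ) (p k a B : ℕ) : ℝ :=
  Real.exp (-(s * (k * p ^ B))) *
    ∏ j : Fin a, (((p ^ (B - 1 - j) / a + 1 : ℕ) : ℝ) *
      (1 - Real.exp (-(s * (k * p ^ (j + 1 : ℕ))))))

lemma chain_measure_le {s : ℝ} (hs : 0 < s) {p k a B : ℕ} (hp : p ≠ 0) (hk : k ≠ 0)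
    (hB : a + 1 ≤ B) :
    (Measure.infinitePi fun j : Fin (a + 1) =>
      geometricMeasure (successProb s hs (k * p ^ (j : ℕ)))).real
        {x | ∑ j : Fin (a + 1), p ^ (j : ℕ) * x j < p ^ B} ≤ 1 - chainTail s p k a B := by
  classical
  set P := Measure.infinitePi fun j : Fin (a + 1) =>
      geometricMeasure (successProb s hs (k * p ^ (j : ℕ))) with hP
  set D : Set (Fin (a + 1) → ℕ) := {x | ∑ j : Fin (a + 1), p ^ (j : ℕ) * x j < p ^ B}
  have hmeas : ∀ A : Set (Fin (a + 1) → ℕ), MeasurableSet A := fun A =>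
    A.to_countable.measurableSet
  set box : Finset (Fin a → ℕ) :=
    Fintype.piFinset fun j : Fin a => Finset.range (p ^ (B - 1 - j) / a + 1) with hbox
  have hbox_le : ∀ g ∈ box, ∑ j : Fin a, p ^ (j + 1 : ℕ) * g j ≤ p ^ B := fun g hg =>
    chain_box_sum_le hB g fun j => by
      have := Fintype.mem_piFinset.1 hg j
      rw [Finset.mem_range] at this
      omega
  set A : (Fin a → ℕ) → Set (Fin (a + 1) → ℕ) := fun g =>
    Set.pi Set.univ (Fin.cons (Set.Ici (p ^ B - ∑ j : Fin a, p ^ (j + 1 : ℕ) * g j))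
      (fun j => {g j}) : Fin (a + 1) → Set ℕ) with hA
  have hmemA : ∀ g x, x ∈ A g ↔
      p ^ B - ∑ j : Fin a, p ^ (j + 1 : ℕ) * g j ≤ x 0 ∧ ∀ j : Fin a, x j.succ = g j := by
    intro g x
    simp [hA, Set.mem_pi, Fin.forall_fin_succ]
  have hsub : ∀ g ∈ box, A g ⊆ Dᶜ := by
    intro g hg x hx
    obtain ⟨h0, h1⟩ := (hmemA g x).1 hx
    simp only [D, Set.mem_compl_iff, Set.mem_ofPred_eq, not_lt]
    rw [Fin.sum_univ_succ]
    simp only [h1, Fin.val_zero, pow_zero, one_mul, Fin.val_succ]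
    omega
  have hval : ∀ g ∈ box, P.real (A g) = Real.exp (-(s * (k * p ^ B))) *
      ∏ j : Fin a, (1 - Real.exp (-(s * (k * p ^ (j + 1 : ℕ))))) := by
    intro g hg
    have hne : ∀ j : ℕ, k * p ^ j ≠ 0 := fun j => mul_ne_zero hk (pow_ne_zero _ hp)
    rw [measureReal_def, hP, hA, Measure.infinitePi_pi_univ _
      (fun j => Set.to_countable _ |>.measurableSet),
      tprod_fintype, ENNReal.toReal_prod, Fin.prod_univ_succ]
    simp only [Fin.cons_zero, Fin.cons_succ, ← measureReal_def]
    rw [geometric_Ici hs (hne _)]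
    simp_rw [geometric_singleton hs (hne _)]
    rw [Finset.prod_mul_distrib]
    simp_rw [← Real.exp_nat_mul]
    rw [← Real.exp_sum, ← mul_assoc, ← Real.exp_add]
    congr 1
    · congr 1
      have h2 : ((p ^ B - ∑ j : Fin a, p ^ (j + 1 : ℕ) * g j : ℕ) : ℝ) =
          (p : ℝ) ^ B - ∑ j : Fin a, (p : ℝ) ^ (j + 1 : ℕ) * g j := by
        rw [Nat.cast_sub (hbox_le g hg)]
        push_cast
        rfl
      rw [h2]
      have h3 : ∑ j : Fin a, (g j : ℝ) * -(s * ((k * p ^ ((j.succ : Fin (a + 1)) : ℕ) : ℕ) : ℝ)) =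
          -(s * k * ∑ j : Fin a, (p : ℝ) ^ (j + 1 : ℕ) * g j) := by
        rw [Finset.mul_sum, ← Finset.sum_neg_distrib]
        refine Finset.sum_congr rfl fun j _ => ?_
        push_cast [Fin.val_succ]
        ring
      rw [h3]
      simp
      ring
    · refine Finset.prod_congr rfl fun j _ => ?_
      push_cast [Fin.val_succ]
      rfl
  have hdisj : Set.PairwiseDisjoint (box : Set (Fin a → ℕ)) A := by
    intro g _ g' _ hne
    refine Set.disjoint_left.2 fun x h1 h2 => hne (funext fun j => ?_)
    rw [← ((hmemA g x).1 h1).2 j, ((hmemA g' x).1 h2).2 j]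
  have hcompl : chainTail s p k a B ≤ P.real Dᶜ := by
    calc chainTail s p k a B = ∑ g ∈ box, P.real (A g) := by
          rw [Finset.sum_congr rfl hval, Finset.sum_const, nsmul_eq_mul, chainTail,
            Finset.prod_mul_distrib, hbox, Fintype.card_piFinset]
          simp only [Finset.card_range]
          push_cast
          ring
      _ = P.real (⋃ g ∈ box, A g) :=
          (measureReal_biUnion_finset hdisj fun g _ => hmeas _).symm
      _ ≤ P.real Dᶜ := measureReal_mono (Set.iUnion₂_subset hsub)
  rw [probReal_compl_eq_one_sub (hmeas D)] at hcompl
  linarith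

/-- Counting partitions for which none of the chains `kᵢ, kᵢp, …, kᵢp^a` is large. -/
lemma ncard_chains_small_le {s : ℝ} (hs : 0 < s) {N p a B m : ℕ} (hp : p.Prime)
    (hB : a + 1 ≤ B) (k : Fin m → ℕ) (hk0 : ∀ i, k i ≠ 0) (hkinj : Function.Injective k)
    (hkp : ∀ i, (k i).Coprime p) (hkN : ∀ i, k i * p ^ a ≤ N) (t : ℝ)
    (ht : ∀ i, t ≤ chainTail s p (k i) a B) (S : Set (Nat.Partition N))
    (hS : ∀ μ ∈ S, ∀ i, ∑ j ∈ Finset.range (a + 1), p ^ j * μ.parts.count (k i * p ^ j) < p ^ B) :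
    (S.ncard : ℝ) * (Real.exp (-(s * N)) * ∏ i ∈ Finset.Icc 1 N, (1 - Real.exp (-(s * i)))) ≤
      Real.exp (-(m * t)) := by
  have hidx : Function.Injective fun q : Fin m × Fin (a + 1) => k q.1 * p ^ (q.2 : ℕ) := by
    rintro ⟨i, j⟩ ⟨i', j'⟩ h
    simp only at h
    have hv : ∀ i (j : ℕ), (k i * p ^ j).factorization p = j := fun i j => by
      rw [Nat.factorization_mul (hk0 i) (pow_ne_zero _ hp.ne_zero), Finsupp.add_apply,
        Nat.factorization_eq_zero_of_not_dvd fun hd =>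
          hp.one_lt.ne' (Nat.dvd_one.1 ((hkp i) ▸ Nat.dvd_gcd hd dvd_rfl)),
        hp.factorization_pow, Finsupp.single_eq_same, zero_add]
    have hj : (j : ℕ) = j' := by rw [← hv i j, h, hv]
    rw [hj] at h
    have hi := hkinj (Nat.eq_of_mul_eq_mul_right (pow_pos hp.pos _) h)
    rw [hi, Fin.ext hj]
  set D : Set (Fin (a + 1) → ℕ) := {x | ∑ j : Fin (a + 1), p ^ (j : ℕ) * x j < p ^ B}
  refine (ncard_mul_le_multLaw hs S
    {ω | ∀ i : Fin m, (fun j : Fin (a + 1) => ω (k i * p ^ (j : ℕ))) ∈ D} ?_).trans ?_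
  · intro μ hμ ω hω i
    have h := hS μ hμ i
    rw [Finset.sum_range] at h
    refine lt_of_eq_of_lt (Finset.sum_congr rfl fun j _ => ?_) h
    have hmem : k i * p ^ (j : ℕ) ∈ Finset.Icc 1 N := by
      refine Finset.mem_Icc.2 ⟨Nat.pos_of_ne_zero
        (mul_ne_zero (hk0 i) (pow_ne_zero _ hp.ne_zero)), le_trans ?_ (hkN i)⟩
      exact Nat.mul_le_mul_left _ (Nat.pow_le_pow_right hp.pos (by have := j.2; omega))
    have := hω _ (by exact_mod_cast hmem)
    simp only [Set.mem_singleton_iff] at this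
    rw [← this]
  · rw [multLaw_forall hs (fun q : Fin m × Fin (a + 1) => k q.1 * p ^ (q.2 : ℕ)) hidx
      fun _ => D]
    calc _ ≤ ∏ _i : Fin m, Real.exp (-t) := by
          refine Finset.prod_le_prod (fun _ _ => measureReal_nonneg) fun i _ => ?_
          refine (chain_measure_le hs hp.ne_zero (hk0 i) hB).trans ?_
          have := Real.add_one_le_exp (-t)
          linarith [ht i]
      _ = _ := by
          rw [Finset.prod_const, ← Real.exp_nat_mul]
          simp

lemma sum_exp_neg_le {x : ℝ} (hx : 0 < x) (N : ℕ) :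
    ∑ i ∈ Finset.Icc 1 N, Real.exp (-(x * i)) ≤ 1 / x := by
  have hy1 : Real.exp (-x) < 1 := by simpa using hx
  have h1 : ∀ M : ℕ, (∑ i ∈ Finset.Icc 1 M, Real.exp (-(x * i))) * (1 - Real.exp (-x)) =
      Real.exp (-x) * (1 - Real.exp (-(x * M))) := by
    intro M
    induction M with
    | zero => simp
    | succ M ih =>
      rw [Finset.sum_Icc_succ_top (by omega), add_mul, ih]
      have : Real.exp (-(x * (M + 1 : ℕ))) = Real.exp (-x) * Real.exp (-(x * M)) := by
        rw [← Real.exp_add]; congr 1; push_cast; ring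
      rw [this]; ring
  have h2 : x * Real.exp (-x) ≤ 1 - Real.exp (-x) := by
    have := Real.add_one_le_exp x
    have h3 : Real.exp x * Real.exp (-x) = 1 := by rw [← Real.exp_add]; simp
    nlinarith [Real.exp_pos (-x)]
  rw [le_div_iff₀ hx]
  have hpos : 0 < 1 - Real.exp (-x) := by linarith
  have hle : Real.exp (-x) * (1 - Real.exp (-(x * N))) ≤ Real.exp (-x) := by
    nlinarith [Real.exp_pos (-x), Real.exp_pos (-(x * N))]
  have hS : ∑ i ∈ Finset.Icc 1 N, Real.exp (-(x * i)) ≤ Real.exp (-x) / (1 - Real.exp (-x)) := by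
    rw [le_div_iff₀ hpos, h1]; exact hle
  calc _ ≤ Real.exp (-x) / (1 - Real.exp (-x)) * x := by gcongr
    _ ≤ 1 := by rw [div_mul_eq_mul_div, div_le_one hpos]; linarith

lemma exp_neg_zeta_div_le_prod {s : ℝ} (hs : 0 < s) (N : ℕ) :
    Real.exp (-(Real.pi ^ 2 / 6 / s)) ≤ ∏ i ∈ Finset.Icc 1 N, (1 - Real.exp (-(s * i))) := by
  have hlt : ∀ i ∈ Finset.Icc 1 N, Real.exp (-(s * i)) < 1 := by
    intro i hi
    have : (0 : ℝ) < i := by exact_mod_cast (Finset.mem_Icc.1 hi).1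
    rw [Real.exp_lt_one_iff]
    simp only [Left.neg_neg_iff]
    positivity
  have hsum := hasSum_sum (s := Finset.Icc 1 N) fun i hi =>
    Real.hasSum_pow_div_log_of_abs_lt_one
      (x := Real.exp (-(s * i))) (by rw [abs_of_pos (Real.exp_pos _)]; exact hlt i hi)
  have hz : HasSum (fun n : ℕ => (1 : ℝ) / ((n + 1 : ℕ) : ℝ) ^ 2) (Real.pi ^ 2 / 6) := by
    have := (hasSum_nat_add_iff' (f := fun n : ℕ => (1 : ℝ) / (n : ℝ) ^ 2) 1).2 hasSum_zeta_two
    simpa using this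
  have hle := hasSum_le (fun k : ℕ => ?_) hsum (hz.div_const s)
  · rw [← Real.exp_log (Finset.prod_pos fun i hi => sub_pos.2 (hlt i hi)), Real.exp_le_exp,
      Real.log_prod fun i hi => (sub_pos.2 (hlt i hi)).ne']
    rw [Finset.sum_neg_distrib] at hle
    linarith
  · rw [← Finset.sum_div]
    have h := sum_exp_neg_le (x := s * (k + 1)) (by positivity) N
    have h2 : ∑ i ∈ Finset.Icc 1 N, Real.exp (-(s * i)) ^ (k + 1) ≤ 1 / (s * (k + 1)) := by
      refine le_of_eq_of_le (Finset.sum_congr rfl fun i _ => ?_) h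
      rw [← Real.exp_nat_mul]
      congr 1
      push_cast
      ring
    calc _ ≤ 1 / (s * (k + 1)) / (k + 1) := by gcongr
      _ = _ := by push_cast; field_simp

lemma card_partition_sub_le {n k v : ℕ} (hv : 0 < v) (h : k * v ≤ n) :
    Fintype.card (Nat.Partition (n - k * v)) ≤
      (Finset.univ.filter fun μ : Nat.Partition n => k ≤ μ.parts.count v).card := by
  classical
  let F : Nat.Partition (n - k * v) → Nat.Partition n := fun ρ =>
    { parts := ρ.parts + Multiset.replicate k v
      parts_pos := by
        intro i hi
        rcases Multiset.mem_add.1 hi with hi | hi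
        · exact ρ.parts_pos hi
        · rw [Multiset.eq_of_mem_replicate hi]; exact hv
      parts_sum := by
        rw [Multiset.sum_add, ρ.parts_sum, Multiset.sum_replicate, smul_eq_mul]
        omega }
  refine Finset.card_le_card_of_injOn F (fun ρ _ => ?_) fun ρ _ ρ' _ h => ?_
  · simp [F]
  · apply Nat.Partition.ext
    have := congrArg Nat.Partition.parts h
    simpa [F] using this

/-- The inequality in Euler's recurrence `∑ v p(n - k v) = n p(n)`. -/
lemma sum_card_partition_le {n : ℕ} (Q : Finset (ℕ × ℕ))
    (hQ : ∀ q ∈ Q, 0 < q.1 ∧ 0 < q.2 ∧ q.1 * q.2 ≤ n) :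
    ∑ q ∈ Q, q.2 * Fintype.card (Nat.Partition (n - q.1 * q.2)) ≤
      n * Fintype.card (Nat.Partition n) := by
  classical
  calc _ ≤ ∑ q ∈ Q, q.2 *
        (Finset.univ.filter fun μ : Nat.Partition n => q.1 ≤ μ.parts.count q.2).card :=
        Finset.sum_le_sum fun q hq => Nat.mul_le_mul_left _
          (card_partition_sub_le (hQ q hq).2.1 (hQ q hq).2.2)
    _ = ∑ μ : Nat.Partition n, ∑ q ∈ Q, if q.1 ≤ μ.parts.count q.2 then q.2 else 0 := by
        rw [Finset.sum_comm]
        refine Finset.sum_congr rfl fun q _ => ?_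
        rw [← Finset.sum_filter, Finset.sum_const, smul_eq_mul, mul_comm]
    _ ≤ ∑ μ : Nat.Partition n, n := by
        refine Finset.sum_le_sum fun μ _ => ?_
        rw [← Finset.sum_filter]
        calc _ ≤ ∑ q ∈ (Finset.Icc 1 n ×ˢ Finset.Icc 1 n) with q.1 ≤ μ.parts.count q.2, q.2 := by
              refine Finset.sum_le_sum_of_subset (Finset.filter_subset_filter _ fun q hq => ?_)
              obtain ⟨h1, h2, h3⟩ := hQ q hq
              have h4 : q.2 ≤ n := (Nat.le_mul_of_pos_left _ h1).trans h3
              have h5 : q.1 ≤ n := (Nat.le_mul_of_pos_right _ h2).trans h3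
              simp only [Finset.mem_product, Finset.mem_Icc]
              omega
          _ = ∑ v ∈ Finset.Icc 1 n, ((Finset.Icc 1 n).filter (· ≤ μ.parts.count v)).card * v := by
              rw [Finset.sum_filter, Finset.sum_product_right]
              refine Finset.sum_congr rfl fun v _ => ?_
              rw [← Finset.sum_filter, Finset.sum_const, smul_eq_mul]
          _ ≤ ∑ v ∈ Finset.Icc 1 n, v * μ.parts.count v := by
              refine Finset.sum_le_sum fun v _ => ?_
              rw [mul_comm]
              refine Nat.mul_le_mul_left _ ?_
              calc _ ≤ (Finset.Icc 1 (μ.parts.count v)).card := by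
                    refine Finset.card_le_card fun k hk => ?_
                    simp only [Finset.mem_filter, Finset.mem_Icc] at hk ⊢
                    omega
                _ = _ := by simp
          _ = n := μ.sum_mul_count
    _ = _ := by simp [mul_comm]

section Series

variable {x : ℝ}

lemma hasSum_choose_exp (hx : 0 < x) (k : ℕ) :
    HasSum (fun n : ℕ => ((n + k).choose k : ℝ) * Real.exp (-x) ^ n)
      (1 / (1 - Real.exp (-x)) ^ (k + 1)) :=
  hasSum_choose_mul_geometric_of_norm_lt_one k (by
    rw [Real.norm_eq_abs, abs_of_pos (Real.exp_pos _)]; simpa using hx)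

lemma summable_pow_exp (hx : 0 < x) (k : ℕ) :
    Summable fun n : ℕ => (n : ℝ) ^ k * Real.exp (-x) ^ n :=
  summable_pow_mul_geometric_of_norm_lt_one k (by
    rw [Real.norm_eq_abs, abs_of_pos (Real.exp_pos _)]; simpa using hx)

lemma tsum_shift_exp (hx : 0 < x) (k : ℕ) (hk : k ≠ 0) :
    ∑' n : ℕ, (n : ℝ) ^ k * Real.exp (-x) ^ n =
      ∑' n : ℕ, ((n : ℝ) + 1) ^ k * Real.exp (-x) ^ (n + 1) := by
  rw [(summable_pow_exp hx k).tsum_eq_zero_add]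
  simp [hk]

lemma summable_shift_exp (hx : 0 < x) (k : ℕ) :
    Summable fun n : ℕ => ((n : ℝ) + 1) ^ k * Real.exp (-x) ^ (n + 1) := by
  have := (summable_nat_add_iff 1).2 (summable_pow_exp hx k)
  simpa using this

lemma one_sub_exp_neg_pos (hx : 0 < x) : 0 < 1 - Real.exp (-x) := by
  have : Real.exp (-x) < 1 := by simpa using hx
  linarith

lemma one_sub_exp_neg_le : 1 - Real.exp (-x) ≤ x := by
  have := Real.add_one_le_exp (-x)
  linarith

lemma le_one_sub_exp_neg (hx : 0 < x) : x ≤ (1 + x) * (1 - Real.exp (-x)) := by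
  have h1 := Real.add_one_le_exp x
  have h2 : Real.exp x * Real.exp (-x) = 1 := by rw [← Real.exp_add]; simp
  nlinarith [Real.exp_pos (-x)]

lemma tsum_mul_exp_ge (hx : 0 < x) :
    1 / x ^ 2 - 1 / 2 ≤ ∑' n : ℕ, (n : ℝ) ^ 1 * Real.exp (-x) ^ n := by
  have h : ∑' n : ℕ, (n : ℝ) ^ 1 * Real.exp (-x) ^ n =
      Real.exp (-x) / (1 - Real.exp (-x)) ^ 2 := by
    rw [tsum_shift_exp hx 1 one_ne_zero]
    have := ((hasSum_choose_exp hx 1).mul_left (Real.exp (-x))).tsum_eq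
    rw [mul_one_div] at this
    rw [← this]
    refine tsum_congr fun n => ?_
    rw [Nat.choose_one_right]
    push_cast
    ring
  rw [h]
  have hpos := one_sub_exp_neg_pos hx
  by_cases hx2 : x ^ 2 / 2 < 1
  · have hc := Real.cosh_le_exp_half_sq x
    have h1 := Real.add_one_le_exp (-(x ^ 2 / 2))
    have h2 : Real.exp (x ^ 2 / 2) * Real.exp (-(x ^ 2 / 2)) = 1 := by
      rw [← Real.exp_add]; simp
    rw [Real.cosh_eq] at hc
    have h3 : Real.exp x * Real.exp (-x) = 1 := by rw [← Real.exp_add]; simp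
    set u := x ^ 2 / 2 with hu
    have hx2' : x ^ 2 = 2 * u := by rw [hu]; ring
    have hu0 : 0 < u := by positivity
    have h4 : (Real.exp u - 1) * (1 - u) ≤ u := by
      nlinarith [Real.exp_pos u, Real.exp_pos (-u)]
    have h5 : (1 - Real.exp (-x)) ^ 2 = Real.exp (-x) * (Real.exp x + Real.exp (-x) - 2) := by
      ring_nf; nlinarith
    rw [le_div_iff₀ (by positivity), h5, hx2']
    have h6 : (Real.exp x + Real.exp (-x) - 2) * (1 - u) ≤ 2 * u := by
      nlinarith
    have h7 : (1 / (2 * u) - 1 / 2) = (1 - u) / (2 * u) := by field_simp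
    rw [h7, div_mul_eq_mul_div, div_le_iff₀ (by positivity)]
    nlinarith [Real.exp_pos (-x)]
  · have h1 : 1 / x ^ 2 ≤ 1 / 2 := by
      apply one_div_le_one_div_of_le (by norm_num)
      linarith
    have : 0 ≤ Real.exp (-x) / (1 - Real.exp (-x)) ^ 2 := by positivity
    linarith

lemma tsum_sq_mul_exp_ge (hx : 0 < x) (hx1 : x ≤ 1) :
    1 / (3 * x ^ 3) ≤ ∑' n : ℕ, (n : ℝ) ^ 2 * Real.exp (-x) ^ n := by
  have hpos := one_sub_exp_neg_pos hx
  have h : Real.exp (-x) / (1 - Real.exp (-x)) ^ 3 ≤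
      ∑' n : ℕ, (n : ℝ) ^ 2 * Real.exp (-x) ^ n := by
    rw [tsum_shift_exp hx 2 two_ne_zero, ← mul_one_div]
    refine hasSum_le (fun n => ?_) ((hasSum_choose_exp hx 2).mul_left (Real.exp (-x)))
      (summable_shift_exp hx 2).hasSum
    rw [Nat.cast_choose_two]
    push_cast
    rw [pow_succ (Real.exp (-x)) n]
    have : 0 < Real.exp (-x) ^ n * Real.exp (-x) := by positivity
    have hn : (0 : ℝ) ≤ n := n.cast_nonneg
    nlinarith [mul_nonneg hn this.le, mul_nonneg (mul_nonneg hn hn) this.le]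
  refine le_trans ?_ h
  have he : (1 : ℝ) / 3 ≤ Real.exp (-x) := by
    have h1 : Real.exp (-1) ≤ Real.exp (-x) := Real.exp_le_exp.2 (by linarith)
    have h2 := Real.exp_one_lt_d9
    have h3 : Real.exp 1 * Real.exp (-1) = 1 := by rw [← Real.exp_add]; simp
    nlinarith [Real.exp_pos (-1)]
  calc 1 / (3 * x ^ 3) = 1 / 3 / x ^ 3 := by field_simp
    _ ≤ Real.exp (-x) / (1 - Real.exp (-x)) ^ 3 := by
      have := one_sub_exp_neg_le (x := x)
      gcongr

lemma tsum_cube_mul_exp_le (hx : 0 < x) :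
    ∑' n : ℕ, (n : ℝ) ^ 3 * Real.exp (-x) ^ n ≤ 432 / x ^ 4 := by
  have hpos := one_sub_exp_neg_pos hx
  have h : ∑' n : ℕ, (n : ℝ) ^ 3 * Real.exp (-x) ^ n ≤
      6 * Real.exp (-x) / (1 - Real.exp (-x)) ^ 4 := by
    rw [tsum_shift_exp hx 3 three_ne_zero, ← mul_one_div]
    refine hasSum_le (fun n => ?_) (summable_shift_exp hx 3).hasSum
      ((hasSum_choose_exp hx 3).mul_left (6 * Real.exp (-x)))
    have h6 : (6 : ℝ) * ((n + 3).choose 3 : ℝ) = (n + 1) * (n + 2) * (n + 3) := by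
      have h1 := Nat.descFactorial_eq_factorial_mul_choose (n + 3) 3
      have h2 : (n + 3).descFactorial 3 = (n + 1) * (n + 2) * (n + 3) := by
        simp [Nat.descFactorial]; ring
      rw [h2] at h1
      have h3 : Nat.factorial 3 = 6 := rfl
      rw [h3] at h1
      exact_mod_cast h1.symm
    have h7 : 6 * Real.exp (-x) * (((n + 3).choose 3 : ℝ) * Real.exp (-x) ^ n) =
        (n + 1) * (n + 2) * (n + 3) * Real.exp (-x) ^ (n + 1) := by
      rw [← h6]; ring
    rw [h7]
    have hn : (0 : ℝ) ≤ n := n.cast_nonneg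
    gcongr
    nlinarith
  refine h.trans ?_
  rw [div_le_div_iff₀ (by positivity) (by positivity)]
  have h1 := le_one_sub_exp_neg hx
  have h2 : (1 + x) ^ 4 ≤ 24 * Real.exp (1 + x) := by
    have := Real.pow_div_factorial_le_exp (1 + x) (by linarith) 4
    have h3 : (Nat.factorial 4 : ℝ) = 24 := by norm_num [Nat.factorial]
    rw [h3] at this
    linarith
  have h3 : Real.exp (-x) * Real.exp (1 + x) = Real.exp 1 := by rw [← Real.exp_add]; simp
  have h4 := Real.exp_one_lt_d9
  calc 6 * Real.exp (-x) * x ^ 4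
      ≤ 6 * Real.exp (-x) * ((1 + x) * (1 - Real.exp (-x))) ^ 4 := by gcongr
    _ = 6 * (Real.exp (-x) * (1 + x) ^ 4) * (1 - Real.exp (-x)) ^ 4 := by ring
    _ ≤ 6 * (Real.exp (-x) * (24 * Real.exp (1 + x))) * (1 - Real.exp (-x)) ^ 4 := by gcongr
    _ = 144 * Real.exp 1 * (1 - Real.exp (-x)) ^ 4 := by rw [← h3]; ring
    _ ≤ 432 * (1 - Real.exp (-x)) ^ 4 := by gcongr; linarith

end Series

/-- The constant `π / √6`. -/
noncomputable def kappa : ℝ := Real.pi / Real.sqrt 6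

lemma kappa_sq : kappa ^ 2 = Real.pi ^ 2 / 6 := by
  rw [kappa, div_pow, Real.sq_sqrt (by norm_num)]

lemma kappa_pos : 0 < kappa := by unfold kappa; positivity

lemma one_le_kappa : 1 ≤ kappa := by
  have h := kappa_sq
  have h1 := Real.pi_gt_three
  nlinarith [kappa_pos]

lemma kappa_le : kappa ≤ 1.3 := by
  have h := kappa_sq
  have h1 := Real.pi_lt_d2
  have h2 := Real.pi_pos
  nlinarith [kappa_pos]

lemma zeta_two_sub_le (M : ℕ) (hM : 1 ≤ M) :
    kappa ^ 2 - 1 / M ≤ ∑ k ∈ Finset.Icc 1 M, 1 / (k : ℝ) ^ 2 := by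
  set f : ℕ → ℝ := fun m => ∑ k ∈ Finset.Icc 1 (m + 1), 1 / (k : ℝ) ^ 2 + 1 / ((m : ℝ) + 1)
  have hanti : Antitone f := by
    refine antitone_nat_of_succ_le fun m => ?_
    simp only [f]
    rw [Finset.sum_Icc_succ_top (by omega : 1 ≤ m + 1 + 1)]
    push_cast
    have h : (1 : ℝ) / (m + 1 + 1) ^ 2 + 1 / (m + 1 + 1) ≤ 1 / (m + 1) := by
      rw [div_add_div _ _ (by positivity) (by positivity), div_le_div_iff₀ (by positivity)
        (by positivity)]
      have : (0 : ℝ) ≤ m := m.cast_nonneg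
      nlinarith [mul_nonneg this this]
    linarith
  have hlim : Filter.Tendsto f Filter.atTop (nhds (Real.pi ^ 2 / 6 + 0)) := by
    refine Filter.Tendsto.add ?_ tendsto_one_div_add_atTop_nhds_zero_nat
    have h1 := (Filter.tendsto_add_atTop_iff_nat 2).2 hasSum_zeta_two.tendsto_sum_nat
    refine h1.congr fun m => ?_
    rw [Finset.range_eq_Ico, Finset.sum_eq_sum_Ico_succ_bot (by omega)]
    simp only [Nat.cast_zero, ne_eq, OfNat.ofNat_ne_zero, not_false_eq_true, zero_pow, div_zero,
      zero_add]
    rfl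
  have h := hanti.le_of_tendsto hlim (M - 1)
  have hM' : M - 1 + 1 = M := by omega
  have hM2 : ((M - 1 : ℕ) : ℝ) + 1 = M := by exact_mod_cast hM'
  simp only [f, hM', hM2] at h
  rw [kappa_sq]
  linarith

lemma sum_inv_sq_le_two (M : ℕ) : ∑ k ∈ Finset.Icc 1 M, 1 / (k : ℝ) ^ 2 ≤ 2 := by
  have h := sum_le_hasSum (Finset.Icc 1 M) (fun k _ => by positivity) hasSum_zeta_two
  have h1 := kappa_sq
  have h2 := kappa_le
  nlinarith [kappa_pos]

/-- The weight that the partitions of `n - j` contribute in the inductive lower bound. -/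
noncomputable def stepWeight (n j : ℝ) : ℝ :=
  Real.exp (-(kappa / √n * j)) * (1 + 2700 * j / n - kappa / √n * j ^ 2 / n)

section StepWeight

variable {n : ℕ}

lemma stepWeight_eq (k v : ℕ) :
    (v : ℝ) * stepWeight n (k * v) =
      (v : ℝ) ^ 1 * Real.exp (-(kappa / √n * k)) ^ v +
      2700 * k / n * ((v : ℝ) ^ 2 * Real.exp (-(kappa / √n * k)) ^ v) -
      kappa / √n * k ^ 2 / n * ((v : ℝ) ^ 3 * Real.exp (-(kappa / √n * k)) ^ v) := by
  rw [stepWeight, ← Real.exp_nat_mul]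
  have : -(kappa / √(n : ℝ) * (k * v)) = v * -(kappa / √(n : ℝ) * k) := by ring
  rw [this]
  ring

lemma summable_stepWeight (hn : 0 < n) {k : ℕ} (hk : 0 < k) :
    Summable fun v : ℕ => (v : ℝ) * stepWeight n (k * v) := by
  have hx : 0 < kappa / √(n : ℝ) * k := by have := kappa_pos; positivity
  simp_rw [stepWeight_eq]
  exact ((summable_pow_exp hx 1).add ((summable_pow_exp hx 2).mul_left _)).sub
    ((summable_pow_exp hx 3).mul_left _)

lemma tsum_stepWeight_ge (hn : 2 ≤ n) {k : ℕ} (hk : 0 < k) :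
    √n ^ 2 / kappa ^ 2 * (1 / (k : ℝ) ^ 2) - 1 / 2 -
        432 * √n / kappa ^ 3 * (1 / (k : ℝ) ^ 2) + (if k = 1 then 900 * √n / kappa ^ 3 else 0) ≤
      ∑' v : ℕ, (v : ℝ) * stepWeight n (k * v) := by
  have hκ := kappa_pos
  have hr : 0 < √(n : ℝ) := by positivity
  have hrn : (n : ℝ) = √n ^ 2 := (Real.sq_sqrt n.cast_nonneg).symm
  have hx : 0 < kappa / √(n : ℝ) * k := by positivity
  simp_rw [stepWeight_eq]
  rw [Summable.tsum_sub ((summable_pow_exp hx 1).add ((summable_pow_exp hx 2).mul_left _))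
    ((summable_pow_exp hx 3).mul_left _), Summable.tsum_add (summable_pow_exp hx 1)
    ((summable_pow_exp hx 2).mul_left _), tsum_mul_left, tsum_mul_left]
  have h1 := tsum_mul_exp_ge hx
  have h3 : kappa / √(n : ℝ) * k ^ 2 / n *
      ∑' v : ℕ, (v : ℝ) ^ 3 * Real.exp (-(kappa / √n * k)) ^ v ≤
        432 * √n / kappa ^ 3 * (1 / (k : ℝ) ^ 2) := by
    calc _ ≤ kappa / √(n : ℝ) * k ^ 2 / n * (432 / (kappa / √(n : ℝ) * k) ^ 4) := by
          gcongr
          exact tsum_cube_mul_exp_le hx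
      _ = _ := by
          generalize √(n : ℝ) = r at *
          rw [hrn]
          field_simp
  have h1' : 1 / (kappa / √(n : ℝ) * k) ^ 2 = √n ^ 2 / kappa ^ 2 * (1 / (k : ℝ) ^ 2) := by
    field_simp
  have h2 : (if k = 1 then 900 * √(n : ℝ) / kappa ^ 3 else 0) ≤ 2700 * k / n *
      ∑' v : ℕ, (v : ℝ) ^ 2 * Real.exp (-(kappa / √n * k)) ^ v := by
    split_ifs with hk1
    · subst hk1
      have hle : kappa / √(n : ℝ) * (1 : ℕ) ≤ 1 := by
        rw [Nat.cast_one, mul_one, div_le_one hr]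
        refine Real.le_sqrt_of_sq_le ?_
        have h2n : (2 : ℝ) ≤ n := by exact_mod_cast hn
        have := kappa_le
        nlinarith
      calc 900 * √(n : ℝ) / kappa ^ 3 =
            2700 * (1 : ℕ) / n * (1 / (3 * (kappa / √(n : ℝ) * (1 : ℕ)) ^ 3)) := by
            generalize √(n : ℝ) = r at *
            rw [hrn]
            push_cast
            field_simp
            norm_num
        _ ≤ _ := by
            gcongr
            exact tsum_sq_mul_exp_ge hx hle
    · exact mul_nonneg (by positivity) (tsum_nonneg fun v => by positivity)
  linarith

lemma le_sum_tsum_stepWeight (hn : 2 ≤ n) :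
    (n : ℝ) ≤ ∑ k ∈ Finset.Icc 1 (Nat.sqrt n), ∑' v : ℕ, (v : ℝ) * stepWeight n (k * v) := by
  have hκ := kappa_pos
  have hr : 0 < √(n : ℝ) := by positivity
  have hrn : (n : ℝ) = √n ^ 2 := (Real.sq_sqrt n.cast_nonneg).symm
  set M := Nat.sqrt n
  have hM1 : 1 ≤ M := Nat.sqrt_pos.2 (by omega)
  have hMr : (M : ℝ) ≤ √n := Real.nat_sqrt_le_real_sqrt
  have hrM : √(n : ℝ) ≤ M + 1 := Real.real_sqrt_le_nat_sqrt_succ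
  have hM1' : (1 : ℝ) ≤ M := by exact_mod_cast hM1
  refine le_trans ?_ (Finset.sum_le_sum fun k hk =>
    tsum_stepWeight_ge hn (Finset.mem_Icc.1 hk).1)
  rw [Finset.sum_add_distrib, Finset.sum_sub_distrib, Finset.sum_sub_distrib, ← Finset.mul_sum,
    ← Finset.mul_sum, Finset.sum_ite_eq', if_pos (Finset.mem_Icc.2 ⟨le_rfl, hM1⟩)]
  have h1 : √(n : ℝ) ^ 2 / kappa ^ 2 * (kappa ^ 2 - 1 / M) ≤
      √(n : ℝ) ^ 2 / kappa ^ 2 * ∑ k ∈ Finset.Icc 1 M, 1 / (k : ℝ) ^ 2 := by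
    gcongr
    exact zeta_two_sub_le M hM1
  have h2 : 432 * √(n : ℝ) / kappa ^ 3 * ∑ k ∈ Finset.Icc 1 M, 1 / (k : ℝ) ^ 2 ≤
      432 * √(n : ℝ) / kappa ^ 3 * 2 := by
    gcongr
    exact sum_inv_sq_le_two M
  have h3 : √(n : ℝ) ^ 2 / kappa ^ 2 * (kappa ^ 2 - 1 / M) =
      n - √(n : ℝ) ^ 2 / (kappa ^ 2 * M) := by
    rw [← hrn]; field_simp
  have h4 : √(n : ℝ) ^ 2 / (kappa ^ 2 * M) ≤ 2 * √n := by
    rw [div_le_iff₀ (by positivity)]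
    have hk2 : 1 ≤ kappa ^ 2 := by nlinarith [one_le_kappa]
    have : (M : ℝ) ≤ kappa ^ 2 * M := by nlinarith
    nlinarith
  have h5 : 16 * √(n : ℝ) ≤ 36 * √(n : ℝ) / kappa ^ 3 := by
    rw [le_div_iff₀ (by positivity)]
    have : kappa ^ 3 ≤ 1.3 ^ 3 := by gcongr; exact kappa_le
    nlinarith
  have h6 : 900 * √(n : ℝ) / kappa ^ 3 - 432 * √(n : ℝ) / kappa ^ 3 * 2 =
      36 * √(n : ℝ) / kappa ^ 3 := by ring
  simp only [Finset.sum_const, Nat.card_Icc, Nat.add_sub_cancel, nsmul_eq_mul]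
  linarith

lemma stepWeight_nonpos {n : ℕ} (hn : 2701 ^ 2 ≤ n) {j : ℝ} (hj : n ≤ j) :
    stepWeight n j ≤ 0 := by
  have hr : 2701 ≤ √(n : ℝ) := Real.le_sqrt_of_sq_le (by exact_mod_cast hn)
  have hn0 : (0 : ℝ) < n := by
    have : (2701 : ℝ) ^ 2 ≤ n := by exact_mod_cast hn
    linarith
  have hrn : (n : ℝ) = √n ^ 2 := (Real.sq_sqrt n.cast_nonneg).symm
  refine mul_nonpos_of_nonneg_of_nonpos (Real.exp_pos _).le ?_
  set t := j / n with ht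
  have ht1 : 1 ≤ t := (one_le_div hn0).2 hj
  have hjt : j = t * n := by rw [ht]; field_simp
  have h1 : 2700 * j / n = 2700 * t := by rw [hjt]; field_simp
  have h2 : kappa / √(n : ℝ) * j ^ 2 / n = kappa * √n * t ^ 2 := by
    rw [hjt]
    generalize √(n : ℝ) = r at *
    rw [hrn]
    field_simp
  rw [h1, h2]
  have h3 : 2701 * t ^ 2 ≤ kappa * √n * t ^ 2 := by
    gcongr
    nlinarith [one_le_kappa]
  nlinarith

lemma lower_profile_sub_ge {n j : ℕ} (hj : j < n) :
    Real.exp (2 * kappa * √n) / (n : ℝ) ^ 2700 * stepWeight n j ≤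
      Real.exp (2 * kappa * √((n - j : ℕ) : ℝ)) / ((n - j : ℕ) : ℝ) ^ 2700 := by
  have hκ := kappa_pos
  have hn0 : (0 : ℝ) < n := by exact_mod_cast (by omega : 0 < n)
  have hr : 0 < √(n : ℝ) := Real.sqrt_pos.2 hn0
  have hrn : (n : ℝ) = √n ^ 2 := (Real.sq_sqrt n.cast_nonneg).symm
  set t : ℝ := j / n with ht
  have hjt : (j : ℝ) = t * n := by rw [ht]; field_simp
  have ht0 : 0 ≤ t := by positivity
  have ht1 : t < 1 := by rw [ht, div_lt_one hn0]; exact_mod_cast hj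
  have hsub : ((n - j : ℕ) : ℝ) = n * (1 - t) := by
    rw [Nat.cast_sub hj.le, hjt]; ring
  have hsqrt : √(n : ℝ) * (1 - t / 2 - t ^ 2 / 2) ≤ √((n - j : ℕ) : ℝ) := by
    rw [hsub, Real.sqrt_mul n.cast_nonneg]
    gcongr
    apply Real.le_sqrt_of_sq_le
    have h : 1 - t / 2 - t ^ 2 / 2 = (1 - t) * (1 + t / 2) := by ring
    rw [h, mul_pow]
    have h1 : (1 - t) * (1 + t / 2) ^ 2 ≤ 1 := by nlinarith [mul_nonneg ht0 ht0, pow_nonneg ht0 3]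
    nlinarith
  have hexp : Real.exp (2 * kappa * √n) * Real.exp (-(kappa / √n * j)) *
      Real.exp (-(kappa / √n * j ^ 2 / n)) ≤ Real.exp (2 * kappa * √((n - j : ℕ) : ℝ)) := by
    rw [← Real.exp_add, ← Real.exp_add, Real.exp_le_exp]
    have h1 : kappa / √(n : ℝ) * j = kappa * √n * t := by
      rw [hjt]
      generalize √(n : ℝ) = r at *
      rw [hrn]
      field_simp
    have h2 : kappa / √(n : ℝ) * j ^ 2 / n = kappa * √n * t ^ 2 := by
      rw [hjt]
      generalize √(n : ℝ) = r at *
      rw [hrn]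
      field_simp
    rw [h1, h2]
    nlinarith
  have hpow : ((n - j : ℕ) : ℝ) ^ 2700 * Real.exp (2700 * j / n) ≤ (n : ℝ) ^ 2700 := by
    have h1 : (1 - t) ≤ Real.exp (-t) := by
      have := Real.add_one_le_exp (-t); linarith
    have h2 : Real.exp (2700 * j / n) = Real.exp t ^ 2700 := by
      rw [← Real.exp_nat_mul, ht]
      congr 1
      push_cast
      ring
    rw [h2, ← mul_pow, hsub]
    have h3 : (n : ℝ) * (1 - t) * Real.exp t ≤ n := by
      have : Real.exp (-t) * Real.exp t = 1 := by rw [← Real.exp_add]; simp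
      have h4 : (1 - t) * Real.exp t ≤ 1 := by nlinarith [Real.exp_pos t]
      nlinarith
    exact pow_le_pow_left₀ (mul_nonneg (mul_nonneg hn0.le (by linarith)) (Real.exp_pos t).le) h3 _
  have hnj : (0 : ℝ) < ((n - j : ℕ) : ℝ) ^ 2700 :=
    pow_pos (by exact_mod_cast (by omega : 0 < n - j)) _
  have hnp : (0 : ℝ) < (n : ℝ) ^ 2700 := pow_pos hn0 _
  rw [div_mul_eq_mul_div, div_le_div_iff₀ hnp hnj]
  have hw : stepWeight n j ≤ Real.exp (-(kappa / √n * j)) *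
      (Real.exp (-(kappa / √n * j ^ 2 / n)) * Real.exp (2700 * j / n)) := by
    rw [stepWeight, ← Real.exp_add]
    gcongr
    have := Real.add_one_le_exp (-(kappa / √n * j ^ 2 / n) + 2700 * (j : ℝ) / n)
    linarith
  generalize (n : ℝ) ^ 2700 = X at *
  generalize ((n - j : ℕ) : ℝ) ^ 2700 = Y at *
  calc Real.exp (2 * kappa * √n) * stepWeight n j * Y
      ≤ Real.exp (2 * kappa * √n) * (Real.exp (-(kappa / √n * j)) *
      (Real.exp (-(kappa / √n * j ^ 2 / n)) * Real.exp (2700 * j / n))) * Y := by gcongr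
    _ = Real.exp (2 * kappa * √n) * Real.exp (-(kappa / √n * j)) *
      Real.exp (-(kappa / √n * j ^ 2 / n)) * (Y * Real.exp (2700 * j / n)) := by ring
    _ ≤ Real.exp (2 * kappa * √((n - j : ℕ) : ℝ)) * X := by gcongr

end StepWeight

/-- A lower bound of Hardy–Ramanujan type for the number of partitions. -/
lemma exists_card_partition_ge :
    ∃ c : ℝ, 0 < c ∧ ∀ n : ℕ, 1 ≤ n →
      c * (Real.exp (2 * kappa * √n) / (n : ℝ) ^ 2700) ≤ Fintype.card (Nat.Partition n) := by
  set f : ℕ → ℝ := fun n => Real.exp (2 * kappa * √n) / (n : ℝ) ^ 2700 with hf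
  have hfpos : ∀ n : ℕ, 1 ≤ n → 0 < f n := fun n hn =>
    div_pos (Real.exp_pos _) (pow_pos (by exact_mod_cast hn) _)
  set C : ℝ := 1 + ∑ n ∈ Finset.Icc 1 (2701 ^ 2), f n with hC
  have hCpos : 0 < C := by
    have : 0 ≤ ∑ n ∈ Finset.Icc 1 (2701 ^ 2), f n :=
      Finset.sum_nonneg fun n hn => (hfpos n (Finset.mem_Icc.1 hn).1).le
    linarith
  refine ⟨C⁻¹, inv_pos.2 hCpos, fun n => ?_⟩
  induction n using Nat.strong_induction_on with
  | _ n ih =>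
  intro hn
  change C⁻¹ * f n ≤ _
  rcases le_or_gt n (2701 ^ 2) with hsmall | hbig
  · have h1 : f n ≤ C := by
      have := Finset.single_le_sum (f := f)
        (fun m hm => (hfpos m (Finset.mem_Icc.1 hm).1).le) (Finset.mem_Icc.2 ⟨hn, hsmall⟩)
      linarith
    have h2 : (1 : ℝ) ≤ Fintype.card (Nat.Partition n) := by
      exact_mod_cast Fintype.card_pos
    refine le_trans ?_ h2
    rw [inv_mul_le_iff₀ hCpos, mul_one]
    exact h1
  have hn0 : (0 : ℝ) < n := by exact_mod_cast hn
  set Q : Finset (ℕ × ℕ) := (Finset.Icc 1 (Nat.sqrt n) ×ˢ Finset.Icc 1 n).filter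
    fun q => q.1 * q.2 < n with hQ
  have hQmem : ∀ q ∈ Q, 0 < q.1 ∧ 0 < q.2 ∧ q.1 * q.2 < n := by
    intro q hq
    simp only [hQ, Finset.mem_filter, Finset.mem_product, Finset.mem_Icc] at hq
    omega
  have hrec := sum_card_partition_le (n := n) Q fun q hq =>
    ⟨(hQmem q hq).1, (hQmem q hq).2.1, (hQmem q hq).2.2.le⟩
  have hrec' : ∑ q ∈ Q, (q.2 : ℝ) * (Fintype.card (Nat.Partition (n - q.1 * q.2)) : ℝ) ≤
      n * Fintype.card (Nat.Partition n) := by exact_mod_cast hrec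
  have hmain : n * (C⁻¹ * f n) ≤
      ∑ q ∈ Q, (q.2 : ℝ) * (Fintype.card (Nat.Partition (n - q.1 * q.2)) : ℝ) := by
    calc (n : ℝ) * (C⁻¹ * f n)
        ≤ (∑ k ∈ Finset.Icc 1 (Nat.sqrt n), ∑' v : ℕ, (v : ℝ) * stepWeight n (k * v)) *
          (C⁻¹ * f n) := by
          gcongr
          exact le_sum_tsum_stepWeight (by omega)
      _ ≤ (∑ k ∈ Finset.Icc 1 (Nat.sqrt n), ∑ v ∈ (Finset.Icc 1 n).filter fun v => k * v < n,
            (v : ℝ) * stepWeight n (k * v)) * (C⁻¹ * f n) := by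
          refine mul_le_mul_of_nonneg_right (Finset.sum_le_sum fun k hk => ?_)
            (mul_nonneg (inv_pos.2 hCpos).le (hfpos n hn).le)
          have hk1 := (Finset.mem_Icc.1 hk).1
          have hsm := summable_stepWeight (n := n) (by omega) hk1
          have h := hsm.neg.sum_le_tsum ((Finset.Icc 1 n).filter fun v => k * v < n)
            (fun v hv => ?_)
          · rw [tsum_neg, Finset.sum_neg_distrib] at h
            linarith
          · rcases Nat.eq_zero_or_pos v with rfl | hv0
            · simp
            · have hge : n ≤ k * v := by
                by_contra hlt
                refine hv (Finset.mem_filter.2 ⟨Finset.mem_Icc.2 ⟨hv0, ?_⟩, by omega⟩)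
                have := Nat.le_mul_of_pos_left v hk1
                omega
              have := stepWeight_nonpos hbig.le (j := (k : ℝ) * v) (by exact_mod_cast hge)
              rw [neg_nonneg]
              exact mul_nonpos_of_nonneg_of_nonpos v.cast_nonneg this
      _ = ∑ q ∈ Q, (q.2 : ℝ) * (C⁻¹ * (f n * stepWeight n ((q.1 * q.2 : ℕ) : ℝ))) := by
          rw [hQ, Finset.sum_filter, Finset.sum_product, Finset.sum_mul]
          refine Finset.sum_congr rfl fun k _ => ?_
          rw [Finset.sum_filter, Finset.sum_mul]
          refine Finset.sum_congr rfl fun v _ => ?_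
          split_ifs
          · push_cast; ring
          · simp
      _ ≤ _ := by
          refine Finset.sum_le_sum fun q hq => ?_
          obtain ⟨h1, h2, h3⟩ := hQmem q hq
          have hpos : 0 < q.1 * q.2 := Nat.mul_pos h1 h2
          gcongr
          refine le_trans ?_ (ih (n - q.1 * q.2) (by omega) (by omega))
          gcongr
          exact lower_profile_sub_ge h3
  have := hmain.trans hrec'
  exact le_of_mul_le_mul_left this hn0

lemma IsPReduction.sum_pow_mul_count_lt {p N : ℕ} (hp : p.Prime) {μ ν : Nat.Partition N}
    (h : IsPReduction p μ ν) {L : ℝ} (hL : ∀ t ∈ ν.parts, (t : ℝ) ≤ L) {k a B : ℕ} (hk : 0 < k)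
    (hkp : k.Coprime p) (ha : a ≤ N) (hkB : L < k * p ^ B) :
    ∑ j ∈ Finset.range (a + 1), p ^ j * μ.parts.count (k * p ^ j) < p ^ B := by
  have hgeom : ∀ b : ℕ, ∑ j ∈ Finset.range b, p ^ j * (p - 1) + 1 = p ^ b := by
    intro b
    induction b with
    | zero => simp
    | succ b ih =>
      have hp1 := Nat.sub_add_cancel hp.one_le
      rw [Finset.sum_range_succ, add_right_comm, ih]
      calc p ^ b + p ^ b * (p - 1) = p ^ b * ((p - 1) + 1) := by ring
        _ = p ^ (b + 1) := by rw [hp1, pow_succ]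
  refine lt_of_mul_lt_mul_left (a := k) ?_ (Nat.zero_le k)
  calc k * ∑ j ∈ Finset.range (a + 1), p ^ j * μ.parts.count (k * p ^ j)
      = ∑ j ∈ Finset.range (a + 1), k * p ^ j * μ.parts.count (k * p ^ j) := by
        simp only [Finset.mul_sum, mul_assoc]
    _ ≤ ∑ j ∈ Finset.range (N + 1), k * p ^ j * μ.parts.count (k * p ^ j) :=
        Finset.sum_le_sum_of_subset (Finset.range_subset_range.2 (by omega))
    _ = ∑ j ∈ Finset.range (N + 1), k * p ^ j * ν.parts.count (k * p ^ j) := (h.2 k hk hkp).symm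
    _ ≤ ∑ j ∈ (Finset.range (N + 1)).filter (· < B), k * p ^ j * (p - 1) := by
        rw [Finset.sum_filter]
        refine Finset.sum_le_sum fun j _ => ?_
        split_ifs with hj
        · exact Nat.mul_le_mul_left _ (h.1 _)
        · have : ν.parts.count (k * p ^ j) = 0 := by
            refine Multiset.count_eq_zero.2 fun hmem => ?_
            have h1 := hL _ hmem
            have h2 : k * p ^ B ≤ k * p ^ j :=
              Nat.mul_le_mul_left _ (Nat.pow_le_pow_right hp.pos (by omega))
            have h3 : (k : ℝ) * (p : ℝ) ^ B ≤ ((k * p ^ j : ℕ) : ℝ) := by exact_mod_cast h2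
            linarith
          simp [this]
    _ ≤ ∑ j ∈ Finset.range B, k * p ^ j * (p - 1) :=
        Finset.sum_le_sum_of_subset fun j hj =>
          Finset.mem_range.2 (Finset.mem_filter.1 hj).2
    _ = k * ∑ j ∈ Finset.range B, p ^ j * (p - 1) := by simp only [Finset.mul_sum, mul_assoc]
    _ < k * p ^ B := by
        refine Nat.mul_lt_mul_of_pos_left ?_ hk
        have := hgeom B
        omega

lemma chainTail_ge {s : ℝ} (hs : 0 < s) {p k a B : ℕ} (hp : 2 ≤ p) (hk : k ≠ 0)
    (hB : a + 1 ≤ B) :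
    Real.exp (-(s * (k * p ^ B) * (1 + 2 / (p : ℝ) ^ (B - a)))) * (s * (k * p ^ B) / a) ^ a ≤
      chainTail s p k a B := by
  have hp0 : (0 : ℝ) < p := by exact_mod_cast (by omega : 0 < p)
  have hk0 : (0 : ℝ) < k := by exact_mod_cast Nat.pos_of_ne_zero hk
  have hp2 : (2 : ℝ) ≤ p := by exact_mod_cast hp
  have hgeom : ∀ b : ℕ, ∑ j : Fin b, (p : ℝ) ^ ((j : ℕ) + 1) ≤ 2 * (p : ℝ) ^ b := by
    intro b
    induction b with
    | zero => simp
    | succ b ih =>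
      rw [Fin.sum_univ_castSucc]
      simp only [Fin.val_castSucc, Fin.val_last]
      have : (p : ℝ) ^ (b + 1) = p ^ b * p := pow_succ _ _
      nlinarith [pow_pos hp0 b]
  have hfac : ∀ j : Fin a, s * (k * p ^ B) / a * Real.exp (-(s * (k * p ^ ((j : ℕ) + 1)))) ≤
      ((p ^ (B - 1 - j) / a + 1 : ℕ) : ℝ) * (1 - Real.exp (-(s * (k * p ^ ((j : ℕ) + 1))))) := by
    intro j
    have ha0 : (0 : ℝ) < a := by exact_mod_cast (by have := j.2; omega : 0 < a)
    set y : ℝ := s * (k * p ^ ((j : ℕ) + 1)) with hy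
    have hy0 : 0 < y := by positivity
    have h1 : (p : ℝ) ^ (B - 1 - j) / a ≤ ((p ^ (B - 1 - j) / a + 1 : ℕ) : ℝ) := by
      rw [div_le_iff₀ ha0]
      have := Nat.lt_div_mul_add (a := p ^ (B - 1 - j)) (b := a) (by have := j.2; omega)
      have h2 : p ^ (B - 1 - j) ≤ (p ^ (B - 1 - j) / a + 1) * a := by
        rw [add_mul, one_mul]; exact this.le
      exact_mod_cast h2
    have h2 : y * Real.exp (-y) ≤ 1 - Real.exp (-y) := by
      have h3 := Real.add_one_le_exp y
      have h4 : Real.exp y * Real.exp (-y) = 1 := by rw [← Real.exp_add]; simp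
      nlinarith [Real.exp_pos (-y)]
    have hpow : (p : ℝ) ^ B = p ^ (B - 1 - j) * p ^ ((j : ℕ) + 1) := by
      rw [← pow_add]; congr 1; have := j.2; omega
    calc s * (k * p ^ B) / a * Real.exp (-y)
        = (p : ℝ) ^ (B - 1 - j) / a * (y * Real.exp (-y)) := by rw [hpow, hy]; ring
      _ ≤ _ := by gcongr
  have hprod : (s * (k * p ^ B) / a) ^ a *
      Real.exp (-∑ j : Fin a, s * (k * (p : ℝ) ^ ((j : ℕ) + 1))) ≤
      ∏ j : Fin a, (((p ^ (B - 1 - j) / a + 1 : ℕ) : ℝ) *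
        (1 - Real.exp (-(s * (k * p ^ (j + 1 : ℕ)))))) := by
    refine le_trans (le_of_eq ?_)
      (Finset.prod_le_prod (fun j _ => by positivity) fun j _ => hfac j)
    rw [Finset.prod_mul_distrib, ← Real.exp_sum, Finset.sum_neg_distrib, Finset.prod_const,
      Finset.card_univ, Fintype.card_fin]
  have hsum : ∑ j : Fin a, s * (k * (p : ℝ) ^ ((j : ℕ) + 1)) ≤
      s * (k * p ^ B) * (2 / (p : ℝ) ^ (B - a)) := by
    have hpow : (p : ℝ) ^ B = p ^ a * p ^ (B - a) := by rw [← pow_add]; congr 1; omega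
    rw [← Finset.mul_sum, ← Finset.mul_sum]
    calc s * (k * ∑ j : Fin a, (p : ℝ) ^ ((j : ℕ) + 1)) ≤ s * (k * (2 * p ^ a)) := by
          gcongr; exact hgeom a
      _ = _ := by rw [hpow]; field_simp
  rw [chainTail]
  calc Real.exp (-(s * (k * p ^ B) * (1 + 2 / (p : ℝ) ^ (B - a)))) * (s * (k * p ^ B) / a) ^ a
      = Real.exp (-(s * (k * p ^ B))) * ((s * (k * p ^ B) / a) ^ a *
        Real.exp (-(s * (k * p ^ B) * (2 / (p : ℝ) ^ (B - a))))) := by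
        rw [mul_add, mul_one, neg_add, Real.exp_add]; ring
    _ ≤ Real.exp (-(s * (k * p ^ B))) * ((s * (k * p ^ B) / a) ^ a *
        Real.exp (-∑ j : Fin a, s * (k * (p : ℝ) ^ ((j : ℕ) + 1)))) := by gcongr
    _ ≤ _ := by gcongr

lemma mul_exp_pow_le_exp_exp {v : ℝ} (hv : 3000 ≤ v) :
    400 * Real.exp v ^ 12 ≤ Real.exp (Real.exp v / 4) := by
  have h1 : (400 : ℝ) ≤ Real.exp 400 := by linarith [Real.add_one_le_exp (400 : ℝ)]
  have h2 : v ^ 2 / 2 ≤ Real.exp v := by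
    linarith [Real.quadratic_le_exp_of_nonneg (by linarith : 0 ≤ v)]
  rw [← Real.exp_nat_mul]
  calc 400 * Real.exp ((12 : ℕ) * v) ≤ Real.exp 400 * Real.exp ((12 : ℕ) * v) := by gcongr
    _ = Real.exp (400 + (12 : ℕ) * v) := (Real.exp_add _ _).symm
    _ ≤ _ := by
      apply Real.exp_le_exp.2
      push_cast
      nlinarith

lemma polynomial_le_exp_of_sq_le {v x : ℝ} (hv : 3000 ≤ v) (hx : v ^ 2 ≤ x) :
    400 * Real.exp 1 * Real.exp v ^ 12 * (2700 * Real.exp v + 1) ≤ Real.exp (0.007 * x) := by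
  have h1 : (400 : ℝ) ≤ Real.exp 400 := by linarith [Real.add_one_le_exp (400 : ℝ)]
  have h2 : (2701 : ℝ) ≤ Real.exp 2701 := by linarith [Real.add_one_le_exp (2701 : ℝ)]
  have h3 : 2700 * Real.exp v + 1 ≤ Real.exp 2701 * Real.exp v := by
    have : 1 ≤ Real.exp v := Real.one_le_exp (by linarith)
    nlinarith
  rw [← Real.exp_nat_mul]
  calc 400 * Real.exp 1 * Real.exp ((12 : ℕ) * v) * (2700 * Real.exp v + 1)
      ≤ Real.exp 400 * Real.exp 1 * Real.exp ((12 : ℕ) * v) *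
        (Real.exp 2701 * Real.exp v) := by gcongr
    _ = Real.exp (400 + 1 + (12 : ℕ) * v + (2701 + v)) := by simp only [Real.exp_add]
    _ ≤ _ := by
      apply Real.exp_le_exp.2
      push_cast
      nlinarith

lemma exp_le_expected_chains {u p T L : ℝ} {a : ℕ} (hu : 0 < u) (hp : 2 ≤ p)
    (hT : T = u / 2 * (1 + 1 / (5 * p))) (ha : a = ⌊T / (Real.exp 1 * p)⌋₊)
    (hL : Real.exp (u / 2) ≤ L) :
    Real.exp (0.0737 * (u / p) - 1) ≤
      L / p ^ a * (Real.exp (-((1 + 1 / (100 * p)) * T * (1 + 2 / p ^ 10))) * (T / a) ^ a) := by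
  have hp0 : 0 < p := by linarith
  have hT0 : 0 < T := by rw [hT]; positivity
  have hfl : (a : ℝ) ≤ T / (Real.exp 1 * p) := by
    rw [ha]; exact Nat.floor_le (by positivity)
  have hfl' : T / (Real.exp 1 * p) - 1 ≤ a := by
    rw [ha]; exact (Nat.sub_one_lt_floor _).le
  have hpow : p ^ a * Real.exp (T / (Real.exp 1 * p) - 1) ≤ (T / a) ^ a := by
    rcases Nat.eq_zero_or_pos a with h0 | h0
    · rw [h0] at hfl' ⊢
      simp only [pow_zero, one_mul]
      rw [Real.exp_le_one_iff]
      simpa using hfl'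
    · have ha0 : (0 : ℝ) < a := by exact_mod_cast h0
      calc p ^ a * Real.exp (T / (Real.exp 1 * p) - 1) ≤ p ^ a * Real.exp a := by gcongr
        _ = (p * Real.exp 1) ^ a := by rw [mul_pow, ← Real.exp_nat_mul, mul_one]
        _ ≤ _ := by
          gcongr
          rw [le_div_iff₀ (by positivity)] at hfl
          rw [le_div_iff₀ ha0]
          linarith
  have hexp : 0.0737 * (u / p) - 1 ≤ u / 2 + (-((1 + 1 / (100 * p)) * T * (1 + 2 / p ^ 10)) +
      (T / (Real.exp 1 * p) - 1)) := by
    set q : ℝ := 1 / p with hq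
    have hq0 : 0 < q := by positivity
    have hq2 : q ≤ 1 / 2 := by rw [hq]; gcongr
    have e1 : u / p = q * u := by rw [hq]; ring
    have e2 : 1 / (100 * p) = q / 100 := by rw [hq]; field_simp
    have e3 : 2 / p ^ 10 = 2 * q ^ 10 := by rw [hq]; field_simp
    have e4 : T / (Real.exp 1 * p) = q * T / Real.exp 1 := by rw [hq]; field_simp
    have e5 : T = u / 2 * (1 + q / 5) := by rw [hT, hq]; field_simp
    rw [e1, e2, e3, e4]
    have h1 : 0.3678 * (q * T) ≤ q * T / Real.exp 1 := by
      rw [le_div_iff₀ (Real.exp_pos 1)]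
      have := Real.exp_one_lt_d9
      have : 0 < q * T := by positivity
      nlinarith
    have h2 : q ^ 10 ≤ q / 512 := by
      have : q ^ 9 ≤ (1 / 2) ^ 9 := by gcongr
      calc q ^ 10 = q * q ^ 9 := by ring
        _ ≤ q * (1 / 2) ^ 9 := by gcongr
        _ = _ := by ring
    have h3 : (1 + q / 100) * (1 + 2 * q ^ 10) ≤ 1 + 0.018 * q := by
      have : (1 + q / 100) * (1 + 2 * q ^ 10) ≤ (1 + q / 100) * (1 + 2 * (q / 512)) := by gcongr
      nlinarith
    have h4 : (1 + q / 100) * T * (1 + 2 * q ^ 10) ≤ T * (1 + 0.018 * q) := by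
      calc _ = T * ((1 + q / 100) * (1 + 2 * q ^ 10)) := by ring
        _ ≤ _ := by gcongr
    have h5 : 0.0737 * (q * u) ≤ u / 2 + (0.3678 * (q * T) - T * (1 + 0.018 * q)) := by
      rw [e5]
      have : 0 < q * u := by positivity
      have : 0 < q * (q * u) := by positivity
      nlinarith
    linarith
  calc Real.exp (0.0737 * (u / p) - 1)
      ≤ Real.exp (u / 2 + (-((1 + 1 / (100 * p)) * T * (1 + 2 / p ^ 10)) +
      (T / (Real.exp 1 * p) - 1))) := Real.exp_le_exp.2 hexp
    _ = Real.exp (u / 2) / p ^ a * (Real.exp (-((1 + 1 / (100 * p)) * T * (1 + 2 / p ^ 10))) *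
        (p ^ a * Real.exp (T / (Real.exp 1 * p) - 1))) := by
        rw [Real.exp_add, Real.exp_add]; field_simp
    _ ≤ _ := by
      have := (Real.exp_pos _).trans_le hL
      gcongr

/-- Integers congruent to `1` modulo `p` and just above `X * p`. -/
lemma lt_progression_le {p m i : ℕ} {X d : ℝ} (hp : 2 ≤ p) (hX : 0 < X) (hd : 4 ≤ d)
    (hm : (m : ℝ) ≤ d / 2) (hi : i < m) :
    X * p < (p * (⌈X⌉₊ + i) + 1 : ℕ) ∧ ((p * (⌈X⌉₊ + i) + 1 : ℕ) : ℝ) ≤ (X + d) * p := by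
  have hp2 : (2 : ℝ) ≤ p := by exact_mod_cast hp
  have h1 : X ≤ ⌈X⌉₊ := Nat.le_ceil X
  have h2 : (⌈X⌉₊ : ℝ) < X + 1 := Nat.ceil_lt_add_one hX.le
  have h3 : (i : ℝ) + 1 ≤ m := by exact_mod_cast hi
  have h4 : (0 : ℝ) ≤ i := i.cast_nonneg
  push_cast
  constructor <;> nlinarith

set_option maxHeartbeats 1600000 in
lemma ncard_reduction_small_mul_le {N p : ℕ} (hp : p.Prime) {v L : ℝ} (hv : 3000 ≤ v)
    (hN : (N : ℝ) = Real.exp (Real.exp v)) (hpv : p ≤ Real.exp v / v ^ 2)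
    (hL : L = √N / kappa * (Real.exp v / 2 * (1 + 1 / (5 * p)))) :
    (Set.ncard {μ : Nat.Partition N | ∃ ν : Nat.Partition N, IsPReduction p μ ν ∧
      ∀ t ∈ ν.parts, (t : ℝ) ≤ L} : ℝ) *
        (Real.exp (-(kappa / √N * N)) *
          ∏ i ∈ Finset.Icc 1 N, (1 - Real.exp (-(kappa / √N * i)))) ≤
      Real.exp (-(Real.exp (Real.exp v / (15 * p)) + 2700 * Real.exp v)) := by
  set u := Real.exp v with hu
  set s := kappa / √N with hs_def
  set T := u / 2 * (1 + 1 / (5 * (p : ℝ))) with hT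
  set a := ⌊T / (Real.exp 1 * p)⌋₊ with ha
  have hκ := kappa_pos
  have hu0 : 0 < u := Real.exp_pos v
  have hu3 : 3001 ≤ u := by linarith [Real.add_one_le_exp v]
  have hp2 : (2 : ℝ) ≤ p := by exact_mod_cast hp.two_le
  have hp0 : (0 : ℝ) < p := by linarith
  have hsqrt : √(N : ℝ) = Real.exp (u / 2) := by
    rw [hN, ← Real.exp_half]
  have hs : 0 < s := by rw [hs_def, hsqrt]; positivity
  have hsL : s * L = T := by
    rw [hL, hs_def, hsqrt]; field_simp
  have hq : 1 / (5 * (p : ℝ)) ≤ 1 / 10 := by gcongr; linarith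
  have hT1 : u / 2 ≤ T := by
    have : 0 < 1 / (5 * (p : ℝ)) := by positivity
    rw [hT]; nlinarith
  have hT2 : T ≤ 0.55 * u := by rw [hT]; nlinarith
  have hT0 : 0 < T := by linarith
  have hLs : L = T / s := by rw [← hsL]; field_simp
  have hL0 : 0 < L := by rw [hLs]; positivity
  have hLge : Real.exp (u / 2) ≤ L := by
    rw [hL, hsqrt, div_mul_eq_mul_div, le_div_iff₀ hκ]
    have := kappa_le
    gcongr
    linarith
  have hLle : L ≤ 0.55 * u * Real.exp (u / 2) := by
    rw [hL, hsqrt, div_mul_eq_mul_div, div_le_iff₀ hκ]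
    have h1 := one_le_kappa
    calc Real.exp (u / 2) * T ≤ Real.exp (u / 2) * (0.55 * u) := by gcongr
      _ = 0.55 * u * Real.exp (u / 2) * 1 := by ring
      _ ≤ _ := by gcongr
  have hpu : (p : ℝ) ≤ u := by
    refine hpv.trans (div_le_self hu0.le ?_)
    nlinarith
  have hfl : (a : ℝ) ≤ T / (Real.exp 1 * p) := Nat.floor_le (by positivity)
  have hpa : (p : ℝ) ^ a ≤ Real.exp (u / 4) := by
    have h1 : (p : ℝ) ≤ Real.exp p := by linarith [Real.add_one_le_exp (p : ℝ)]
    calc (p : ℝ) ^ a ≤ Real.exp p ^ a := by gcongr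
      _ = Real.exp (a * p) := (Real.exp_nat_mul _ _).symm
      _ ≤ _ := by
        apply Real.exp_le_exp.2
        rw [le_div_iff₀ (by positivity)] at hfl
        have h2 := Real.exp_one_gt_d9
        have h3 : 0 ≤ (a : ℝ) * p := by positivity
        nlinarith
  have hbig := mul_exp_pow_le_exp_exp hv
  rw [← hu] at hbig
  set X := L / (p : ℝ) ^ (a + 11) with hX
  set d := X / (100 * p) with hd
  have hd' : d = L / p ^ a / (100 * p ^ 12) := by
    rw [hd, hX, pow_add]; field_simp
  have hd4 : 4 ≤ d := by
    rw [hd', le_div_iff₀ (by positivity), le_div_iff₀ (by positivity)]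
    calc 4 * (100 * (p : ℝ) ^ 12) * p ^ a ≤ 400 * u ^ 12 * Real.exp (u / 4) := by
          have : (p : ℝ) ^ 12 ≤ u ^ 12 := by gcongr
          calc _ = 400 * (p : ℝ) ^ 12 * p ^ a := by ring
            _ ≤ _ := by gcongr
      _ ≤ Real.exp (u / 4) * Real.exp (u / 4) := by gcongr
      _ = Real.exp (u / 2) := by rw [← Real.exp_add]; ring_nf
      _ ≤ L := hLge
  have hX0 : 0 < X := by positivity
  set m := ⌊d / 2⌋₊ with hm
  have hm1 : (m : ℝ) ≤ d / 2 := Nat.floor_le (by linarith)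
  have hm2 : d / 4 ≤ m := by linarith [Nat.sub_one_lt_floor (d / 2)]
  set k : Fin m → ℕ := fun i => p * (⌈X⌉₊ + i) + 1 with hk
  have hXp : X * p * p ^ (a + 10) = L := by
    rw [hX, pow_add, pow_add]; field_simp
  have hkgt : ∀ i, L < k i * (p : ℝ) ^ (a + 10) := by
    intro i
    rw [← hXp]
    have h2 : X * p < (k i : ℝ) := (lt_progression_le hp.two_le hX0 hd4 hm1 i.2).1
    gcongr
  have hkle : ∀ i, k i * (p : ℝ) ^ (a + 10) ≤ (1 + 1 / (100 * p)) * L := by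
    intro i
    have h3 : (k i : ℝ) ≤ (X + d) * p := (lt_progression_le hp.two_le hX0 hd4 hm1 i.2).2
    calc k i * (p : ℝ) ^ (a + 10) ≤ (X + d) * p * (p : ℝ) ^ (a + 10) := by gcongr
      _ = (1 + 1 / (100 * p)) * L := by rw [← hXp, hd]; field_simp
  have hδ : 1 / (100 * (p : ℝ)) ≤ 1 / 200 := by gcongr; linarith
  have hkN : ∀ i, k i * p ^ (a + 10) ≤ N := by
    intro i
    have h1 : (k i : ℝ) * (p : ℝ) ^ (a + 10) ≤ N := by
      refine (hkle i).trans ?_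
      rw [hN]
      have h2 : u ≤ Real.exp (u / 2) := by
        have h3 : u ≤ u ^ 12 := le_self_pow₀ (by linarith) (by norm_num)
        have h4 : Real.exp (u / 4) ≤ Real.exp (u / 2) := by gcongr; linarith
        have h5 : 0 < u ^ 12 := by positivity
        linarith
      calc (1 + 1 / (100 * (p : ℝ))) * L ≤ (1 + 1 / 200) * (0.55 * u * Real.exp (u / 2)) := by
            gcongr
        _ ≤ u * Real.exp (u / 2) := by
          have : 0 < u * Real.exp (u / 2) := by positivity
          linarith
        _ ≤ Real.exp (u / 2) * Real.exp (u / 2) := by gcongr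
        _ = Real.exp u := by rw [← Real.exp_add]; ring_nf
    exact_mod_cast h1
  have haN : a ≤ N := by
    have h1 : (p : ℝ) ^ a ≤ N := by
      rw [hN]
      exact hpa.trans (Real.exp_le_exp.2 (by linarith))
    exact (Nat.lt_pow_self hp.one_lt).le.trans (by exact_mod_cast h1)
  set t := Real.exp (-((1 + 1 / (100 * (p : ℝ))) * T * (1 + 2 / (p : ℝ) ^ 10))) * (T / a) ^ a
    with ht
  have hchain : ∀ i, t ≤ chainTail s p (k i) a (a + 10) := by
    intro i
    refine le_trans ?_ (chainTail_ge hs hp.two_le (by simp [hk]) (by omega))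
    have h1 : T ≤ s * (k i * (p : ℝ) ^ (a + 10)) := by
      rw [← hsL]; exact mul_le_mul_of_nonneg_left (hkgt i).le hs.le
    have h2 : s * (k i * (p : ℝ) ^ (a + 10)) ≤ (1 + 1 / (100 * (p : ℝ))) * T := by
      rw [← hsL, mul_left_comm _ s L]
      exact mul_le_mul_of_nonneg_left (hkle i) hs.le
    rw [Nat.add_sub_cancel_left, ht]
    gcongr
  have hmain := ncard_chains_small_le hs hp (by omega : a + 1 ≤ a + 10) k (fun i => by simp [hk])
    (fun i j hij => by
      have h1 : p * (⌈X⌉₊ + i) = p * (⌈X⌉₊ + j) := Nat.succ_injective hij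
      have h2 := Nat.eq_of_mul_eq_mul_left hp.pos h1
      exact Fin.ext (by omega))
    (fun i => by simp [hk])
    (fun i => (Nat.mul_le_mul_left _ (Nat.pow_le_pow_right hp.pos (by omega))).trans (hkN i))
    t hchain
    {μ : Nat.Partition N | ∃ ν : Nat.Partition N, IsPReduction p μ ν ∧ ∀ t ∈ ν.parts, (t : ℝ) ≤ L}
    (fun μ ⟨ν, hν, hνL⟩ i =>
      hν.sum_pow_mul_count_lt hp hνL (by simp [hk]) (by simp [hk]) haN (hkgt i))
  refine hmain.trans (Real.exp_le_exp.2 (neg_le_neg ?_))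
  have hexp := exp_le_expected_chains hu0 hp2 hT ha hLge
  rw [← ht] at hexp
  have ht0 : 0 ≤ t := by positivity
  have hx : v ^ 2 ≤ u / p := by
    rw [le_div_iff₀ (by positivity)] at hpv ⊢
    linarith
  have hpoly := polynomial_le_exp_of_sq_le hv hx
  rw [← hu] at hpoly
  have hE1 : 1 ≤ Real.exp (u / (15 * p)) := Real.one_le_exp (by positivity)
  have hkey : 400 * u ^ 12 * (Real.exp (u / (15 * p)) * (2700 * u + 1)) ≤ L / p ^ a * t := by
    refine le_trans ?_ hexp
    have h1 : Real.exp (0.0737 * (u / p) - 1) * Real.exp 1 =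
        Real.exp (0.0667 * (u / p)) * Real.exp (0.007 * (u / p)) := by
      rw [← Real.exp_add, ← Real.exp_add]; ring_nf
    have h2 : Real.exp (u / (15 * p)) ≤ Real.exp (0.0667 * (u / p)) := by
      apply Real.exp_le_exp.2
      have : u / (15 * p) = u / p / 15 := by field_simp
      have : 0 < u / p := by positivity
      linarith
    refine le_of_mul_le_mul_right ?_ (Real.exp_pos 1)
    rw [h1]
    calc 400 * u ^ 12 * (Real.exp (u / (15 * p)) * (2700 * u + 1)) * Real.exp 1
        = Real.exp (u / (15 * p)) * (400 * Real.exp 1 * u ^ 12 * (2700 * u + 1)) := by ring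
      _ ≤ _ := by gcongr
  calc Real.exp (u / (15 * p)) + 2700 * u
      ≤ Real.exp (u / (15 * p)) * (2700 * u + 1) := by nlinarith
    _ ≤ L / p ^ a * t / (400 * u ^ 12) := by
        rw [le_div_iff₀ (by positivity)]
        linarith
    _ ≤ L / p ^ a * t / (400 * p ^ 12) := by gcongr
    _ = d / 4 * t := by rw [hd']; ring
    _ ≤ m * t := by gcongr

/-- **Proposition 2.** There exist absolute constants `C > 0` and `N₀` such
that for all `N ≥ N₀` and every prime `p ≤ (log N)/(log log N)²`, the number of partitions
`μ` of `N` whose reduction `μ̃` has largest part at most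
`(√6/(2π))·√N·(log N)·(1 + 1/(5p))` is at most `C · p(N) · exp(−N^(1/(15p)))`. -/
theorem reduction_has_large_part :
    ∃ C : ℝ, 0 < C ∧ ∃ N₀ : ℕ, ∀ N : ℕ, N₀ ≤ N → ∀ p : ℕ, p.Prime →
      (p : ℝ) ≤ Real.log N / (Real.log (Real.log N)) ^ 2 →
      (Set.ncard {μ : Nat.Partition N | ∃ ν : Nat.Partition N, IsPReduction p μ ν ∧
          ∀ t ∈ ν.parts,
            (t : ℝ) ≤ Real.sqrt 6 / (2 * Real.pi) * Real.sqrt N * Real.log N *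
              (1 + 1 / (5 * (p : ℝ)))} : ℝ) ≤
        C * (Fintype.card (Nat.Partition N) : ℝ) *
          Real.exp (-(N : ℝ) ^ ((1 : ℝ) / (15 * (p : ℝ)))) := by
  obtain ⟨c, hc, hcard⟩ := exists_card_partition_ge
  refine ⟨c⁻¹, inv_pos.2 hc, ⌈Real.exp (Real.exp 3000)⌉₊, fun N hN p hp hpN => ?_⟩
  have hN0 : Real.exp (Real.exp 3000) ≤ N := (Nat.le_ceil _).trans (by exact_mod_cast hN)
  have hNpos : (0 : ℝ) < N := (Real.exp_pos _).trans_le hN0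
  have hlog : Real.exp 3000 ≤ Real.log N := (Real.le_log_iff_exp_le hNpos).2 hN0
  have hlogpos : 0 < Real.log N := (Real.exp_pos _).trans_le hlog
  have hv : 3000 ≤ Real.log (Real.log N) := (Real.le_log_iff_exp_le hlogpos).2 hlog
  have hexpv : Real.exp (Real.log (Real.log N)) = Real.log N := Real.exp_log hlogpos
  have hp0 : (0 : ℝ) < p := by exact_mod_cast hp.pos
  have hκ := kappa_pos
  have hr : 0 < √(N : ℝ) := Real.sqrt_pos.2 hNpos
  have hrr : √(N : ℝ) * √(N : ℝ) = N := Real.mul_self_sqrt hNpos.le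
  have hmain := ncard_reduction_small_mul_le hp hv (by rw [hexpv, Real.exp_log hNpos])
    (by rwa [hexpv]) (L := √6 / (2 * Real.pi) * √N * Real.log N * (1 + 1 / (5 * (p : ℝ))))
    (by rw [hexpv, kappa]; field_simp)
  rw [hexpv] at hmain
  have hrpow : (N : ℝ) ^ ((1 : ℝ) / (15 * (p : ℝ))) = Real.exp (Real.log N / (15 * p)) := by
    rw [Real.rpow_def_of_pos hNpos]; ring_nf
  have hsN : kappa / √(N : ℝ) * N = kappa * √N := by
    field_simp; linarith
  have hprod := exp_neg_zeta_div_le_prod (div_pos hκ hr) N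
  rw [← kappa_sq, show kappa ^ 2 / (kappa / √(N : ℝ)) = kappa * √N by field_simp] at hprod
  rw [hsN, neg_add, Real.exp_add] at hmain
  rw [hrpow]
  have hpow : Real.exp (-(2700 * Real.log N)) = ((N : ℝ) ^ 2700)⁻¹ := by
    rw [Real.exp_neg, ← Real.exp_log (pow_pos hNpos 2700), Real.log_pow]
    norm_num
  rw [hpow] at hmain
  have hN1 : 1 ≤ N := by exact_mod_cast hNpos
  have hc' := hcard N hN1
  set Q := (Set.ncard {μ : Nat.Partition N | ∃ ν : Nat.Partition N, IsPReduction p μ ν ∧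
          ∀ t ∈ ν.parts, (t : ℝ) ≤ √6 / (2 * Real.pi) * √N * Real.log N *
              (1 + 1 / (5 * (p : ℝ)))} : ℝ)
  have hQ : 0 ≤ Q := Nat.cast_nonneg _
  have h1 : Q * (Real.exp (-(kappa * √N)) * Real.exp (-(kappa * √N))) ≤
      Real.exp (-Real.exp (Real.log N / (15 * p))) * ((N : ℝ) ^ 2700)⁻¹ :=
    le_trans (by gcongr) hmain
  have h2 : Real.exp (-(kappa * √N)) * Real.exp (-(kappa * √N)) =
      (Real.exp (2 * kappa * √N))⁻¹ := by
    rw [← Real.exp_add, ← Real.exp_neg]; ring_nf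
  rw [h2, ← div_eq_mul_inv, div_le_iff₀ (Real.exp_pos _)] at h1
  calc Q ≤ Real.exp (-Real.exp (Real.log N / (15 * p))) * ((N : ℝ) ^ 2700)⁻¹ *
        Real.exp (2 * kappa * √N) := h1
    _ = c⁻¹ * (c * (Real.exp (2 * kappa * √N) / (N : ℝ) ^ 2700)) *
        Real.exp (-Real.exp (Real.log N / (15 * p))) := by
        rw [inv_mul_cancel_left₀ hc.ne']; ring
    _ ≤ _ := by gcongr
end

section
/- There is an absolute constant C > 0 such that for every prime p and every real number x ≥ 1, one has log F_p(x) ≥ (log x)²/(2 log p) + (1/2)·log x − C, where F_p(x) = ∑_{j=0}^∞ p̃(j)·e^(−j/x). -/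
/-- `ptilde p j` is the number of partitions of `j` into parts that are powers of `p`
(including `p⁰ = 1`); in particular `ptilde p 0 = 1` (the empty partition). -/
noncomputable def ptilde (p j : ℕ) : ℕ :=
  Nat.card {π : Nat.Partition j // ∀ a ∈ π.parts, ∃ i : ℕ, a = p ^ i}

/-- `Fp p x = ∑_{j≥0} p̃(j)·e^(−j/x)`. -/
noncomputable def Fp (p : ℕ) (x : ℝ) : ℝ :=
  ∑' j : ℕ, (ptilde p j : ℝ) * Real.exp (-(j : ℝ) / x)

open Filter Topology

/-- A partition of `j` into powers of `p` is determined by the multiplicities of the powers of `p`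
not exceeding `j`. -/
theorem ptilde_le_pow_log {p : ℕ} (hp : 2 ≤ p) (j : ℕ) :
    ptilde p j ≤ (j + 1) ^ (Nat.log 2 j + 1) := by
  have hcount (π : Nat.Partition j) (a : ℕ) : π.parts.count a ≤ j := by
    rcases Nat.eq_zero_or_pos a with rfl | ha
    · rw [Multiset.count_eq_zero_of_notMem fun h ↦ (π.parts_pos h).ne rfl]
      exact Nat.zero_le _
    · obtain ⟨u, hu⟩ := Multiset.le_iff_exists_add.1
        (Multiset.le_count_iff_replicate_le.1 (le_refl (π.parts.count a)))
      have h := congrArg Multiset.sum hu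
      rw [π.parts_sum, Multiset.sum_add, Multiset.sum_replicate, smul_eq_mul] at h
      exact (Nat.le_mul_of_pos_right _ ha).trans (by omega)
  let g : {π : Nat.Partition j // ∀ a ∈ π.parts, ∃ i : ℕ, a = p ^ i} →
      (Fin (Nat.log 2 j + 1) → Fin (j + 1)) :=
    fun π i ↦ ⟨π.1.parts.count (p ^ (i : ℕ)), Nat.lt_succ_of_le (hcount _ _)⟩
  have key (π σ : {π : Nat.Partition j // ∀ a ∈ π.parts, ∃ i : ℕ, a = p ^ i}) (h : g π = g σ)
      (a : ℕ) (ha : a ∈ π.1.parts) : π.1.parts.count a = σ.1.parts.count a := by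
    obtain ⟨i, rfl⟩ := π.2 a ha
    have hle : p ^ i ≤ j := by
      simpa [π.1.parts_sum] using Multiset.le_sum_of_mem ha
    have hi : i ≤ Nat.log 2 j :=
      Nat.le_log_of_pow_le one_lt_two ((Nat.pow_le_pow_left hp i).trans hle)
    simpa [g] using congrArg Fin.val (congrFun h ⟨i, Nat.lt_succ_of_le hi⟩)
  have hg : Function.Injective g := by
    intro π σ h
    refine Subtype.ext (Nat.Partition.ext (Multiset.ext.2 fun a ↦ ?_))
    by_cases ha : a ∈ π.1.parts
    · exact key π σ h a ha
    · by_cases hb : a ∈ σ.1.parts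
      · exact (key σ π h.symm a hb).symm
      · rw [Multiset.count_eq_zero_of_notMem ha, Multiset.count_eq_zero_of_notMem hb]
  simpa [ptilde] using Nat.card_le_card_of_injective g hg

/-- Distinct multiplicity vectors for the first `n` powers of `p` give distinct partitions. -/
theorem card_filter_sum_pow_le_ptilde {p : ℕ} (hp : 2 ≤ p) {n : ℕ}
    (S : Finset (Fin n → ℕ)) (j : ℕ) :
    (S.filter fun f ↦ ∑ i : Fin n, f i * p ^ (i : ℕ) = j).card ≤ ptilde p j := by
  let parts (f : Fin n → ℕ) : Multiset ℕ := ∑ i, Multiset.replicate (f i) (p ^ (i : ℕ))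
  have hmem (f : Fin n → ℕ) (a : ℕ) (ha : a ∈ parts f) : ∃ i : ℕ, a = p ^ i := by
    obtain ⟨i, -, hi⟩ := Multiset.mem_sum.1 ha
    exact ⟨i, Multiset.eq_of_mem_replicate hi⟩
  have hcount (f : Fin n → ℕ) (i : Fin n) : (parts f).count (p ^ (i : ℕ)) = f i := by
    have hinj (k : Fin n) : p ^ (k : ℕ) = p ^ (i : ℕ) ↔ k = i := by
      rw [Nat.pow_right_inj hp, Fin.ext_iff]
    simp [parts, Multiset.count_sum', Multiset.count_replicate, hinj]
  let g : {f // f ∈ S.filter fun f ↦ ∑ i : Fin n, f i * p ^ (i : ℕ) = j} →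
      {π : Nat.Partition j // ∀ a ∈ π.parts, ∃ i : ℕ, a = p ^ i} :=
    fun f ↦ ⟨⟨parts f.1, fun {a} ha ↦ by
        obtain ⟨i, rfl⟩ := hmem _ _ ha
        positivity, by
        simpa [parts, Multiset.sum_sum] using (Finset.mem_filter.1 f.2).2⟩, hmem f.1⟩
  have hg : Function.Injective g := by
    intro f f' h
    have h' : parts f.1 = parts f'.1 := congrArg (fun π ↦ π.1.parts) h
    exact Subtype.ext (funext fun i ↦ by rw [← hcount f.1 i, h', hcount])
  simpa only [ptilde, Nat.card_eq_fintype_card, Fintype.card_coe] using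
    Nat.card_le_card_of_injective g hg

theorem summable_ptilde_mul_exp {p : ℕ} (hp : 2 ≤ p) {x : ℝ} (hx : 0 < x) :
    Summable fun j : ℕ ↦ (ptilde p j : ℝ) * Real.exp (-(j : ℝ) / x) := by
  have hgeom : Summable fun j : ℕ ↦ Real.exp (-(1 / (2 * x))) ^ j :=
    summable_geometric_of_lt_one (Real.exp_pos _).le
      (Real.exp_lt_one_iff.2 (neg_lt_zero.2 (by positivity)))
  have hlog : ∀ᶠ j : ℕ in atTop, 3 * Real.log (j + 1 : ℝ) ^ 2 ≤ 1 / (4 * x) * (j + 1 : ℝ) := by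
    have h := (Real.isLittleO_pow_log_id_atTop (n := 2)).def
      (show (0 : ℝ) < 1 / (12 * x) by positivity)
    have ht : Tendsto (fun j : ℕ ↦ (j + 1 : ℝ)) atTop atTop :=
      tendsto_atTop_add_const_right _ _ tendsto_natCast_atTop_atTop
    filter_upwards [ht.eventually h] with j hj
    rw [Real.norm_of_nonneg (by positivity), id, Real.norm_of_nonneg (by positivity)] at hj
    calc 3 * Real.log (j + 1 : ℝ) ^ 2 ≤ 3 * (1 / (12 * x) * (j + 1 : ℝ)) := by linarith
      _ = _ := by field_simp; norm_num
  refine Summable.of_norm_bounded_eventually_nat hgeom ?_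
  filter_upwards [hlog, eventually_ge_atTop 1] with j hj hj1
  rw [Real.norm_of_nonneg (by positivity)]
  have hj1' : (1 : ℝ) ≤ j := by exact_mod_cast hj1
  have hpt : (ptilde p j : ℝ) ≤ Real.exp (3 * Real.log (j + 1 : ℝ) ^ 2) := by
    have hpos : (0 : ℝ) < (j + 1 : ℝ) := by positivity
    have h2 : Real.log 2 ≤ Real.log (j + 1 : ℝ) := Real.log_le_log two_pos (by linarith)
    have hln : (Nat.log 2 j : ℝ) * Real.log 2 ≤ Real.log (j + 1 : ℝ) := by
      rw [← Real.log_pow]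
      refine Real.log_le_log (by positivity) ?_
      have : 2 ^ Nat.log 2 j ≤ j + 1 := (Nat.pow_log_le_self 2 (by omega)).trans (Nat.le_succ j)
      exact_mod_cast this
    have hl2 := Real.log_two_gt_d9
    have hexp : (Nat.log 2 j + 1 : ℝ) ≤ 3 * Real.log (j + 1 : ℝ) := by
      have h0 : (0 : ℝ) ≤ Nat.log 2 j := Nat.cast_nonneg _
      nlinarith
    calc (ptilde p j : ℝ) ≤ (j + 1 : ℝ) ^ (Nat.log 2 j + 1) := by
          exact_mod_cast ptilde_le_pow_log hp j
      _ = Real.exp ((Nat.log 2 j + 1 : ℝ) * Real.log (j + 1 : ℝ)) := by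
          rw [← Real.exp_log (pow_pos hpos _), Real.log_pow]
          push_cast
          rfl
      _ ≤ _ := by
          refine Real.exp_le_exp.2 ?_
          nlinarith [Real.log_pos one_lt_two]
  calc (ptilde p j : ℝ) * Real.exp (-(j : ℝ) / x)
      ≤ Real.exp (3 * Real.log (j + 1 : ℝ) ^ 2) * Real.exp (-(j : ℝ) / x) := by gcongr
    _ ≤ Real.exp (1 / (4 * x) * (j + j : ℝ)) * Real.exp (-(j : ℝ) / x) := by
        refine mul_le_mul_of_nonneg_right (Real.exp_le_exp.2 (hj.trans ?_)) (Real.exp_pos _).le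
        gcongr
    _ = Real.exp (-(1 / (2 * x))) ^ j := by
        rw [← Real.exp_add, ← Real.exp_nat_mul]
        congr 1
        field_simp
        ring

/-- The finite Euler products are lower bounds for `Fp`. -/
theorem prod_one_sub_exp_inv_le_Fp {p : ℕ} (hp : 2 ≤ p) {x : ℝ} (hx : 0 < x) (n : ℕ) :
    ∏ i : Fin n, (1 - Real.exp (-((p : ℝ) ^ (i : ℕ)) / x))⁻¹ ≤ Fp p x := by
  have hlim : Tendsto (fun M : ℕ ↦ ∏ i : Fin n, ∑ m ∈ Finset.range M,
      Real.exp (-((p : ℝ) ^ (i : ℕ)) / x) ^ m) atTop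
      (𝓝 (∏ i : Fin n, (1 - Real.exp (-((p : ℝ) ^ (i : ℕ)) / x))⁻¹)) := by
    refine tendsto_finsetProd _ fun i _ ↦ ?_
    refine (hasSum_geometric_of_lt_one (Real.exp_pos _).le ?_).tendsto_sum_nat
    refine Real.exp_lt_one_iff.2 (div_neg_of_neg_of_pos (neg_neg_of_pos ?_) hx)
    positivity
  refine le_of_tendsto' hlim fun M ↦ ?_
  set S := Fintype.piFinset fun _ : Fin n ↦ Finset.range M
  let v (f : Fin n → ℕ) : ℕ := ∑ i : Fin n, f i * p ^ (i : ℕ)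
  calc ∏ i : Fin n, ∑ m ∈ Finset.range M, Real.exp (-((p : ℝ) ^ (i : ℕ)) / x) ^ m
      = ∑ f ∈ S, Real.exp (-(v f : ℝ) / x) := by
        rw [Finset.prod_univ_sum]
        refine Finset.sum_congr rfl fun f _ ↦ ?_
        simp_rw [← Real.exp_nat_mul]
        rw [← Real.exp_sum]
        congr 1
        simp only [v]
        push_cast
        rw [← Finset.sum_neg_distrib, Finset.sum_div]
        exact Finset.sum_congr rfl fun i _ ↦ by ring
    _ = ∑ j ∈ S.image v, ((S.filter fun f ↦ v f = j).card : ℝ) * Real.exp (-(j : ℝ) / x) := by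
        rw [← Finset.sum_fiberwise_of_maps_to (t := S.image v) (g := v)
          fun f hf ↦ Finset.mem_image_of_mem v hf]
        refine Finset.sum_congr rfl fun j _ ↦ ?_
        rw [← nsmul_eq_mul, ← Finset.sum_const]
        exact Finset.sum_congr rfl fun f hf ↦ by rw [(Finset.mem_filter.1 hf).2]
    _ ≤ ∑ j ∈ S.image v, (ptilde p j : ℝ) * Real.exp (-(j : ℝ) / x) := by
        gcongr with j
        exact card_filter_sum_pow_le_ptilde hp S j
    _ ≤ Fp p x := (summable_ptilde_mul_exp hp hx).sum_le_tsum _ fun j _ ↦ by positivity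

theorem sum_log_sub_le_log_Fp {p : ℕ} (hp : 2 ≤ p) {x : ℝ} (hx : 0 < x) (n : ℕ) :
    ∑ i : Fin n, (Real.log x - (i : ℕ) * Real.log p) ≤ Real.log (Fp p x) := by
  have hp0 : (0 : ℝ) < p := by positivity
  have hfac (i : ℕ) : x / (p : ℝ) ^ i ≤ (1 - Real.exp (-((p : ℝ) ^ i) / x))⁻¹ := by
    have hneg : -((p : ℝ) ^ i) / x < 0 :=
      div_neg_of_neg_of_pos (neg_neg_of_pos (by positivity)) hx
    rw [← inv_div]
    refine inv_anti₀ (sub_pos.2 (Real.exp_lt_one_iff.2 hneg)) ?_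
    have := Real.add_one_le_exp (-((p : ℝ) ^ i) / x)
    rw [neg_div] at this ⊢
    linarith
  have hprod : ∏ i : Fin n, x / (p : ℝ) ^ (i : ℕ) ≤ Fp p x :=
    (Finset.prod_le_prod (fun (i : Fin n) _ ↦ by positivity) fun i _ ↦ hfac i).trans
      (prod_one_sub_exp_inv_le_Fp hp hx n)
  refine le_trans (le_of_eq ?_) (Real.log_le_log (by positivity) hprod)
  rw [Real.log_prod fun i _ ↦ by positivity]
  refine Finset.sum_congr rfl fun i _ ↦ ?_
  rw [Real.log_div hx.ne' (by positivity), Real.log_pow]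

/-- **Lemma 2, lower bound.** There is an absolute constant `C > 0` such that
for every prime `p` and every real `x ≥ 1`,
`log F_p(x) ≥ (log x)²/(2 log p) + (1/2)·log x − C`. -/
theorem log_Fp_lower_bound :
    ∃ C : ℝ, 0 < C ∧ ∀ p : ℕ, p.Prime → ∀ x : ℝ, 1 ≤ x →
      (Real.log x) ^ 2 / (2 * Real.log p) + (1 / 2) * Real.log x - C ≤
        Real.log (Fp p x) := by
  refine ⟨1, one_pos, fun p hp x hx ↦ ?_⟩
  have hL : 0 < Real.log p := Real.log_pos (by exact_mod_cast hp.one_lt)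
  set L := Real.log p
  set t := Real.log x / L with ht
  have hx' : Real.log x = t * L := by rw [ht]; field_simp
  have ht0 : 0 ≤ t := div_nonneg (Real.log_nonneg hx) hL.le
  have h1 := Nat.floor_le ht0
  have h2 := Nat.lt_floor_add_one t
  set n := ⌊t⌋₊
  have hsum (m : ℕ) : ∑ i ∈ Finset.range m, (t * L - (i : ℝ) * L) =
      L * (m * t - m * (m - 1) / 2) := by
    induction m with
    | zero => simp
    | succ k ih => rw [Finset.sum_range_succ, ih]; push_cast; ring
  have h := sum_log_sub_le_log_Fp hp.two_le (one_pos.trans_le hx) (n + 1)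
  rw [Fin.sum_univ_eq_sum_range (fun i ↦ Real.log x - (i : ℝ) * Real.log p), hx', hsum] at h
  refine le_trans ?_ h
  have hsq : (t * L) ^ 2 / (2 * L) = L * (t ^ 2 / 2) := by field_simp
  have hfrac : 0 ≤ L * ((t - n) * (n + 1 - t)) :=
    mul_nonneg hL.le (mul_nonneg (by linarith) (by linarith))
  rw [hx', hsq]
  push_cast
  nlinarith
end

section
/- There is an absolute constant C > 0 such that for every prime p and every real number x ≥ 1, one has log F_p(x) ≤ (log x)²/(2 log p) + (1/2)·log x + (1/8)·log p + C, where F_p(x) = ∑_{j=0}^∞ p̃(j)·e^(−j/x). -/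
/-- The number of partitions of `j` into powers of `p` is at most the number of ways of writing
`j = ∑ aᵢ pⁱ` with digits `aᵢ` bounded by `N`, as soon as `j < N`. -/
theorem ptilde_le_card_digits {p : ℕ} (hp : 1 < p) {N j : ℕ} (hj : j < N) :
    ptilde p j ≤ ((Fintype.piFinset fun _ : Fin N => Finset.range N).filter
      fun a => ∑ i : Fin N, a i * p ^ (i : ℕ) = j).card := by
  classical
  rw [ptilde, ← Fintype.card_coe, ← Nat.card_eq_fintype_card]
  have hpow : ∀ i, N ≤ i → j < p ^ i := fun i hi =>
    hj.trans_le (hi.trans (Nat.lt_pow_self hp).le)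
  have hle : ∀ (π : Nat.Partition j) (a : ℕ), a ∈ π.parts → a ≤ j := fun π a ha =>
    (Multiset.le_sum_of_mem ha).trans_eq π.parts_sum
  have hmem : ∀ π : {π : Nat.Partition j // ∀ a ∈ π.parts, ∃ i : ℕ, a = p ^ i},
      (fun i : Fin N => π.1.parts.count (p ^ (i : ℕ))) ∈
        (Fintype.piFinset fun _ : Fin N => Finset.range N).filter
          fun a => ∑ i : Fin N, a i * p ^ (i : ℕ) = j := by
    rintro ⟨π, hπ⟩
    have hsum : ∑ i : Fin N, π.parts.count (p ^ (i : ℕ)) * p ^ (i : ℕ) = j := by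
      rw [Fin.sum_univ_eq_sum_range (fun i => π.parts.count (p ^ i) * p ^ i) N]
      conv_rhs => rw [← π.parts_sum, Finset.sum_multiset_count]
      rw [← Finset.sum_image (s := Finset.range N) (g := fun i => p ^ i)
        (f := fun a => π.parts.count a * a) (Nat.pow_right_injective hp).injOn]
      symm
      simp only [smul_eq_mul]
      refine Finset.sum_subset ?_ ?_
      · intro a ha
        rw [Multiset.mem_toFinset] at ha
        obtain ⟨i, rfl⟩ := hπ a ha
        refine Finset.mem_image_of_mem _ (Finset.mem_range.2 ?_)
        by_contra! h
        exact absurd (hle π _ ha) (hpow i h).not_ge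
      · intro a _ ha
        rw [Multiset.mem_toFinset] at ha
        simp [Multiset.count_eq_zero_of_notMem ha]
    refine Finset.mem_filter.2 ⟨Fintype.mem_piFinset.2 fun i => Finset.mem_range.2 ?_, hsum⟩
    refine lt_of_le_of_lt ?_ hj
    calc π.parts.count (p ^ (i : ℕ))
        ≤ π.parts.count (p ^ (i : ℕ)) * p ^ (i : ℕ) :=
          Nat.le_mul_of_pos_right _ (by positivity)
      _ ≤ ∑ i : Fin N, π.parts.count (p ^ (i : ℕ)) * p ^ (i : ℕ) :=
          Finset.single_le_sum (f := fun i : Fin N => π.parts.count (p ^ (i : ℕ)) * p ^ (i : ℕ))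
            (fun _ _ => Nat.zero_le _) (Finset.mem_univ i)
      _ = j := hsum
  refine Nat.card_le_card_of_injective (fun π => ⟨_, hmem π⟩) ?_
  rintro ⟨π, hπ⟩ ⟨σ, hσ⟩ h
  have h' : ∀ i : Fin N, π.parts.count (p ^ (i : ℕ)) = σ.parts.count (p ^ (i : ℕ)) := fun i =>
    congrFun (congrArg Subtype.val h) i
  refine Subtype.ext (Nat.Partition.ext (Multiset.ext.2 fun a => ?_))
  by_cases ha : ∃ i, a = p ^ i
  · obtain ⟨i, rfl⟩ := ha
    by_cases hi : i < N
    · exact h' ⟨i, hi⟩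
    · have hlt := hpow i (not_lt.1 hi)
      rw [Multiset.count_eq_zero_of_notMem fun hm => (hle π _ hm).not_gt hlt,
        Multiset.count_eq_zero_of_notMem fun hm => (hle σ _ hm).not_gt hlt]
  · rw [Multiset.count_eq_zero_of_notMem fun hm => ha (hπ a hm),
      Multiset.count_eq_zero_of_notMem fun hm => ha (hσ a hm)]

/-- Partial sums of the generating function of `ptilde p` are bounded by the partial products of
its Euler product. -/
theorem sum_ptilde_mul_pow_le {p : ℕ} (hp : 1 < p) {q : ℝ} (hq0 : 0 ≤ q) (hq1 : q < 1) (N : ℕ) :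
    ∑ j ∈ Finset.range N, (ptilde p j : ℝ) * q ^ j ≤
      ∏ i ∈ Finset.range N, (1 - q ^ p ^ i)⁻¹ := by
  classical
  set S := Fintype.piFinset fun _ : Fin N => Finset.range N
  set w : (Fin N → ℕ) → ℕ := fun a => ∑ i, a i * p ^ (i : ℕ)
  calc ∑ j ∈ Finset.range N, (ptilde p j : ℝ) * q ^ j
      ≤ ∑ j ∈ Finset.range N, ∑ a ∈ S with w a = j, q ^ w a := by
        refine Finset.sum_le_sum fun j hj => ?_
        rw [Finset.sum_congr rfl fun a ha => by rw [(Finset.mem_filter.1 ha).2],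
          Finset.sum_const, nsmul_eq_mul]
        gcongr
        exact ptilde_le_card_digits hp (Finset.mem_range.1 hj)
    _ ≤ ∑ a ∈ S, q ^ w a :=
        Finset.sum_fiberwise_le_sum_of_sum_fiber_nonneg fun j _ =>
          Finset.sum_nonneg fun a _ => by positivity
    _ = ∏ i : Fin N, ∑ a ∈ Finset.range N, (q ^ p ^ (i : ℕ)) ^ a := by
        rw [Finset.prod_univ_sum]
        refine Finset.sum_congr rfl fun a _ => ?_
        rw [← Finset.prod_pow_eq_pow_sum]
        refine Finset.prod_congr rfl fun i _ => ?_
        rw [← pow_mul, mul_comm]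
    _ = ∏ i ∈ Finset.range N, ∑ a ∈ Finset.range N, (q ^ p ^ i) ^ a :=
        Fin.prod_univ_eq_prod_range (fun i => ∑ a ∈ Finset.range N, (q ^ p ^ i) ^ a) N
    _ ≤ ∏ i ∈ Finset.range N, (1 - q ^ p ^ i)⁻¹ := by
        refine Finset.prod_le_prod (fun i _ => by positivity) fun i _ => ?_
        have h1 : q ^ p ^ i < 1 := pow_lt_one₀ hq0 hq1 (by positivity)
        rw [← tsum_geometric_of_lt_one (by positivity) h1]
        exact (summable_geometric_of_lt_one (by positivity) h1).sum_le_tsum _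
          fun _ _ => by positivity

theorem inv_one_sub_exp_neg_le {u : ℝ} (hu : 0 < u) :
    (1 - Real.exp (-u))⁻¹ ≤ 1 + u⁻¹ := by
  have h1 : Real.exp (-u) ≤ (1 + u)⁻¹ := by
    rw [Real.exp_neg]
    gcongr
    linarith [Real.add_one_le_exp u]
  have h2 : u / (1 + u) ≤ 1 - Real.exp (-u) := by
    have : u / (1 + u) = 1 - (1 + u)⁻¹ := by field_simp; ring
    linarith
  calc (1 - Real.exp (-u))⁻¹ ≤ (u / (1 + u))⁻¹ := by gcongr
    _ = 1 + u⁻¹ := by field_simp; ring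

theorem prod_one_add_div_pow_le_exp {p : ℕ} (hp : 1 < p) {x : ℝ} (hx : 1 ≤ x) (N : ℕ) :
    ∏ i ∈ Finset.range N, (1 + x / (p : ℝ) ^ i) ≤
      Real.exp ((Real.log x) ^ 2 / (2 * Real.log p) + (1 / 2) * Real.log x +
          (1 / 8) * Real.log p + 4) := by
  have hx0 : 0 < x := by linarith
  have hp2 : (2 : ℝ) ≤ p := by exact_mod_cast hp
  have hp0 : (0 : ℝ) < p := by linarith
  have hL : 0 < Real.log p := Real.log_pos (by linarith)
  obtain ⟨m, hm1, hm2⟩ := exists_nat_pow_near hx (show (1 : ℝ) < p by linarith)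
  have hhead : ∏ i ∈ Finset.range (m + 1), (1 + x / (p : ℝ) ^ i) ≤
      Real.exp ((m + 1) * Real.log x - m * (m + 1) / 2 * Real.log p + 2) := by
    have hterm : ∀ i ∈ Finset.range (m + 1), 1 + x / (p : ℝ) ^ i ≤
        Real.exp (Real.log x - i * Real.log p + (p : ℝ) ^ i / x) := by
      intro i _
      rw [Real.exp_add, ← Real.log_pow, ← Real.log_div (by positivity) (by positivity),
        Real.exp_log (by positivity)]
      calc 1 + x / (p : ℝ) ^ i = x / (p : ℝ) ^ i * ((p : ℝ) ^ i / x + 1) := by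
            field_simp
        _ ≤ _ := by gcongr; exact Real.add_one_le_exp _
    refine (Finset.prod_le_prod (fun i _ => by positivity) hterm).trans ?_
    rw [← Real.exp_sum, Finset.sum_add_distrib]
    gcongr
    · refine le_of_eq ?_
      clear hm1 hm2 hterm
      induction m with
      | zero => simp
      | succ m ih => rw [Finset.sum_range_succ, ih]; push_cast; ring
    · rw [← Finset.sum_div, div_le_iff₀ hx0]
      have : ∀ n : ℕ, ∑ i ∈ Finset.range (n + 1), (p : ℝ) ^ i ≤ 2 * (p : ℝ) ^ n := by
        intro n
        induction n with
        | zero => simp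
        | succ n ih =>
          rw [Finset.sum_range_succ, pow_succ]
          nlinarith [pow_pos hp0 n]
      linarith [this m]
  have htail : ∏ k ∈ Finset.range N, (1 + x / (p : ℝ) ^ (m + 1 + k)) ≤ Real.exp 2 := by
    have hterm : ∀ k ∈ Finset.range N, 1 + x / (p : ℝ) ^ (m + 1 + k) ≤
        Real.exp ((1 / 2 : ℝ) ^ k) := by
      intro k _
      have : x / (p : ℝ) ^ (m + 1 + k) ≤ (1 / 2 : ℝ) ^ k := by
        rw [pow_add, ← div_div, div_pow, one_pow]
        gcongr
        exact (div_le_one (by positivity)).2 hm2.le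
      linarith [Real.add_one_le_exp ((1 / 2 : ℝ) ^ k)]
    refine (Finset.prod_le_prod (fun i _ => by positivity) hterm).trans ?_
    rw [← Real.exp_sum]
    gcongr
    exact sum_geometric_two_le N
  have hsquare : (m + 1) * Real.log x - m * (m + 1) / 2 * Real.log p ≤
      (Real.log x) ^ 2 / (2 * Real.log p) + (1 / 2) * Real.log x + (1 / 8) * Real.log p := by
    have h : 0 ≤ (Real.log x - (m + 1 / 2) * Real.log p) ^ 2 / (2 * Real.log p) := by positivity
    have h' : (Real.log x - (m + 1 / 2) * Real.log p) ^ 2 / (2 * Real.log p) =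
        (Real.log x) ^ 2 / (2 * Real.log p) - (m + 1 / 2) * Real.log x +
          (m + 1 / 2) ^ 2 / 2 * Real.log p := by
      field_simp
      ring
    linarith
  calc ∏ i ∈ Finset.range N, (1 + x / (p : ℝ) ^ i)
      ≤ ∏ i ∈ Finset.range (m + 1 + N), (1 + x / (p : ℝ) ^ i) := by
        rw [Nat.add_comm, Finset.prod_range_add]
        refine le_mul_of_one_le_right (by positivity) (Finset.one_le_prod fun i _ => ?_)
        exact le_add_of_nonneg_right (by positivity)
    _ ≤ Real.exp ((m + 1) * Real.log x - m * (m + 1) / 2 * Real.log p + 2) * Real.exp 2 := by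
        rw [Finset.prod_range_add]
        gcongr
    _ ≤ _ := by
        rw [← Real.exp_add]
        exact Real.exp_le_exp.2 (by linarith)

theorem Fp_le_exp {p : ℕ} (hp : 1 < p) {x : ℝ} (hx : 1 ≤ x) :
    Fp p x ≤ Real.exp ((Real.log x) ^ 2 / (2 * Real.log p) + (1 / 2) * Real.log x +
          (1 / 8) * Real.log p + 4) := by
  have hx0 : 0 < x := by linarith
  have hp0 : (0 : ℝ) < p := by exact_mod_cast (zero_lt_one.trans hp)
  have hpow : ∀ j : ℕ, Real.exp (-1 / x) ^ j = Real.exp (-(j : ℝ) / x) := by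
    intro j
    rw [← Real.exp_nat_mul]
    congr 1
    ring
  have hlt : Real.exp (-1 / x) < 1 :=
    Real.exp_lt_one_iff.2 (div_neg_of_neg_of_pos (by norm_num) hx0)
  refine Real.tsum_le_of_sum_range_le (fun j => by positivity) fun N => ?_
  simp_rw [← hpow]
  refine (sum_ptilde_mul_pow_le hp (Real.exp_pos _).le hlt N).trans
    (le_trans (Finset.prod_le_prod (fun i _ => ?_) fun i _ => ?_)
      (prod_one_add_div_pow_le_exp hp hx N))
  · exact inv_nonneg.2 (sub_nonneg.2 (pow_le_one₀ (Real.exp_pos _).le hlt.le))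
  · have h := inv_one_sub_exp_neg_le (u := (p : ℝ) ^ i / x) (by positivity)
    rwa [inv_div, ← neg_div, ← Nat.cast_pow, ← hpow, Nat.cast_pow] at h

/-- **Lemma 2, upper bound.** There is an absolute constant `C > 0` such that
for every prime `p` and every real `x ≥ 1`,
`log F_p(x) ≤ (log x)²/(2 log p) + (1/2)·log x + (1/8)·log p + C`. -/
theorem log_Fp_upper_bound :
    ∃ C : ℝ, 0 < C ∧ ∀ p : ℕ, p.Prime → ∀ x : ℝ, 1 ≤ x →
      Real.log (Fp p x) ≤
        (Real.log x) ^ 2 / (2 * Real.log p) + (1 / 2) * Real.log x +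
          (1 / 8) * Real.log p + C := by
  refine ⟨4, by norm_num, fun p hp x hx => ?_⟩
  have hF : 0 ≤ Fp p x := tsum_nonneg fun j => by positivity
  rcases hF.eq_or_lt with h0 | hpos
  · rw [← h0, Real.log_zero]
    have := Real.log_nonneg hx
    have : 0 ≤ Real.log p := Real.log_natCast_nonneg p
    positivity
  · exact (Real.log_le_iff_le_exp hpos).2 (Fp_le_exp hp.one_lt hx)
end

section
/- For every prime p and every integer r ≥ 2, one has p̃(p^r) ≥ p^(r(r−1)/2) / (r−1)^(r−1). -/
/-- The multiset with `a i` copies of `p ^ (i + 1)` for each `i < n`, filled up with ones to have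
sum `m`. -/
def powerParts (p m n : ℕ) (a : Fin n → ℕ) : Multiset ℕ :=
  ∑ i, Multiset.replicate (a i) (p ^ (i.val + 1)) +
    Multiset.replicate (m - ∑ i, a i * p ^ (i.val + 1)) 1

lemma sum_powerParts {p m n : ℕ} {a : Fin n → ℕ} (h : ∑ i, a i * p ^ (i.val + 1) ≤ m) :
    (powerParts p m n a).sum = m := by
  simp [powerParts, Multiset.sum_sum, h]

lemma exists_eq_pow_of_mem_powerParts {p m n : ℕ} {a : Fin n → ℕ} {x : ℕ}
    (hx : x ∈ powerParts p m n a) : ∃ i : ℕ, x = p ^ i := by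
  rcases Multiset.mem_add.1 hx with h | h
  · obtain ⟨i, -, hi⟩ := Multiset.mem_sum.1 h
    exact ⟨_, Multiset.eq_of_mem_replicate hi⟩
  · exact ⟨0, by simpa using Multiset.eq_of_mem_replicate h⟩

lemma count_powerParts {p : ℕ} (hp : 1 < p) (m n : ℕ) (a : Fin n → ℕ) (i : Fin n) :
    (powerParts p m n a).count (p ^ (i.val + 1)) = a i := by
  have h1 : 1 ≠ p ^ (i.val + 1) := (Nat.one_lt_pow (by simp) hp).ne
  have h (j : Fin n) : p ^ (j.val + 1) = p ^ (i.val + 1) ↔ j = i := by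
    rw [Nat.pow_right_inj hp, Nat.add_right_cancel_iff, Fin.val_inj]
  simp [powerParts, Multiset.count_sum', Multiset.count_replicate, h, h1]

/-- Distinct choices of multiplicities of `p, p², …, pⁿ`, each power taking up at most the fraction
`1 / n` of `p ^ (n + 1)`, give distinct partitions of `p ^ (n + 1)`. -/
lemma prod_le_ptilde {p : ℕ} (hp : 1 < p) (n : ℕ) :
    ∏ i : Fin n, (p ^ (n - i.val) / n + 1) ≤ ptilde p (p ^ (n + 1)) := by
  have hsum (a : (i : Fin n) → Fin (p ^ (n - i.val) / n + 1)) :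
      ∑ i, (a i).val * p ^ (i.val + 1) ≤ p ^ (n + 1) := by
    calc ∑ i, (a i).val * p ^ (i.val + 1) ≤ ∑ _i : Fin n, p ^ (n + 1) / n := by
          refine Finset.sum_le_sum fun i _ => ?_
          rw [Nat.le_div_iff_mul_le i.pos]
          calc (a i).val * p ^ (i.val + 1) * n = (a i).val * n * p ^ (i.val + 1) := by ring
            _ ≤ p ^ (n - i.val) * p ^ (i.val + 1) := by
              gcongr
              exact (Nat.le_div_iff_mul_le i.pos).1 (Nat.lt_succ_iff.1 (a i).isLt)
            _ = p ^ (n + 1) := by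
              rw [← pow_add]
              congr 1
              omega
      _ ≤ p ^ (n + 1) := by simpa using Nat.mul_div_le (p ^ (n + 1)) n
  let f (a : (i : Fin n) → Fin (p ^ (n - i.val) / n + 1)) :
      {π : Nat.Partition (p ^ (n + 1)) // ∀ x ∈ π.parts, ∃ i : ℕ, x = p ^ i} :=
    ⟨⟨powerParts p (p ^ (n + 1)) n fun i => a i, fun hx => by
        obtain ⟨i, rfl⟩ := exists_eq_pow_of_mem_powerParts hx
        positivity, sum_powerParts (hsum a)⟩, fun _ => exists_eq_pow_of_mem_powerParts⟩
  have hf : Function.Injective f := fun a b hab => by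
    have hparts : powerParts p (p ^ (n + 1)) n (fun i => a i) =
        powerParts p (p ^ (n + 1)) n fun i => b i :=
      congrArg (fun π => π.1.parts) hab
    funext i
    apply Fin.ext
    rw [← count_powerParts hp (p ^ (n + 1)) n (fun i => a i) i, hparts, count_powerParts hp]
  simpa [ptilde, Nat.card_eq_fintype_card] using Nat.card_le_card_of_injective f hf

/-- **Lemma 3, second part.** For every prime `p` and every integer `r ≥ 2`,
`p̃(p^r) ≥ p^(r(r−1)/2) / (r−1)^(r−1)`. -/
theorem ptilde_lower_bound (p : ℕ) (hp : p.Prime) (r : ℕ) (hr : 2 ≤ r) :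
    (p : ℝ) ^ (r * (r - 1) / 2) / ((r : ℝ) - 1) ^ (r - 1) ≤ (ptilde p (p ^ r) : ℝ) := by
  obtain ⟨n, rfl⟩ : ∃ n, r = n + 1 := ⟨r - 1, by omega⟩
  have hexp : ∑ i : Fin n, (n - i.val) = (n + 1) * n / 2 := by
    have h := Finset.sum_range_id (n + 1)
    rw [← Finset.sum_range_reflect, Finset.sum_range_succ] at h
    rw [Fin.sum_univ_eq_sum_range fun i => n - i]
    simpa using h
  calc (p : ℝ) ^ ((n + 1) * (n + 1 - 1) / 2) / (((n + 1 : ℕ) : ℝ) - 1) ^ (n + 1 - 1)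
      = ∏ i : Fin n, (p : ℝ) ^ (n - i.val) / n := by
        simp [Finset.prod_div_distrib, Finset.prod_pow_eq_pow_sum, hexp]
    _ ≤ ∏ i : Fin n, ((p ^ (n - i.val) / n + 1 : ℕ) : ℝ) := by
        refine Finset.prod_le_prod (fun i _ => by positivity) fun i _ => ?_
        have := (Nat.lt_floor_add_one ((p ^ (n - i.val) : ℕ) / (n : ℝ))).le
        rw [Nat.floor_div_eq_div] at this
        exact_mod_cast this
    _ ≤ ptilde p (p ^ (n + 1)) := by exact_mod_cast prod_le_ptilde hp.one_lt n
end
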